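/- arXiv:2207.12860 — 2 statements merged into one kernel-verified Lean document; each statement's English description precedes it below -/
import Mathlib

section
/- Let n, m, l, a be positive integers with n > m > l > 1, n > 550, satisfying |F_n + F_m + F_l - 2^a| < 2^(a/2). Then n < 1.87 × 10^29 and a < 9 × 10^28. -/
section

open Polynomial

/-- A Dirichlet box argument: among more integer vectors than boxes, some nonzero bounded one
makes all the given real linear forms small. -/
theorem exists_int_vec_linear_forms_small {ι κ : Type*} [Fintype ι] [Fintype κ]
    (A : κ → ι → ℝ) {P Z : ℕ} (hP : 0 < P) (hZ : 0 < Z) {B : ℝ} (hB : 0 < B)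
    (hA : ∀ i, ∑ n, |A i n| < B) (hcard : Z ^ Fintype.card κ < (P + 1) ^ Fintype.card ι) :
    ∃ p : ι → ℤ, p ≠ 0 ∧ (∀ n, |p n| ≤ P) ∧ ∀ i, |∑ n, (p n : ℝ) * A i n| ≤ P * B / Z := by
  classical
  have hP' : (0 : ℝ) < P := by exact_mod_cast hP
  have hZ' : (0 : ℝ) < Z := by exact_mod_cast hZ
  let y : (ι → Fin (P + 1)) → κ → ℝ := fun u i =>
    ∑ n, ((u n : ℕ) : ℝ) * A i n - ∑ n, (P : ℝ) * min (A i n) 0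
  have hy0 : ∀ u i, 0 ≤ y u i := by
    intro u i
    simp only [y]
    rw [← Finset.sum_sub_distrib]
    refine Finset.sum_nonneg fun n _ => ?_
    have h1 : ((u n : ℕ) : ℝ) ≤ P := by exact_mod_cast Nat.lt_succ_iff.mp (u n).2
    have h2 : (0 : ℝ) ≤ ((u n : ℕ) : ℝ) := Nat.cast_nonneg _
    rcases le_total (A i n) 0 with h | h
    · rw [min_eq_left h]; nlinarith
    · rw [min_eq_right h]; nlinarith
  have hy1 : ∀ u i, y u i < P * B := by
    intro u i
    refine lt_of_le_of_lt ?_ (mul_lt_mul_of_pos_left (hA i) hP')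
    simp only [y]
    rw [← Finset.sum_sub_distrib, Finset.mul_sum]
    refine Finset.sum_le_sum fun n _ => ?_
    have h1 : ((u n : ℕ) : ℝ) ≤ P := by exact_mod_cast Nat.lt_succ_iff.mp (u n).2
    have h2 : (0 : ℝ) ≤ ((u n : ℕ) : ℝ) := Nat.cast_nonneg _
    rcases le_total (A i n) 0 with h | h
    · rw [min_eq_left h, abs_of_nonpos h]; nlinarith
    · rw [min_eq_right h, abs_of_nonneg h]; nlinarith
  let f : (ι → Fin (P + 1)) → κ → Fin Z := fun u i =>
    ⟨⌊y u i * Z / (P * B)⌋₊, by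
      rw [Nat.floor_lt (by have := hy0 u i; positivity), div_lt_iff₀ (by positivity)]
      have := hy1 u i
      nlinarith⟩
  obtain ⟨u, v, huv, hf⟩ := Fintype.exists_ne_map_eq_of_card_lt f (by simpa using hcard)
  refine ⟨fun n => ((u n : ℕ) : ℤ) - ((v n : ℕ) : ℤ), ?_, ?_, ?_⟩
  · intro h
    apply huv
    ext n
    have := congrFun h n
    simp only [Pi.zero_apply] at this
    omega
  · intro n
    have h1 := (u n).2
    have h2 := (v n).2
    show |((u n : ℕ) : ℤ) - ((v n : ℕ) : ℤ)| ≤ P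
    rw [abs_le]
    constructor <;> omega
  · intro i
    have h1 : ∑ n, (((((u n : ℕ) : ℤ) - ((v n : ℕ) : ℤ) : ℤ)) : ℝ) * A i n = y u i - y v i := by
      simp only [y]
      push_cast
      simp only [sub_mul, Finset.sum_sub_distrib]
      ring
    have h2 : ⌊y u i * Z / (P * B)⌋₊ = ⌊y v i * Z / (P * B)⌋₊ := by
      have := congrFun hf i
      simpa [f] using this
    have h3 : |y u i * Z / (P * B) - y v i * Z / (P * B)| < 1 := by
      have hu := Nat.floor_le (a := y u i * Z / (P * B)) (by have := hy0 u i; positivity)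
      have hv := Nat.floor_le (a := y v i * Z / (P * B)) (by have := hy0 v i; positivity)
      have hu' := Nat.lt_floor_add_one (y u i * Z / (P * B))
      have hv' := Nat.lt_floor_add_one (y v i * Z / (P * B))
      rw [h2] at hu hu'
      rw [abs_lt]
      constructor <;> linarith
    rw [h1, le_div_iff₀ hZ']
    have h4 : |y u i * Z / (P * B) - y v i * Z / (P * B)| = |y u i - y v i| * Z / (P * B) := by
      rw [← sub_div, ← sub_mul, abs_div, abs_mul (_ - _), abs_of_pos hZ',
        abs_of_pos (mul_pos hP' hB)]
    rw [h4, div_lt_one (by positivity)] at h3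
    exact h3.le

theorem coeff_prod_sum_of_natDegree_le {ι R : Type*} [CommRing R] (s : Finset ι) (f : ι → R[X])
    (d : ι → ℕ) (h : ∀ i ∈ s, (f i).natDegree ≤ d i) :
    (∏ i ∈ s, f i).coeff (∑ i ∈ s, d i) = ∏ i ∈ s, (f i).coeff (d i) := by
  classical
  induction s using Finset.induction_on with
  | empty => simp
  | insert a s ha ih =>
    have hs : ∀ i ∈ s, (f i).natDegree ≤ d i := fun i hi => h i (Finset.mem_insert_of_mem hi)
    rw [Finset.prod_insert ha, Finset.sum_insert ha, Finset.prod_insert ha,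
      coeff_mul_add_eq_of_natDegree_le (h a (Finset.mem_insert_self a s)), ih hs]
    exact (natDegree_prod_le s f).trans (Finset.sum_le_sum hs)

theorem det_shift_ne_zero {L : ℕ} (Q : Fin L → ℝ[X]) (hQ : ∀ l, Q l ≠ 0) {x : ℝ} (hx : 0 < x)
    (hx1 : x ≠ 1) :
    (Matrix.of fun i l : Fin L => C ((x ^ (l : ℕ)) ^ (i : ℕ)) * (Q l).comp (X + C (i : ℝ))).det
      ≠ 0 := by
  intro h0
  have hc := congrArg (fun p => p.coeff (∑ l, (Q l).natDegree)) h0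
  have hdeg : ∀ i l : Fin L,
      (C ((x ^ (l : ℕ)) ^ (i : ℕ)) * (Q l).comp (X + C (i : ℝ))).natDegree ≤ (Q l).natDegree := by
    intro i l
    refine (natDegree_C_mul_le _ _).trans ?_
    rw [natDegree_comp, natDegree_X_add_C, mul_one]
  have hcoef : ∀ i l : Fin L,
      (C ((x ^ (l : ℕ)) ^ (i : ℕ)) * (Q l).comp (X + C (i : ℝ))).coeff (Q l).natDegree
        = (x ^ (l : ℕ)) ^ (i : ℕ) * (Q l).leadingCoeff := by
    intro i l
    rw [coeff_C_mul]
    congr 1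
    have h1 : ((Q l).comp (X + C (i : ℝ))).natDegree = (Q l).natDegree := by
      rw [natDegree_comp, natDegree_X_add_C, mul_one]
    conv_lhs => rw [← h1]
    rw [coeff_natDegree, leadingCoeff_comp (by rw [natDegree_X_add_C]; exact one_ne_zero),
      leadingCoeff_X_add_C, one_pow, mul_one]
  have key : (∑ σ : Equiv.Perm (Fin L), ((Equiv.Perm.sign σ : ℤ) : ℝ) *
      ∏ l : Fin L, ((x ^ (l : ℕ)) ^ ((σ l : Fin L) : ℕ) * (Q l).leadingCoeff)) = 0 := by
    simp only [Matrix.det_apply, finsetSum_coeff, coeff_zero] at hc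
    rw [← hc]
    refine Finset.sum_congr rfl fun σ _ => ?_
    rw [Units.smul_def, coeff_smul, zsmul_eq_mul]
    congr 1
    simp only [Matrix.of_apply]
    rw [coeff_prod_sum_of_natDegree_le _ _ _ fun l _ => hdeg (σ l) l]
    exact Finset.prod_congr rfl fun l _ => (hcoef (σ l) l).symm
  have hv : (Matrix.vandermonde fun l : Fin L => x ^ (l : ℕ)).det ≠ 0 := by
    rw [Matrix.det_vandermonde_ne_zero_iff]
    intro a b hab
    exact Fin.ext (pow_right_injective₀ hx hx1 hab)
  have hl : (∏ l, (Q l).leadingCoeff) ≠ 0 :=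
    Finset.prod_ne_zero_iff.mpr fun l _ => leadingCoeff_ne_zero.mpr (hQ l)
  apply mul_ne_zero hv hl
  rw [← Matrix.det_transpose, Matrix.det_apply, Finset.sum_mul, ← key]
  refine Finset.sum_congr rfl fun σ _ => ?_
  rw [Finset.prod_mul_distrib, Units.smul_def, zsmul_eq_mul, mul_assoc]
  simp [Matrix.vandermonde_apply]

/-- A zero estimate for polynomials in two variables along shifted points. -/
theorem card_le_of_vanish {L K : ℕ} (Q : Fin L → ℝ[X]) (hdeg : ∀ l, (Q l).natDegree ≤ K)
    (hne : ∃ l, Q l ≠ 0) {x : ℝ} (hx : 0 < x) (hx1 : x ≠ 1) (s : Finset ℝ) (y : ℝ → ℝ)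
    (hy : ∀ t ∈ s, y t ≠ 0)
    (h : ∀ t ∈ s, ∀ i : Fin L, ∑ l, (Q l).eval (t + (i : ℕ)) * (x ^ (i : ℕ) * y t) ^ (l : ℕ) = 0) :
    s.card ≤ L * K := by
  classical
  let R : Fin L → ℝ[X] := fun l => if Q l = 0 then 1 else Q l
  have hR : ∀ l, R l ≠ 0 := by
    intro l
    by_cases h : Q l = 0 <;> simp [R, h]
  have hRdeg : ∀ l, (R l).natDegree ≤ K := by
    intro l
    by_cases h : Q l = 0
    · simp [R, h]
    · simpa [R, h] using hdeg l
  have hdet := det_shift_ne_zero R hR hx hx1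
  set M := Matrix.of fun i l : Fin L => C ((x ^ (l : ℕ)) ^ (i : ℕ)) * (R l).comp (X + C (i : ℝ))
    with hM
  have hMdeg : M.det.natDegree ≤ L * K := by
    rw [Matrix.det_apply]
    refine natDegree_sum_le_of_forall_le _ _ fun σ _ => ?_
    refine (natDegree_smul_le _ _).trans ((natDegree_prod_le _ _).trans ?_)
    calc _ ≤ ∑ _l : Fin L, K := by
          refine Finset.sum_le_sum fun l _ => ?_
          simp only [hM, Matrix.of_apply]
          refine (natDegree_C_mul_le _ _).trans ?_
          rw [natDegree_comp, natDegree_X_add_C, mul_one]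
          exact hRdeg l
      _ = L * K := by simp
  have hroot : ∀ t ∈ s, M.det.IsRoot t := by
    intro t ht
    obtain ⟨l₀, hl₀⟩ := hne
    have : (M.map (evalRingHom t)).det = 0 := by
      rw [← Matrix.exists_mulVec_eq_zero_iff]
      refine ⟨fun l => if Q l = 0 then 0 else y t ^ (l : ℕ), ?_, ?_⟩
      · intro h0
        have := congrFun h0 l₀
        simp [hl₀, hy t ht] at this
      · ext i
        refine Eq.trans ?_ (h t ht i)
        simp only [Matrix.mulVec, dotProduct]
        refine Finset.sum_congr rfl fun l _ => ?_
        by_cases hl : Q l = 0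
        · simp [hl]
        · simp only [hM, R, hl, Matrix.map_apply, Matrix.of_apply, if_false, coe_evalRingHom,
            eval_mul, eval_C, eval_comp, eval_add, eval_X]
          rw [mul_pow, ← pow_mul, ← pow_mul, mul_comm (l : ℕ)]
          ring
    rw [IsRoot.def, ← coe_evalRingHom, RingHom.map_det]
    exact this
  calc s.card ≤ M.det.roots.toFinset.card := by
        refine Finset.card_le_card fun t ht => ?_
        rw [Multiset.mem_toFinset, mem_roots hdet]
        exact hroot t ht
    _ ≤ M.det.roots.card := Multiset.toFinset_card_le _
    _ ≤ M.det.natDegree := card_roots' _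
    _ ≤ L * K := hMdeg

/-- `x` and `y` are an element of `ℤ[φ]` and its conjugate. -/
def IsConjPair (x y : ℝ) : Prop :=
  ∃ a b : ℤ, x = a + b * Real.goldenRatio ∧ y = a + b * Real.goldenConj

namespace IsConjPair

theorem intCast (a : ℤ) : IsConjPair a a := ⟨a, 0, by simp, by simp⟩

theorem natCast (a : ℕ) : IsConjPair a a := ⟨a, 0, by simp, by simp⟩

theorem one : IsConjPair 1 1 := ⟨1, 0, by simp, by simp⟩

theorem goldenRatio : IsConjPair Real.goldenRatio Real.goldenConj := ⟨0, 1, by simp, by simp⟩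

theorem add {x y u v : ℝ} (h : IsConjPair x y) (h' : IsConjPair u v) :
    IsConjPair (x + u) (y + v) := by
  obtain ⟨a, b, rfl, rfl⟩ := h
  obtain ⟨c, d, rfl, rfl⟩ := h'
  exact ⟨a + c, b + d, by push_cast; ring, by push_cast; ring⟩

theorem mul {x y u v : ℝ} (h : IsConjPair x y) (h' : IsConjPair u v) :
    IsConjPair (x * u) (y * v) := by
  obtain ⟨a, b, rfl, rfl⟩ := h
  obtain ⟨c, d, rfl, rfl⟩ := h'
  refine ⟨a * c + b * d, a * d + b * c + b * d, ?_, ?_⟩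
  · push_cast
    linear_combination (b * d : ℝ) * Real.goldenRatio_sq
  · push_cast
    linear_combination (b * d : ℝ) * Real.goldenConj_sq

theorem pow {x y : ℝ} (h : IsConjPair x y) (n : ℕ) : IsConjPair (x ^ n) (y ^ n) := by
  induction n with
  | zero => simpa using one
  | succ n ih => simpa [pow_succ] using ih.mul h

theorem sum {ι : Type*} (s : Finset ι) {f g : ι → ℝ} (h : ∀ i ∈ s, IsConjPair (f i) (g i)) :
    IsConjPair (∑ i ∈ s, f i) (∑ i ∈ s, g i) := by
  classical
  induction s using Finset.induction_on with
  | empty => simpa using intCast 0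
  | insert a s ha ih =>
    rw [Finset.sum_insert ha, Finset.sum_insert ha]
    exact (h a (Finset.mem_insert_self a s)).add
      (ih fun i hi => h i (Finset.mem_insert_of_mem hi))

/-- A nonzero element of `ℤ[φ]` has norm at least one. -/
theorem eq_zero {x y : ℝ} (h : IsConjPair x y) (hlt : |x * y| < 1) : x = 0 := by
  obtain ⟨a, b, rfl, rfl⟩ := h
  have h1 : ((a + b * Real.goldenRatio) * (a + b * Real.goldenConj) : ℝ)
      = ((a ^ 2 + a * b - b ^ 2 : ℤ) : ℝ) := by
    push_cast
    linear_combination (a * b : ℝ) * Real.goldenRatio_add_goldenConj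
      + (b ^ 2 : ℝ) * Real.goldenRatio_mul_goldenConj
  have h2 : (a ^ 2 + a * b - b ^ 2 : ℤ) = 0 := by
    rw [h1] at hlt
    rw [← Int.abs_lt_one_iff]
    exact_mod_cast hlt
  rw [h2, Int.cast_zero, mul_eq_zero] at h1
  by_cases hb : b = 0
  · subst hb
    rcases h1 with h | h <;> simpa using h
  · rcases h1 with h | h
    · exact h
    · exfalso
      have hb' : (b : ℝ) ≠ 0 := by exact_mod_cast hb
      apply Real.goldenConj_irrational
      refine ⟨-a / b, ?_⟩
      push_cast
      rw [div_eq_iff hb']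
      linarith

end IsConjPair

/-- Coefficientwise domination of a real polynomial by another one. -/
def CoeffDominated (p q : ℝ[X]) : Prop := ∀ i, |p.coeff i| ≤ q.coeff i

namespace CoeffDominated

theorem mul {p q r s : ℝ[X]} (h : CoeffDominated p q) (h' : CoeffDominated r s) :
    CoeffDominated (p * r) (q * s) := by
  intro i
  rw [coeff_mul, coeff_mul]
  refine (Finset.abs_sum_le_sum_abs _ _).trans (Finset.sum_le_sum fun x _ => ?_)
  rw [abs_mul]
  exact mul_le_mul (h _) (h' _) (abs_nonneg _) ((abs_nonneg _).trans (h _))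

theorem sum {ι : Type*} (s : Finset ι) {f g : ι → ℝ[X]}
    (h : ∀ i ∈ s, CoeffDominated (f i) (g i)) : CoeffDominated (∑ i ∈ s, f i) (∑ i ∈ s, g i) := by
  intro i
  rw [finsetSum_coeff, finsetSum_coeff]
  exact (Finset.abs_sum_le_sum_abs _ _).trans (Finset.sum_le_sum fun x hx => h x hx i)

theorem monomial {a b : ℝ} (h : |a| ≤ b) (n : ℕ) :
    CoeffDominated (monomial n a) (monomial n b) := by
  intro i
  rw [coeff_monomial, coeff_monomial]
  split_ifs <;> simp [h]

theorem X_sub_C_X_add_C {a b : ℝ} (h : |a| ≤ b) : CoeffDominated (X - C a) (X + C b) := by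
  intro i
  rcases i with _ | _ | i
  · simpa using h
  · simp
  · simp [coeff_X]

theorem descPochhammer {k K : ℕ} (h : k ≤ K) :
    CoeffDominated (descPochhammer ℝ k) ((X + C (K : ℝ)) ^ k) := by
  induction k with
  | zero =>
    intro i
    simp only [descPochhammer_zero, pow_zero, coeff_one]
    split_ifs <;> simp
  | succ k ih =>
    rw [descPochhammer_succ_right, pow_succ]
    refine (ih (by omega)).mul ?_
    have h1 : |(k : ℝ)| ≤ K := by
      rw [abs_of_nonneg (by positivity)]
      exact_mod_cast (by omega : k ≤ K)
    simpa using X_sub_C_X_add_C h1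

theorem abs_coeff_mul_pow_le {p q : ℝ[X]} (h : CoeffDominated p q) {T : ℝ} (hT : 0 ≤ T) (i : ℕ) :
    |p.coeff i * T ^ i| ≤ q.eval T := by
  have h0 : ∀ i, 0 ≤ q.coeff i * T ^ i := fun i =>
    mul_nonneg ((abs_nonneg _).trans (h i)) (pow_nonneg hT i)
  rw [abs_mul, abs_of_nonneg (pow_nonneg hT i)]
  refine (mul_le_mul_of_nonneg_right (h i) (pow_nonneg hT i)).trans ?_
  by_cases hi : i ≤ q.natDegree
  · rw [eval_eq_sum_range]
    exact Finset.single_le_sum (f := fun i => q.coeff i * T ^ i) (fun i _ => h0 i)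
      (Finset.mem_range.mpr (Nat.lt_succ_of_le hi))
  · rw [coeff_eq_zero_of_natDegree_lt (by omega), zero_mul, eval_eq_sum_range]
    exact Finset.sum_nonneg fun i _ => h0 i

end CoeffDominated

/-- The polynomial `X (X - 1) ⋯ (X - k + 1) / k!`. -/
noncomputable def binomPoly (k : ℕ) : ℝ[X] := monomial 0 (1 / (k.factorial : ℝ)) * descPochhammer ℝ k

/-- The Taylor polynomial of order `J` of `t ↦ exp (x t)`. -/
noncomputable def expPoly (J : ℕ) (x : ℝ) : ℝ[X] :=
  ∑ i ∈ Finset.range J, monomial i (x ^ i / (i.factorial : ℝ))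

theorem natDegree_binomPoly_le (k : ℕ) : (binomPoly k).natDegree ≤ k := by
  unfold binomPoly
  refine natDegree_mul_le.trans ?_
  simp [descPochhammer_natDegree]

theorem binomPoly_eval (k t : ℕ) : (binomPoly k).eval (t : ℝ) = t.choose k := by
  unfold binomPoly
  rw [eval_mul, descPochhammer_eval_eq_descFactorial, Nat.descFactorial_eq_factorial_mul_choose]
  have : (k.factorial : ℝ) ≠ 0 := by exact_mod_cast k.factorial_ne_zero
  simp
  field_simp

theorem natDegree_expPoly_lt {J : ℕ} (hJ : 0 < J) (x : ℝ) : (expPoly J x).natDegree < J := by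
  have : (expPoly J x).natDegree ≤ J - 1 := by
    refine natDegree_sum_le_of_forall_le _ _ fun i hi => ?_
    refine (natDegree_monomial_le _).trans ?_
    have := Finset.mem_range.mp hi
    omega
  omega

theorem expPoly_eval (J : ℕ) (x t : ℝ) :
    (expPoly J x).eval t = ∑ i ∈ Finset.range J, (x * t) ^ i / (i.factorial : ℝ) := by
  unfold expPoly
  rw [eval_finsetSum]
  refine Finset.sum_congr rfl fun i _ => ?_
  rw [eval_monomial, mul_pow]
  ring

theorem abs_coeff_binomPoly_mul_expPoly_le {k K J : ℕ} (hk : k ≤ K) {x y T : ℝ} (hxy : |x| ≤ y)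
    (hT : 0 ≤ T) (i : ℕ) :
    |(binomPoly k * expPoly J x).coeff i * T ^ i| ≤
      (T + K) ^ k / k.factorial * Real.exp (y * T) := by
  have hy : 0 ≤ y := (abs_nonneg x).trans hxy
  have h1 : CoeffDominated (binomPoly k)
      (monomial 0 (1 / (k.factorial : ℝ)) * (X + C (K : ℝ)) ^ k) :=
    (CoeffDominated.monomial (by rw [abs_of_nonneg (by positivity)]) 0).mul
      (CoeffDominated.descPochhammer hk)
  have h2 : CoeffDominated (expPoly J x) (expPoly J y) := by
    refine CoeffDominated.sum _ fun i _ => CoeffDominated.monomial ?_ i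
    rw [abs_div, abs_pow, abs_of_nonneg (by positivity : (0 : ℝ) ≤ (i.factorial : ℝ))]
    gcongr
  refine ((h1.mul h2).abs_coeff_mul_pow_le hT i).trans ?_
  rw [eval_mul, expPoly_eval]
  have h3 : (monomial 0 (1 / (k.factorial : ℝ)) * (X + C (K : ℝ)) ^ k).eval T
      = (T + K) ^ k / k.factorial := by
    simp
    ring
  rw [h3]
  exact mul_le_mul_of_nonneg_left (Real.sum_le_exp_of_nonneg (by positivity) J) (by positivity)

theorem pow_div_factorial_le_two_pow {k K c b : ℕ} (hk : k ≤ K) (hc : 3 * c ≤ 2 ^ b) (hc0 : 0 < c)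
    {u : ℝ} (hu0 : 0 ≤ u) (hu : u ≤ c * K) : u ^ k / k.factorial ≤ 2 ^ (b * K) := by
  have hc1 : (1 : ℝ) ≤ c := by exact_mod_cast hc0
  calc u ^ k / k.factorial ≤ (c * K : ℝ) ^ k / k.factorial := by gcongr
    _ = (c : ℝ) ^ k * ((K : ℝ) ^ k / k.factorial) := by rw [mul_pow]; ring
    _ ≤ (c : ℝ) ^ K * Real.exp K := by
        exact mul_le_mul (pow_le_pow_right₀ hc1 hk)
          (Real.pow_div_factorial_le_exp _ (by positivity) k) (by positivity) (by positivity)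
    _ ≤ (c : ℝ) ^ K * 3 ^ K := by
        gcongr
        rw [← mul_one (K : ℝ), Real.exp_nat_mul]
        gcongr
        exact Real.exp_one_lt_three.le
    _ = ((3 * c : ℕ) : ℝ) ^ K := by push_cast; ring
    _ ≤ ((2 ^ b : ℕ) : ℝ) ^ K := by gcongr
    _ = 2 ^ (b * K) := by push_cast; rw [pow_mul]

theorem pow_div_factorial_le_half_pow {J e : ℕ} (hJ : 0 < J) {w : ℝ} (hw : 0 ≤ w)
    (h : 3 * w * 2 ^ e ≤ J) : w ^ J / J.factorial ≤ (1 / 2) ^ (e * J) := by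
  have hJ' : (0 : ℝ) < J := by exact_mod_cast hJ
  calc w ^ J / J.factorial = (w / J) ^ J * ((J : ℝ) ^ J / J.factorial) := by
        rw [div_pow]; field_simp
    _ ≤ (w / J) ^ J * 3 ^ J := by
        gcongr
        refine (Real.pow_div_factorial_le_exp _ hJ'.le J).trans ?_
        rw [← mul_one (J : ℝ), Real.exp_nat_mul]
        gcongr
        exact Real.exp_one_lt_three.le
    _ = (3 * w / J) ^ J := by rw [← mul_pow]; ring
    _ ≤ ((1 / 2) ^ e) ^ J := by
        gcongr
        rw [div_le_iff₀ hJ', div_pow, one_pow, div_mul_eq_mul_div, one_mul, le_div_iff₀ (by positivity)]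
        exact h
    _ = (1 / 2) ^ (e * J) := by rw [pow_mul]

theorem exp_sub_sum_le {y : ℝ} (hy : 0 ≤ y) (J : ℕ) :
    Real.exp y - ∑ i ∈ Finset.range J, y ^ i / (i.factorial : ℝ) ≤
      y ^ J / J.factorial * Real.exp y := by
  have h : HasSum (fun n : ℕ => y ^ n / (n.factorial : ℝ)) (Real.exp y) := by
    rw [Real.exp_eq_exp_ℝ]
    exact NormedSpace.expSeries_div_hasSum_exp y
  have h1 := (hasSum_nat_add_iff' J).mpr h
  refine hasSum_le (fun i => ?_) h1 (h.mul_left _)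
  rw [pow_add, div_mul_div_comm, mul_comm (y ^ J)]
  refine div_le_div_of_nonneg_left (by positivity) (by positivity) ?_
  rw [add_comm i J]
  exact_mod_cast Nat.le_of_dvd (Nat.factorial_pos _) (Nat.factorial_mul_factorial_dvd_factorial_add J i)

theorem abs_exp_add_sub_sum_le {u v w : ℝ} (hu : |u| ≤ w) (hv : |v| ≤ 1) {J : ℕ} :
    |Real.exp (u + v) - ∑ i ∈ Finset.range J, u ^ i / (i.factorial : ℝ)| ≤
      Real.exp w * (2 * |v| + w ^ J / J.factorial) := by
  have h1 : |Real.exp u - ∑ i ∈ Finset.range J, u ^ i / (i.factorial : ℝ)|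
      ≤ |u| ^ J / J.factorial * Real.exp |u| := by
    have := Complex.norm_exp_sub_sum_le_exp_norm_sub_sum (u : ℂ) J
    have h2 : Complex.exp u - ∑ m ∈ Finset.range J, (u : ℂ) ^ m / m.factorial
        = ((Real.exp u - ∑ i ∈ Finset.range J, u ^ i / (i.factorial : ℝ) : ℝ) : ℂ) := by
      push_cast; rfl
    rw [h2, Complex.norm_real, Complex.norm_real, Real.norm_eq_abs, Real.norm_eq_abs] at this
    exact this.trans (exp_sub_sum_le (abs_nonneg u) J)
  have h3 : |Real.exp v - 1| ≤ 2 * |v| := Real.abs_exp_sub_one_le hv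
  have h4 : Real.exp u ≤ Real.exp w := Real.exp_le_exp.mpr ((le_abs_self u).trans hu)
  have hw : 0 ≤ w := (abs_nonneg u).trans hu
  have h5 : |u| ^ J / J.factorial * Real.exp |u| ≤ w ^ J / J.factorial * Real.exp w := by
    gcongr
  have h6 : Real.exp (u + v) - ∑ i ∈ Finset.range J, u ^ i / (i.factorial : ℝ) =
    Real.exp u * (Real.exp v - 1)
     + (Real.exp u - ∑ i ∈ Finset.range J, u ^ i / (i.factorial : ℝ)) := by
    rw [Real.exp_add]; ring
  rw [h6]
  refine (abs_add_le _ _).trans ?_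
  rw [abs_mul, abs_of_pos (Real.exp_pos u)]
  have := mul_le_mul h4 h3 (abs_nonneg _) (Real.exp_pos w).le
  linarith

theorem exists_small_exp_poly {L j π b X e K T c : ℕ} {ω : ℝ} (hK : 0 < K) (hL : 0 < L)
    (hj : 0 < j) (hc0 : 0 < c) (hπ : X * (1 + j) ≤ π * L) (he : X ≤ e * j) (hTK : T + K ≤ c * K)
    (hcb : 3 * c ≤ 2 ^ b) (hω : 3 * (L * |ω| * T) * 2 ^ e ≤ j * K) (hω' : L * |ω| * T ≤ K / 2) :
    ∃ p : Fin K × Fin L → ℤ, p ≠ 0 ∧ (∀ x, |(p x : ℝ)| ≤ 2 ^ (π * K)) ∧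
      ∀ t ≤ T, ∀ v : ℝ, L * |v| ≤ 1 →
        |∑ x : Fin K × Fin L, (p x : ℝ) * (t.choose x.1 * Real.exp (x.2 * (ω * t + v)))| ≤
          2 ^ (π * K) * (K * L) * 2 ^ ((b + 1) * K) *
            (2 * (L * |v|) + (j * K + K + 1) / 2 ^ (X * K)) := by
  set w : ℝ := L * |ω| * T with hw
  have hw0 : 0 ≤ w := by positivity
  have hK' : (0 : ℝ) < K := by exact_mod_cast hK
  have hL' : (0 : ℝ) < L := by exact_mod_cast hL
  have hexp : Real.exp w < 2 ^ K := by
    have h1 : Real.exp (1 / 2) < 2 := by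
      have h2 : Real.exp (1 / 2) ^ 2 < 3 := by
        rw [← Real.exp_nat_mul]; norm_num
        exact Real.exp_one_lt_three
      nlinarith [Real.exp_pos (1 / 2)]
    calc Real.exp w ≤ Real.exp (K * (1 / 2)) := Real.exp_le_exp.mpr (by linarith)
      _ = Real.exp (1 / 2) ^ K := Real.exp_nat_mul _ _
      _ < 2 ^ K := by
        gcongr
  have hchoose : ∀ k < K, ((T : ℝ) + K) ^ k / k.factorial ≤ 2 ^ (b * K) := fun k hk =>
    pow_div_factorial_le_two_pow hk.le hcb hc0 (by positivity) (by exact_mod_cast hTK)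
  have hlω : ∀ l < L, |(l : ℝ) * ω| ≤ L * |ω| := by
    intro l hl
    rw [abs_mul, abs_of_nonneg (Nat.cast_nonneg l)]
    gcongr
  have hpow : (2 : ℝ) ^ ((b + 1) * K) = 2 ^ (b * K) * 2 ^ K := by rw [← pow_add]; ring_nf
  let Q : Fin K × Fin L → ℝ[X] := fun x => binomPoly x.1 * expPoly (j * K) (x.2 * ω)
  have hcoef : ∀ x : Fin K × Fin L, ∀ i, |(Q x).coeff i * (T : ℝ) ^ i| < 2 ^ ((b + 1) * K) := by
    intro x i
    refine (abs_coeff_binomPoly_mul_expPoly_le x.1.2.le (hlω _ x.2.2) (by positivity) i).trans_lt ?_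
    rw [hpow]
    exact mul_lt_mul' (hchoose _ x.1.2) hexp (Real.exp_pos _).le (by positivity)
  have hdegQ : ∀ x, (Q x).natDegree < K + j * K := by
    intro x
    refine natDegree_mul_le.trans_lt ?_
    have h1 := natDegree_binomPoly_le x.1
    have h2 := natDegree_expPoly_lt (J := j * K) (Nat.mul_pos hj hK) (x.2 * ω)
    have := x.1.2
    omega
  obtain ⟨p, hp0, hpP, hp⟩ := exists_int_vec_linear_forms_small
    (fun (i : Fin (K + j * K)) (x : Fin K × Fin L) => (Q x).coeff i * (T : ℝ) ^ (i : ℕ))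
    (P := 2 ^ (π * K)) (Z := 2 ^ (X * K)) (by positivity) (by positivity)
    (B := (K * L) * 2 ^ ((b + 1) * K)) (by positivity)
    (by
      intro i
      have : Nonempty (Fin K × Fin L) := ⟨⟨⟨0, hK⟩, ⟨0, hL⟩⟩⟩
      calc _ < ∑ _x : Fin K × Fin L, (2 : ℝ) ^ ((b + 1) * K) :=
            Finset.sum_lt_sum_of_nonempty Finset.univ_nonempty fun x _ => hcoef x i
        _ = _ := by simp)
    (by
      rw [Fintype.card_fin, Fintype.card_prod, Fintype.card_fin, Fintype.card_fin]
      calc (2 ^ (X * K)) ^ (K + j * K) = 2 ^ (X * (1 + j) * (K * K)) := by rw [← pow_mul]; ring_nf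
        _ ≤ 2 ^ (π * L * (K * K)) := by gcongr; norm_num
        _ = (2 ^ (π * K)) ^ (K * L) := by rw [← pow_mul]; ring_nf
        _ < _ := by
          apply Nat.pow_lt_pow_left (Nat.lt_succ_self _)
          positivity)
  have hpP' : ∀ x, |(p x : ℝ)| ≤ 2 ^ (π * K) := fun x => by exact_mod_cast hpP x
  refine ⟨p, hp0, hpP', fun t ht v hv => ?_⟩
  have htT : (t : ℝ) ≤ T := by exact_mod_cast ht
  have hG : |∑ x, (p x : ℝ) * (Q x).eval (t : ℝ)| ≤
      2 ^ (π * K) * (K * L) * 2 ^ ((b + 1) * K) * ((j * K + K) / 2 ^ (X * K)) := by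
    have h1 : ∑ x, (p x : ℝ) * (Q x).eval (t : ℝ) =
        ∑ i : Fin (K + j * K), ∑ x, (p x : ℝ) * ((Q x).coeff i * (t : ℝ) ^ (i : ℕ)) := by
      rw [Finset.sum_comm]
      refine Finset.sum_congr rfl fun x _ => ?_
      rw [eval_eq_sum_range' (hdegQ x), ← Finset.mul_sum, Finset.sum_range]
    rw [h1]
    refine (Finset.abs_sum_le_sum_abs _ _).trans ?_
    have h2 : ∀ i : Fin (K + j * K),
        |∑ x, (p x : ℝ) * ((Q x).coeff i * (t : ℝ) ^ (i : ℕ))| ≤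
          2 ^ (π * K) * ((K * L) * 2 ^ ((b + 1) * K)) / 2 ^ (X * K) := by
      intro i
      have h3 := hp i
      simp only [← mul_assoc] at h3 ⊢
      rw [← Finset.sum_mul, abs_mul] at h3 ⊢
      refine le_trans ?_ (h3.trans (le_of_eq ?_))
      · gcongr
      · push_cast; ring
    refine (Finset.sum_le_sum fun i _ => h2 i).trans (le_of_eq ?_)
    simp
    ring
  have hF : |∑ x : Fin K × Fin L, (p x : ℝ) * (t.choose x.1 * Real.exp (x.2 * (ω * t + v)))
      - ∑ x, (p x : ℝ) * (Q x).eval (t : ℝ)| ≤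
      2 ^ (π * K) * (K * L) * 2 ^ ((b + 1) * K) * (2 * (L * |v|) + 1 / 2 ^ (X * K)) := by
    rw [← Finset.sum_sub_distrib]
    refine (Finset.abs_sum_le_sum_abs _ _).trans ?_
    have h2 : ∀ x : Fin K × Fin L,
        |(p x : ℝ) * (t.choose x.1 * Real.exp (x.2 * (ω * t + v))) - (p x : ℝ) * (Q x).eval (t : ℝ)|
          ≤ 2 ^ (π * K) * (2 ^ (b * K) * (2 ^ K * (2 * (L * |v|) + 1 / 2 ^ (X * K)))) := by
      intro x
      have hx : ((x.2 : ℕ) : ℝ) ≤ L := by exact_mod_cast x.2.2.le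
      have h3 : (Q x).eval (t : ℝ) = t.choose x.1 *
          ∑ i ∈ Finset.range (j * K), ((x.2 : ℕ) * ω * t) ^ i / (i.factorial : ℝ) := by
        simp only [Q]
        rw [eval_mul, binomPoly_eval, expPoly_eval]
      have hch : ((t.choose x.1 : ℕ) : ℝ) ≤ 2 ^ (b * K) := by
        refine (Nat.choose_le_pow_div (α := ℝ) _ _).trans (le_trans ?_ (hchoose _ x.1.2))
        gcongr
        linarith
      have hvx : |((x.2 : ℕ) : ℝ) * v| ≤ L * |v| := by
        rw [abs_mul, abs_of_nonneg (Nat.cast_nonneg _)]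
        gcongr
      have h4 := abs_exp_add_sub_sum_le (u := (x.2 : ℕ) * ω * t) (v := (x.2 : ℕ) * v) (w := w)
        (by
          rw [abs_mul, hw, abs_of_nonneg (Nat.cast_nonneg t : (0 : ℝ) ≤ t)]
          have := hlω _ x.2.2
          gcongr) (hvx.trans hv) (J := j * K)
      have h5 : w ^ (j * K) / ((j * K).factorial : ℝ) ≤ 1 / 2 ^ (X * K) := by
        refine (pow_div_factorial_le_half_pow (Nat.mul_pos hj hK) hw0 (by exact_mod_cast hω)).trans ?_
        rw [div_pow, one_pow]
        refine one_div_le_one_div_of_le (by positivity) (pow_le_pow_right₀ (by norm_num) ?_)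
        rw [← mul_assoc]
        exact Nat.mul_le_mul_right K he
      have h6 : ((x.2 : ℕ) : ℝ) * (ω * t + v) = (x.2 : ℕ) * ω * t + (x.2 : ℕ) * v := by ring
      rw [h3, ← mul_sub, ← mul_sub, abs_mul, abs_mul, h6,
        abs_of_nonneg (Nat.cast_nonneg (t.choose x.1) : (0 : ℝ) ≤ (t.choose x.1 : ℕ))]
      refine mul_le_mul (hpP' x) (mul_le_mul hch (h4.trans ?_) (abs_nonneg _) (by positivity))
        (by positivity) (by positivity)
      refine mul_le_mul hexp.le ?_ (by positivity) (by positivity)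
      linarith
    refine (Finset.sum_le_sum fun i _ => h2 i).trans (le_of_eq ?_)
    rw [hpow]
    simp
    ring
  have hsum := abs_add_le (∑ x : Fin K × Fin L, (p x : ℝ) * (t.choose x.1 * Real.exp (x.2 * (ω * t + v)))
      - ∑ x, (p x : ℝ) * (Q x).eval (t : ℝ)) (∑ x, (p x : ℝ) * (Q x).eval (t : ℝ))
  rw [sub_add_cancel] at hsum
  refine hsum.trans ((add_le_add hF hG).trans (le_of_eq ?_))
  ring

theorem not_forall_exp_poly_eq_zero {L g S d K : ℕ} {ω lam : ℝ} (hK : K = S * g) (hK0 : 0 < K)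
    (hL : 0 < L) (hω : ω ≠ 0) (hd : L * g ≤ d) {p : Fin K × Fin L → ℤ} (hp : p ≠ 0)
    (h : ∀ r < L * (g + 1), ∀ s < S,
      ∑ x : Fin K × Fin L, (p x : ℝ) * ((r + s * d).choose x.1 *
        Real.exp (x.2 * (ω * (r + s * d : ℕ) + s * lam))) = 0) : False := by
  classical
  have hg : 0 < g := by
    rcases Nat.eq_zero_or_pos g with h0 | h0
    · simp [h0] at hK; omega
    · exact h0
  have hd0 : 0 < d := lt_of_lt_of_le (Nat.mul_pos hL hg) hd
  let Q : Fin L → ℝ[X] := fun l => ∑ k : Fin K, C (p (k, l) : ℝ) * binomPoly k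
  have hdeg : ∀ l, (Q l).natDegree ≤ K - 1 := fun l => by
    refine natDegree_sum_le_of_forall_le _ _ fun k _ => ?_
    refine (natDegree_C_mul_le _ _).trans ((natDegree_binomPoly_le _).trans ?_)
    have := k.2
    omega
  have hQeval : ∀ l (t : ℕ), (Q l).eval (t : ℝ) = ∑ k : Fin K, (p (k, l) : ℝ) * t.choose k := by
    intro l t
    simp only [Q]
    rw [eval_finsetSum]
    refine Finset.sum_congr rfl fun k _ => ?_
    rw [eval_mul, eval_C, binomPoly_eval]
  have hne : ∃ l, Q l ≠ 0 := by
    by_contra! hall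
    apply hp
    suffices hz : ∀ (n : ℕ) (hn : n < K) (l : Fin L), p (⟨n, hn⟩, l) = 0 by
      ext ⟨k, l⟩
      exact hz k k.2 l
    intro n
    induction n using Nat.strong_induction_on with
    | _ n ih =>
      intro hn l
      have h1 := hQeval l n
      rw [hall l, eval_zero, Finset.sum_eq_single (⟨n, hn⟩ : Fin K)] at h1
      · simpa using h1.symm
      · intro k _ hk
        rcases lt_trichotomy (k : ℕ) n with h2 | h2 | h2
        · have := ih k h2 k.2 l
          rw [this]; simp
        · exact absurd (Fin.ext h2) hk
        · rw [Nat.choose_eq_zero_of_lt h2]; simp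
      · simp
  let f : Fin (L * g) × Fin S → ℝ := fun z => ((z.1 + z.2 * d : ℕ) : ℝ)
  have hf : Function.Injective f := by
    rintro ⟨a, s⟩ ⟨a', s'⟩ hEq
    have h1 : (a + s * d : ℕ) = a' + s' * d := Nat.cast_injective (R := ℝ) hEq
    have ha : (a : ℕ) < d := a.2.trans_le hd
    have ha' : (a' : ℕ) < d := a'.2.trans_le hd
    have h2 : (a : ℕ) = a' := by
      have := congrArg (· % d) h1
      simpa [Nat.add_mul_mod_self_right, Nat.mod_eq_of_lt ha, Nat.mod_eq_of_lt ha'] using this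
    have h3 : (s : ℕ) = s' := by
      rw [h2] at h1
      exact Nat.eq_of_mul_eq_mul_right hd0 (Nat.add_left_cancel h1)
    exact Prod.ext (Fin.ext h2) (Fin.ext h3)
  have hcard := card_le_of_vanish Q hdeg hne (Real.exp_pos ω) (by simpa using hω)
    (Finset.univ.image f) (fun t => Real.exp (ω * t + ((⌊t⌋₊ / d : ℕ) : ℝ) * lam))
    (fun t _ => (Real.exp_pos _).ne') (by
      intro t ht i
      obtain ⟨⟨a, s⟩, -, rfl⟩ := Finset.mem_image.mp ht
      have ha : (a : ℕ) < d := a.2.trans_le hd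
      have hfl : ⌊f (a, s)⌋₊ / d = s := by
        simp only [f]
        rw [Nat.floor_natCast, Nat.add_mul_div_right _ _ hd0, Nat.div_eq_of_lt ha, zero_add]
      have hai : (a + i : ℕ) < L * (g + 1) := by
        have := a.2
        have := i.2
        rw [mul_add, mul_one]
        omega
      have h1 := h (a + i) hai s s.2
      rw [hfl, ← h1, Fintype.sum_prod_type_right]
      refine Finset.sum_congr rfl fun l _ => ?_
      have h2 : f (a, s) + (i : ℕ) = ((a + i + s * d : ℕ) : ℝ) := by
        simp only [f]; push_cast; ring
      rw [h2, hQeval, Finset.sum_mul]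
      refine Finset.sum_congr rfl fun k _ => ?_
      rw [mul_assoc, ← Real.exp_nat_mul, ← Real.exp_add, ← Real.exp_nat_mul]
      congr 3
      simp only [f]
      push_cast
      ring)
  rw [Finset.card_image_of_injective _ hf, Finset.card_univ, Fintype.card_prod, Fintype.card_fin,
    Fintype.card_fin] at hcard
  have h3 : L * g * S = L * K := by rw [hK]; ring
  have h4 : L * (K - 1) < L * K := Nat.mul_lt_mul_of_pos_left (by omega) hL
  omega

/-- A lower bound for a linear form in two logarithms, the first of which is small. -/
theorem two_log_lower_bound {L j π b H e g S d c K R T X : ℕ} (hK : K = S * g)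
    (hR : R = L * (g + 1)) (hT : T = R + S * d) (hX : X = 2 * π + 2 * b + 2 + H)
    (hL : 0 < L) (hj : 0 < j) (hg : 0 < g) (hS : 0 < S) (hc0 : 0 < c)
    {A₁ A₁' B₁ B₁' m₁ A₂ A₂' B₂ B₂' m₂ ω lam : ℝ}
    (hA₁ : IsConjPair A₁ A₁') (hB₁ : IsConjPair B₁ B₁') (hA₂ : IsConjPair A₂ A₂')
    (hB₂ : IsConjPair B₂ B₂') (hB₁0 : 0 < B₁) (hB₂0 : 0 < B₂)
    (hA₁m : |A₁'| ≤ m₁) (hB₁m : |B₁'| ≤ m₁) (hA₂m : |A₂'| ≤ m₂) (hB₂m : |B₂'| ≤ m₂)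
    (hω0 : ω ≠ 0) (hAB₁ : A₁ = B₁ * Real.exp ω) (hAB₂ : A₂ = B₂ * Real.exp (d * ω + lam))
    (hπ : X * (1 + j) ≤ π * L) (he : X ≤ e * j) (hTK : T + K ≤ c * K)
    (hcb : 3 * c ≤ 2 ^ b) (hω : 3 * (L * |ω| * T) * 2 ^ e ≤ j * K) (hω' : L * |ω| * T ≤ K / 2)
    (hd : L * g ≤ d) (hsmall : (K * L) ^ 2 * (j * K + K + 1 + 2 * L * S) < 2 ^ K)
    (hH : (B₁ * m₁) ^ (R * L) * (B₂ * m₂) ^ (S * L) ≤ 2 ^ (H * K)) :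
    1 / 2 ^ (X * K) ≤ |lam| := by
  by_contra! hlam
  have hK0 : 0 < K := by rw [hK]; positivity
  obtain ⟨p, hp0, hpP, hp⟩ := exists_small_exp_poly hK0 hL hj hc0 hπ he hTK hcb hω hω'
  refine not_forall_exp_poly_eq_zero (lam := lam) hK hK0 hL hω0 hd hp0 fun r hr s hs => ?_
  have hm₁ : 0 ≤ m₁ := (abs_nonneg _).trans hA₁m
  have hm₂ : 0 ≤ m₂ := (abs_nonneg _).trans hA₂m
  have hrR : r ≤ R := by omega
  have ht : r + s * d ≤ T := by
    have : s * d ≤ S * d := Nat.mul_le_mul_right d hs.le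
    omega
  set t := r + s * d with ht_def
  set V := ∑ x : Fin K × Fin L, (p x : ℝ) * (t.choose x.1 *
        Real.exp (x.2 * (ω * t + s * lam))) with hV
  let W : ℝ → ℝ → ℝ → ℝ → ℝ := fun a b a' b' => ∑ x : Fin K × Fin L, (p x : ℝ) * (t.choose x.1 *
    (a ^ (r * x.2) * b ^ (R * L - r * x.2) * (a' ^ (s * x.2) * b' ^ (S * L - s * x.2))))
  have hWpair : IsConjPair (W A₁ B₁ A₂ B₂) (W A₁' B₁' A₂' B₂') := by
    refine IsConjPair.sum _ fun x _ => (IsConjPair.intCast _).mul ((IsConjPair.natCast _).mul ?_)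
    exact ((hA₁.pow _).mul (hB₁.pow _)).mul ((hA₂.pow _).mul (hB₂.pow _))
  have hrl : ∀ l < L, r * l ≤ R * L := fun l hl => Nat.mul_le_mul hrR hl.le
  have hsl : ∀ l < L, s * l ≤ S * L := fun l hl => Nat.mul_le_mul hs.le hl.le
  have hWV : W A₁ B₁ A₂ B₂ = B₁ ^ (R * L) * B₂ ^ (S * L) * V := by
    simp only [W]
    rw [hV, Finset.mul_sum]
    refine Finset.sum_congr rfl fun x _ => ?_
    have h1 := hrl _ x.2.2
    have h2 := hsl _ x.2.2
    rw [hAB₁, hAB₂, mul_pow, mul_pow, ← Real.exp_nat_mul, ← Real.exp_nat_mul]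
    have h3 : Real.exp ((x.2 : ℕ) * (ω * t + s * lam)) = Real.exp ((r * x.2 : ℕ) * ω) *
        Real.exp ((s * x.2 : ℕ) * (d * ω + lam)) := by
      rw [← Real.exp_add, ht_def]
      congr 1
      push_cast
      ring
    have h4 : B₁ ^ (R * L) = B₁ ^ (r * x.2) * B₁ ^ (R * L - r * x.2) := by
      rw [← pow_add, Nat.add_sub_cancel' h1]
    have h5 : B₂ ^ (S * L) = B₂ ^ (s * x.2) * B₂ ^ (S * L - s * x.2) := by
      rw [← pow_add, Nat.add_sub_cancel' h2]
    rw [h3, h4, h5]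
    ring
  have hchoose : ∀ k < K, ((t.choose k : ℕ) : ℝ) ≤ 2 ^ (b * K) := fun k hk => by
    refine (Nat.choose_le_pow_div (α := ℝ) _ _).trans
      (pow_div_factorial_le_two_pow hk.le hcb hc0 (by positivity) ?_)
    have : t ≤ c * K := by omega
    exact_mod_cast this
  have hW' : |W A₁' B₁' A₂' B₂'| ≤
      2 ^ (π * K) * (K * L) * 2 ^ (b * K) * (m₁ ^ (R * L) * m₂ ^ (S * L)) := by
    have h1 : ∀ x : Fin K × Fin L, |(p x : ℝ) * (t.choose x.1 * (A₁' ^ (r * x.2) *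
        B₁' ^ (R * L - r * x.2) * (A₂' ^ (s * x.2) * B₂' ^ (S * L - s * x.2))))| ≤
        2 ^ (π * K) * (2 ^ (b * K) * (m₁ ^ (R * L) * m₂ ^ (S * L))) := by
      intro x
      have h1 := hrl _ x.2.2
      have h2 := hsl _ x.2.2
      have h4 : m₁ ^ (R * L) = m₁ ^ (r * x.2) * m₁ ^ (R * L - r * x.2) := by
        rw [← pow_add, Nat.add_sub_cancel' h1]
      have h5 : m₂ ^ (S * L) = m₂ ^ (s * x.2) * m₂ ^ (S * L - s * x.2) := by
        rw [← pow_add, Nat.add_sub_cancel' h2]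
      rw [h4, h5]
      simp only [abs_mul, abs_pow]
      rw [abs_of_nonneg (Nat.cast_nonneg (t.choose x.1) : (0 : ℝ) ≤ (t.choose x.1 : ℕ))]
      have := hpP x
      have := hchoose _ x.1.2
      gcongr
    refine (Finset.abs_sum_le_sum_abs _ _).trans ((Finset.sum_le_sum fun x _ => h1 x).trans
      (le_of_eq ?_))
    simp
    ring
  have hKL : (0 : ℝ) < K * L := by positivity
  have hLs : (L : ℝ) * |s * lam| ≤ L * S / 2 ^ (X * K) := by
    rw [abs_mul, abs_of_nonneg (Nat.cast_nonneg s : (0 : ℝ) ≤ s), mul_div_assoc]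
    have : (s : ℝ) ≤ S := by exact_mod_cast hs.le
    rw [div_eq_mul_one_div]
    gcongr
  have hsmall' : ((K * L : ℝ)) ^ 2 * (j * K + K + 1 + 2 * L * S) < 2 ^ K := by
    exact_mod_cast hsmall
  have hKX : (2 : ℝ) ^ K ≤ 2 ^ (X * K) := by
    refine pow_le_pow_right₀ (by norm_num) ?_
    have : 1 * K ≤ X * K := Nat.mul_le_mul_right K (by omega)
    omega
  have hKL1 : (1 : ℝ) ≤ K * L := by exact_mod_cast Nat.mul_pos hK0 hL
  have hLv1 : (L : ℝ) * |s * lam| ≤ 1 := by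
    refine hLs.trans ?_
    rw [div_le_one (by positivity)]
    refine le_trans ?_ (hsmall'.le.trans hKX)
    have h1 : (L * S : ℝ) ≤ 1 * (j * K + K + 1 + 2 * L * S) := by
      have : (0 : ℝ) ≤ L * S := by positivity
      have : (0 : ℝ) ≤ j * K := by positivity
      have : (0 : ℝ) ≤ K := by positivity
      linarith
    refine h1.trans ?_
    gcongr
    exact one_le_pow₀ hKL1
  have hVb := hp t ht (s * lam) hLv1
  rw [← hV] at hVb
  have hV2 : |V| ≤ 2 ^ (π * K) * (K * L) * 2 ^ ((b + 1) * K) *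
      ((j * K + K + 1 + 2 * L * S) / 2 ^ (X * K)) := by
    refine hVb.trans ?_
    gcongr
    rw [add_div _ (2 * (L : ℝ) * S), mul_assoc 2 (L : ℝ) S, mul_div_assoc 2]
    linarith
  have hprod : |W A₁ B₁ A₂ B₂ * W A₁' B₁' A₂' B₂'| < 1 := by
    rw [abs_mul, hWV, abs_mul, abs_of_pos (by positivity : 0 < B₁ ^ (R * L) * B₂ ^ (S * L))]
    calc _ ≤ B₁ ^ (R * L) * B₂ ^ (S * L) * (2 ^ (π * K) * (K * L) * 2 ^ ((b + 1) * K) *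
            ((j * K + K + 1 + 2 * L * S) / 2 ^ (X * K))) *
          (2 ^ (π * K) * (K * L) * 2 ^ (b * K) * (m₁ ^ (R * L) * m₂ ^ (S * L))) := by
          gcongr
      _ = ((B₁ * m₁) ^ (R * L) * (B₂ * m₂) ^ (S * L)) *
          (2 ^ (π * K) * 2 ^ ((b + 1) * K) * 2 ^ (π * K) * 2 ^ (b * K)) *
          ((K * L) ^ 2 * (j * K + K + 1 + 2 * L * S)) / 2 ^ (X * K) := by
          rw [mul_pow, mul_pow]; ring
      _ < 2 ^ (H * K) * (2 ^ (π * K) * 2 ^ ((b + 1) * K) * 2 ^ (π * K) * 2 ^ (b * K)) *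
          2 ^ K / 2 ^ (X * K) := by
          rw [div_lt_div_iff_of_pos_right (by positivity)]
          refine mul_lt_mul' ?_ hsmall' (by positivity) (by positivity)
          gcongr
      _ = 1 := by
          rw [div_eq_one_iff_eq (by positivity), hX]
          simp only [← pow_add]
          congr 1
          ring
  have hW0 := hWpair.eq_zero hprod
  rw [hWV] at hW0
  rcases mul_eq_zero.mp hW0 with h | h
  · exact absurd h (by positivity)
  · exact h

end

theorem IsConjPair.swap {x y : ℝ} (h : IsConjPair x y) : IsConjPair y x := by
  obtain ⟨a, b, rfl, rfl⟩ := h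
  refine ⟨a + b, -b, ?_, ?_⟩
  · push_cast
    linear_combination (b : ℝ) * Real.goldenRatio_add_goldenConj
  · push_cast
    linear_combination (b : ℝ) * Real.goldenRatio_add_goldenConj

theorem IsConjPair.sqrt_five : IsConjPair (√5) (-√5) :=
  ⟨-1, 2, by unfold Real.goldenRatio; push_cast; ring, by unfold Real.goldenConj; push_cast; ring⟩

theorem goldenRatio_pow_ne_two_pow {q : ℕ} (hq : q ≠ 0) (p : ℕ) : Real.goldenRatio ^ q ≠ 2 ^ p := by
  intro h
  have h1 : IsConjPair (Real.goldenRatio ^ q + (-1 : ℤ) * (2 : ℕ) ^ p)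
      (Real.goldenConj ^ q + (-1 : ℤ) * (2 : ℕ) ^ p) :=
    (IsConjPair.goldenRatio.pow q).add ((IsConjPair.intCast _).mul ((IsConjPair.natCast 2).pow p))
  have h2 := h1.swap.eq_zero (by rw [h]; simp)
  have h3 : Real.goldenConj ^ q = 2 ^ p := by push_cast at h2; linarith
  have h4 : |Real.goldenConj ^ q| < 1 := by
    rw [abs_pow]
    refine pow_lt_one₀ (abs_nonneg _) ?_ hq
    rw [abs_lt]
    exact ⟨Real.neg_one_lt_goldenConj, Real.goldenConj_neg.trans one_pos⟩
  rw [h3, abs_of_pos (by positivity)] at h4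
  exact absurd (one_le_pow₀ (by norm_num : (1 : ℝ) ≤ 2)) (not_le.mpr h4)

theorem pow_six_lt_two_pow {K : ℕ} (hK : 30 ≤ K) : K ^ 6 < 2 ^ K := by
  induction K, hK using Nat.le_induction with
  | base => norm_num
  | succ k hk ih =>
    have h1 : (k + 1) ^ 6 ≤ 2 * k ^ 6 := by
      obtain ⟨m, rfl⟩ := Nat.exists_eq_add_of_le hk
      ring_nf
      linarith [Nat.zero_le m, Nat.zero_le (m ^ 2), Nat.zero_le (m ^ 3), Nat.zero_le (m ^ 4),
        Nat.zero_le (m ^ 5), Nat.zero_le (m ^ 6)]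
    calc (k + 1) ^ 6 ≤ 2 * k ^ 6 := h1
      _ < 2 * 2 ^ k := by linarith
      _ = 2 ^ (k + 1) := by ring

/-- The linear form in logarithms attached to `φ ^ n * B / √5` and `2 ^ a`. -/
noncomputable def logForm (n a : ℕ) (B : ℝ) : ℝ :=
  n * Real.log Real.goldenRatio + Real.log B - Real.log 5 / 2 - a * Real.log 2

set_option maxHeartbeats 1000000 in
theorem logForm_lower_bound {q p L j π b H₁ H₂ e S c D X G : ℕ} {Ω : ℝ}
    (hX : X = 2 * π + 2 * b + 2 + (H₁ + (H₂ + 2))) (hL : 0 < L) (hj : 0 < j) (hS : 2 * L + j + 2 ≤ S)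
    (hc : 3 < c) (hq : q ≠ 0) (hπ : X * (1 + j) ≤ π * L) (he : X ≤ e * j) (hcb : 3 * c ≤ 2 ^ b)
    (hΩ : |q * Real.log Real.goldenRatio - p * Real.log 2| ≤ Ω)
    (hΩj : 3 * (L * Ω * c) * 2 ^ e ≤ j) (hje : 2 * j ≤ 2 ^ e)
    (hDq : D ≤ q * (c - 3)) (hLD : 2 * L * q ≤ D)
    (hH₁ : 2 * p * L ^ 2 * 101 ≤ 100 * (H₁ * S)) (hG : 100 ≤ G) (hcG : c ≤ G)
    (hqG : L * (3 * q + 8) ≤ G)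
    {n n' a ν : ℕ} (hnn : n' ≤ n) (hnn' : n ≤ 2 * n') (hn : D * G ≤ n)
    (hν : 3 * L * ν ≤ H₂ * (n / D))
    {B B' : ℝ} (hB : IsConjPair B B') (hB1 : 1 ≤ B) (hB2 : B ≤ 2 ^ ν) (hB3 : |B'| ≤ 3) :
    1 / 2 ^ (X * (S * (n / D))) ≤ |logForm n' a B| := by
  by_contra! hlt
  refine absurd hlt (not_lt.mpr ?_)
  have hΛ1 : |logForm n' a B| < 1 := by
    refine hlt.trans_le ?_
    rw [div_le_one (by positivity)]
    exact one_le_pow₀ (by norm_num)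
  set g := n / D with hg
  set d := n' / q with hd
  set r := n' % q with hr
  have hq0 : 0 < q := Nat.pos_of_ne_zero hq
  have hD : 0 < D := lt_of_lt_of_le (by positivity) hLD
  have hgG : G ≤ g := by
    rw [hg, Nat.le_div_iff_mul_le hD, mul_comm]
    exact hn
  have hgn : D * g ≤ n := Nat.mul_div_le n D
  have hgn' : n < D * (g + 1) := by
    have := Nat.lt_div_mul_add (a := n) hD
    rw [mul_add, mul_one, mul_comm D]
    exact this
  have hdq : q * d + r = n' := Nat.div_add_mod n' q
  have hrq : r < q := Nat.mod_lt _ hq0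
  have hdg : L * g ≤ d := by
    rw [hd, Nat.le_div_iff_mul_le hq0]
    have : 2 * L * q * g ≤ D * g := Nat.mul_le_mul_right g hLD
    have h2 : 2 * L * q * g = 2 * (L * g * q) := by ring
    omega
  have hdc : d ≤ (c - 2) * g := by
    have h1 : d < (c - 3) * (g + 1) := by
      rw [hd, Nat.div_lt_iff_lt_mul hq0]
      calc n' < D * (g + 1) := by omega
        _ ≤ q * (c - 3) * (g + 1) := Nat.mul_le_mul_right _ hDq
        _ = _ := by ring
    obtain ⟨c', rfl⟩ := Nat.exists_eq_add_of_lt hc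
    have h3 : 3 + c' + 1 - 3 = c' + 1 := by omega
    have h4 : 3 + c' + 1 - 2 = c' + 2 := by omega
    rw [h3] at h1
    rw [h4]
    have h5 : (c' + 1) * (g + 1) = c' * g + c' + g + 1 := by ring
    have h6 : (c' + 2) * g = c' * g + 2 * g := by ring
    omega
  have hTc : L * (g + 1) + S * d + S * g ≤ c * (S * g) := by
    have h1 : L * (g + 1) ≤ S * g := by
      calc L * (g + 1) ≤ L * (2 * g) := Nat.mul_le_mul_left L (by omega)
        _ = 2 * L * g := by ring
        _ ≤ S * g := Nat.mul_le_mul_right g (by omega)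
    have h2 : S * d ≤ S * ((c - 2) * g) := Nat.mul_le_mul_left S hdc
    calc _ ≤ S * g + S * ((c - 2) * g) + S * g := by omega
      _ = (c - 2 + 2) * (S * g) := by ring
      _ = c * (S * g) := by rw [Nat.sub_add_cancel (by omega)]
  set ω := q * Real.log Real.goldenRatio - p * Real.log 2 with hω
  have hS0 : 0 < S := by omega
  have hg0 : 0 < g := by omega
  have hSg : (0 : ℝ) < S * g := by positivity
  have hTr : ((L * (g + 1) + S * d : ℕ) : ℝ) ≤ c * (S * g) := by
    exact_mod_cast (by omega : L * (g + 1) + S * d ≤ c * (S * g))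
  have hLωT : L * |ω| * ((L * (g + 1) + S * d : ℕ) : ℝ) ≤ (L * Ω * c) * (S * g) := by
    have hΩ0 : 0 ≤ Ω := (abs_nonneg _).trans hΩ
    calc _ ≤ L * Ω * (c * (S * g)) := by gcongr
      _ = _ := by ring
  have hje' : (2 * j : ℝ) ≤ 2 ^ e := by exact_mod_cast hje
  have hΩc : L * Ω * c ≤ 1 / 2 := by
    have : 0 < (2 : ℝ) ^ e := by positivity
    by_contra! hcon
    have := mul_lt_mul_of_pos_right hcon this
    have : (0 : ℝ) < j := by positivity
    linarith
  have hΩ0 : 0 ≤ Ω := (abs_nonneg _).trans hΩ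
  have hlogφ : 0 < Real.log Real.goldenRatio := Real.log_pos Real.one_lt_goldenRatio
  have hlogφ2 : Real.log Real.goldenRatio ≤ Real.log 2 :=
    Real.log_le_log Real.goldenRatio_pos Real.goldenRatio_lt_two.le
  have hlog2 : 0.69 < Real.log 2 := by have := Real.log_two_gt_d9; linarith
  have hlog2' : Real.log 2 < 0.7 := by have := Real.log_two_lt_d9; linarith
  have hlog5 : Real.log 5 / 2 ≤ 3 * Real.log 2 / 2 := by
    have : Real.log 5 ≤ Real.log (2 ^ 3) := Real.log_le_log (by norm_num) (by norm_num)
    rw [Real.log_pow] at this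
    push_cast at this
    linarith
  have hlog5' : 0 ≤ Real.log 5 / 2 := by
    have := Real.log_nonneg (by norm_num : (1 : ℝ) ≤ 5)
    linarith
  have hlogB : 0 ≤ Real.log B := Real.log_nonneg hB1
  have hB0 : 0 < B := by linarith
  have hlogB2 : Real.log B ≤ ν * Real.log 2 := by
    rw [← Real.log_pow]
    exact Real.log_le_log hB0 hB2
  have hn'r : (n' : ℝ) = q * d + r := by exact_mod_cast hdq.symm
  set s : ℤ := a - d * p with hs
  have hsr : (s : ℝ) * Real.log 2 = r * Real.log Real.goldenRatio + Real.log B - Real.log 5 / 2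
      + d * ω - logForm n' a B := by
    rw [logForm, hn'r, hs, hω]
    push_cast
    ring
  have hdω : |(d : ℝ) * ω| ≤ d * Ω := by
    rw [abs_mul, abs_of_nonneg (Nat.cast_nonneg d : (0 : ℝ) ≤ d)]
    gcongr
  have hrr : (r : ℝ) ≤ q := by exact_mod_cast hrq.le
  have hsabs : |(s : ℝ)| ≤ q + ν + 3 + 2 * (d * Ω) := by
    have h1 : |(s : ℝ)| * Real.log 2 ≤ (q + ν + 3 + 2 * (d * Ω)) * Real.log 2 := by
      rw [← abs_of_pos (by linarith : 0 < Real.log 2), ← abs_mul,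
        abs_of_pos (by linarith : 0 < Real.log 2), hsr]
      have h2 : (r : ℝ) * Real.log Real.goldenRatio ≤ q * Real.log 2 := by gcongr
      have h3 : 0 ≤ (r : ℝ) * Real.log Real.goldenRatio := by positivity
      have h4 : d * Ω ≤ 2 * (d * Ω) * Real.log 2 := by
        have h5 : 0 ≤ d * Ω := by positivity
        have := mul_le_mul_of_nonneg_left hlog2.le h5
        linarith
      have h5 : 0 ≤ (q : ℝ) * Real.log 2 := by positivity
      have h6 : 0 ≤ (ν : ℝ) * Real.log 2 := by positivity
      have h7 := abs_le.mp hdω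
      have h8 := abs_lt.mp hΛ1
      rw [abs_le]
      have h9 : 0 ≤ d * Ω := by positivity
      have h10 : (q + ν + 3 + 2 * (d * Ω)) * Real.log 2 = q * Real.log 2 + ν * Real.log 2
        + 3 * Real.log 2 + 2 * (d * Ω) * Real.log 2 := by ring
      rw [h10]
      constructor <;> linarith
    exact le_of_mul_le_mul_right h1 (by linarith)
  set s₁ := s.toNat with hs₁
  set s₂ := (-s).toNat with hs₂
  have hs12 : (s : ℝ) = s₁ - s₂ := by
    have : s = s₁ - s₂ := by omega
    rw [this]; push_cast; ring
  have hs12' : ((s₁ + s₂ : ℕ) : ℝ) ≤ |(s : ℝ)| := by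
    have : ((s₁ + s₂ : ℕ) : ℤ) ≤ |s| := by
      rcases abs_cases s with h | h <;> omega
    exact_mod_cast this
  have hconj : |Real.goldenConj| ≤ 1 := by
    rw [abs_le]
    exact ⟨Real.neg_one_lt_goldenConj.le, (Real.goldenConj_neg.trans one_pos).le⟩
  have hsqrt5 : √5 ≤ 3 := by
    rw [Real.sqrt_le_left (by norm_num)]; norm_num
  have hY : L * (2 + 2 * (s₁ + s₂) + r + ν) ≤ (H₂ + 2) * g := by
    have hqG' : (L * (3 * q + 8) : ℝ) ≤ g := by exact_mod_cast hqG.trans hgG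
    have hνr : (3 * L * ν : ℝ) ≤ H₂ * g := by exact_mod_cast hν
    have hLdΩ : L * (d * Ω) ≤ g / 4 := by
      have hdcr : (d : ℝ) ≤ c * g := by
        have : d ≤ c * g := hdc.trans (Nat.mul_le_mul_right g (by omega))
        exact_mod_cast this
      have h1 : L * Ω * c ≤ 1 / 6 := by
        have : 0 < (2 : ℝ) ^ e := by positivity
        by_contra! hcon
        have := mul_lt_mul_of_pos_right hcon this
        linarith
      calc L * (d * Ω) ≤ L * (c * g * Ω) := by gcongr
        _ = L * Ω * c * g := by ring
        _ ≤ 1 / 6 * g := by gcongr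
        _ ≤ g / 4 := by have : (0 : ℝ) ≤ g := by positivity
                        linarith
    have : (L * (2 + 2 * (s₁ + s₂) + r + ν) : ℝ) ≤ (H₂ + 2) * g := by
      push_cast at hs12'
      calc (L * (2 + 2 * (s₁ + s₂) + r + ν) : ℝ)
          ≤ L * (2 + 2 * (q + ν + 3 + 2 * (d * Ω)) + q + ν) := by
            refine mul_le_mul_of_nonneg_left ?_ (Nat.cast_nonneg L)
            linarith
        _ = L * (3 * q + 8) + 3 * L * ν + 4 * (L * (d * Ω)) := by ring
        _ ≤ g + H₂ * g + 4 * (g / 4) := by gcongr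
        _ = _ := by ring
    exact_mod_cast this
  have hω0 : ω ≠ 0 := by
    intro h0
    apply goldenRatio_pow_ne_two_pow hq p
    apply Real.log_injOn_pos (Set.mem_Ioi.mpr (by positivity)) (Set.mem_Ioi.mpr (by positivity))
    rw [Real.log_pow, Real.log_pow]
    linarith
  have hmain := two_log_lower_bound (L := L) (j := j) (π := π) (b := b) (H := H₁ + (H₂ + 2)) (e := e)
    (g := g) (S := S) (d := d) (c := c) rfl rfl rfl hX hL hj hg0 hS0 (by omega)
    (A₁ := Real.goldenRatio ^ q) (A₁' := Real.goldenConj ^ q) (B₁ := ((2 : ℕ) : ℝ) ^ p)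
    (B₁' := ((2 : ℕ) : ℝ) ^ p) (m₁ := 2 ^ p) (A₂ := √5 * ((2 : ℕ) : ℝ) ^ s₁)
    (A₂' := -√5 * ((2 : ℕ) : ℝ) ^ s₁)
    (B₂ := ((2 : ℕ) : ℝ) ^ s₂ * Real.goldenRatio ^ r * B)
    (B₂' := ((2 : ℕ) : ℝ) ^ s₂ * Real.goldenConj ^ r * B')
    (m₂ := 3 * 2 ^ (s₁ + s₂)) (ω := ω) (lam := -logForm n' a B)
    (IsConjPair.goldenRatio.pow q) ((IsConjPair.natCast 2).pow p)
    (IsConjPair.sqrt_five.mul ((IsConjPair.natCast 2).pow s₁))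
    ((((IsConjPair.natCast 2).pow s₂).mul (IsConjPair.goldenRatio.pow r)).mul hB)
    (by positivity) (by positivity)
    (by
      rw [abs_pow]
      exact (pow_le_one₀ (abs_nonneg _) hconj).trans (one_le_pow₀ (by norm_num)))
    (by rw [abs_of_pos (by positivity)]; norm_num)
    (by
      rw [abs_mul, abs_neg, abs_of_nonneg (by positivity), abs_of_nonneg (by positivity)]
      push_cast
      gcongr
      · norm_num
      · omega)
    (by
      rw [abs_mul, abs_mul, abs_pow, abs_pow, abs_of_nonneg (by positivity : (0 : ℝ) ≤ (2 : ℕ))]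
      calc _ ≤ ((2 : ℕ) : ℝ) ^ s₂ * 1 * 3 := by
            gcongr
            exact pow_le_one₀ (abs_nonneg _) hconj
        _ ≤ 3 * 2 ^ (s₁ + s₂) := by
            push_cast
            rw [mul_one, mul_comm]
            gcongr
            · norm_num
            · omega)
    hω0
    (by
      rw [hω, Real.exp_sub, mul_comm (q : ℝ), mul_comm (p : ℝ), Real.exp_mul, Real.exp_mul,
        Real.exp_log Real.goldenRatio_pos, Real.exp_log (by norm_num), Real.rpow_natCast,
        Real.rpow_natCast]
      push_cast
      field_simp)
    (by
      have h5 : √5 = Real.exp (Real.log 5 / 2) := by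
        rw [Real.sqrt_eq_rpow, Real.rpow_def_of_pos (by norm_num)]
        ring_nf
      have h2 : ∀ m : ℕ, ((2 : ℕ) : ℝ) ^ m = Real.exp (m * Real.log 2) := by
        intro m
        rw [mul_comm, Real.exp_mul, Real.exp_log (by norm_num), Real.rpow_natCast]
        norm_num
      have h3 : Real.goldenRatio ^ r = Real.exp (r * Real.log Real.goldenRatio) := by
        rw [mul_comm, Real.exp_mul, Real.exp_log Real.goldenRatio_pos, Real.rpow_natCast]
      rw [h5, h2, h2, h3]
      generalize logForm n' a B = t at hsr
      conv_rhs => rw [← Real.exp_log hB0]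
      simp only [← Real.exp_add]
      congr 1
      rw [hs12] at hsr
      linarith)
    hπ he hTc hcb
    (by
      have hL3 : 3 * (L * |ω| * ((L * (g + 1) + S * d : ℕ) : ℝ)) * 2 ^ e ≤
        3 * ((L * Ω * c) * (S * g)) * 2 ^ e := by gcongr
      refine hL3.trans ?_
      calc _ = (3 * (L * Ω * c) * 2 ^ e) * (S * g) := by ring
        _ ≤ j * (S * g) := by gcongr
        _ = _ := by push_cast; ring)
    (by
      refine hLωT.trans ?_
      calc _ ≤ 1 / 2 * (S * g : ℝ) := by gcongr
        _ = _ := by push_cast; ring)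
    hdg
    (by
      have hSK : S * 100 ≤ S * g := Nat.mul_le_mul_left S (by omega)
      set K := S * g with hK
      have h1 : L ≤ K := by omega
      have h2 : j * K + K + 1 + 2 * L * S ≤ K * K := by
        have h3 : S ≤ K := by omega
        calc _ ≤ j * K + K + K + 2 * L * K := by
              have := Nat.mul_le_mul_left (2 * L) h3
              omega
          _ = (2 * L + j + 2) * K := by ring
          _ ≤ K * K := Nat.mul_le_mul_right K (by omega)
      calc (K * L) ^ 2 * (j * K + K + 1 + 2 * L * S) ≤ (K * K) ^ 2 * (K * K) := by gcongr
        _ = K ^ 6 := by ring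
        _ < 2 ^ K := pow_six_lt_two_pow (by omega))
    (by
      have h1 : (((2 : ℕ) : ℝ) ^ p * 2 ^ p) ^ (L * (g + 1) * L) ≤ 2 ^ (H₁ * (S * g)) := by
        push_cast
        rw [← pow_add, ← pow_mul]
        refine pow_le_pow_right₀ (by norm_num) ?_
        have h2 : 100 * (g + 1) ≤ 101 * g := by omega
        have h3 : 2 * p * L ^ 2 * (100 * (g + 1)) ≤ 2 * p * L ^ 2 * (101 * g) :=
          Nat.mul_le_mul_left _ h2
        have h4 : 2 * p * L ^ 2 * 101 * g ≤ 100 * (H₁ * S) * g := Nat.mul_le_mul_right g hH₁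
        have h5 : 100 * ((p + p) * (L * (g + 1) * L)) = 2 * p * L ^ 2 * (100 * (g + 1)) := by ring
        have h6 : 2 * p * L ^ 2 * (101 * g) = 2 * p * L ^ 2 * 101 * g := by ring
        have h7 : 100 * (H₁ * S) * g = 100 * (H₁ * (S * g)) := by ring
        omega
      have h2 : ((2 : ℕ) : ℝ) ^ s₂ * Real.goldenRatio ^ r * B * (3 * 2 ^ (s₁ + s₂)) ≤
          2 ^ (2 + 2 * (s₁ + s₂) + r + ν) := by
        push_cast
        calc (2 : ℝ) ^ s₂ * Real.goldenRatio ^ r * B * (3 * 2 ^ (s₁ + s₂))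
            ≤ 2 ^ (s₁ + s₂) * 2 ^ r * 2 ^ ν * (2 ^ 2 * 2 ^ (s₁ + s₂)) := by
              have := Real.goldenRatio_lt_two.le
              gcongr
              · norm_num
              · omega
              · norm_num
          _ = _ := by rw [← pow_add, ← pow_add, ← pow_add, ← pow_add]; ring_nf
      rw [add_mul H₁ (H₂ + 2) (S * g), pow_add 2 (H₁ * (S * g))]
      have h3 : 0 ≤ ((2 : ℕ) : ℝ) ^ s₂ * Real.goldenRatio ^ r * B * (3 * 2 ^ (s₁ + s₂)) := by
        positivity
      refine mul_le_mul h1 ?_ (pow_nonneg h3 _) (by positivity)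
      refine (pow_le_pow_left₀ h3 h2 _).trans ?_
      rw [← pow_mul]
      refine pow_le_pow_right₀ (by norm_num) ?_
      have := Nat.mul_le_mul_left S hY
      calc _ = S * (L * (2 + 2 * (s₁ + s₂) + r + ν)) := by ring
        _ ≤ _ := this
        _ = _ := by ring)
  rwa [abs_neg] at hmain

/-- Fixed-point evaluation (scale `B`) of `∑ y z ^ (2 i) / (2 i + 1)`, where `w` encodes `z ^ 2`. -/
def artanhSum (B w : ℕ) : ℕ → ℕ → ℕ → ℕ
  | 0, _, _ => 0
  | _ + 1, _, 0 => 0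
  | n + 1, i, y + 1 => (y + 1) / (2 * i + 1) + artanhSum B w n (i + 1) ((y + 1) * w / B)

theorem artanhSum_zero_right (B w n i : ℕ) : artanhSum B w n i 0 = 0 := by
  cases n <;> rfl

theorem artanhSum_succ (B w n i y : ℕ) :
    artanhSum B w (n + 1) i y = y / (2 * i + 1) + artanhSum B w n (i + 1) (y * w / B) := by
  cases y with
  | zero => simp [artanhSum_zero_right]
  | succ y => rfl

/-- Fixed-point approximation (scale `B`) of `log ((1 + z) / (1 - z))`, where `Z` encodes `z`. -/
def logRatioApprox (B N Z : ℕ) : ℕ := 2 * artanhSum B (Z * Z / B) N 0 Z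

theorem abs_sub_natDiv_le (x : ℝ) (a b : ℕ) :
    |x - ((a / b : ℕ) : ℝ)| ≤ |x - (a : ℝ) / b| + 1 := by
  have h1 : ((a / b : ℕ) : ℝ) ≤ (a : ℝ) / b := Nat.cast_div_le
  have h2 : (a : ℝ) / b ≤ ((a / b : ℕ) : ℝ) + 1 := by
    rw [← Nat.floor_div_eq_div (K := ℝ)]
    exact (Nat.lt_floor_add_one _).le
  have h3 := abs_sub_abs_le_abs_sub x ((a : ℝ) / b)
  calc |x - ((a / b : ℕ) : ℝ)| = |(x - (a : ℝ) / b) + ((a : ℝ) / b - ((a / b : ℕ) : ℝ))| := by ring_nf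
    _ ≤ |x - (a : ℝ) / b| + |(a : ℝ) / b - ((a / b : ℕ) : ℝ)| := abs_add_le _ _
    _ ≤ _ := by
      have : |(a : ℝ) / b - ((a / b : ℕ) : ℝ)| ≤ 1 := by rw [abs_le]; constructor <;> linarith
      linarith

/-- Error propagation in a fixed-point multiplication. -/
theorem abs_mul_sub_natDiv_le {B Y Z : ℕ} (hB : 0 < B) {y z e f : ℝ} (hz : 0 ≤ z)
    (hy : |B * y - Y| ≤ e) (hzZ : |B * z - Z| ≤ f) :
    |B * (y * z) - ((Y * Z / B : ℕ) : ℝ)| ≤ z * e + (Y / B) * f + 1 := by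
  have hB' : (0 : ℝ) < B := by exact_mod_cast hB
  refine (abs_sub_natDiv_le _ _ _).trans ?_
  have h1 : B * (y * z) - ((Y * Z : ℕ) : ℝ) / B = z * (B * y - Y) + (Y / B) * (B * z - Z) := by
    push_cast
    field_simp
    ring
  rw [h1]
  have h2 := abs_add_le (z * (B * y - Y)) ((Y / B : ℝ) * (B * z - Z))
  rw [abs_mul, abs_mul, abs_of_nonneg hz, abs_of_nonneg (by positivity : (0 : ℝ) ≤ Y / B)] at h2
  have h3 := mul_le_mul_of_nonneg_left hy hz
  have h4 := mul_le_mul_of_nonneg_left hzZ (by positivity : (0 : ℝ) ≤ Y / B)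
  linarith

theorem abs_sum_sub_artanhSum_le {B w : ℕ} (hB : 0 < B) {z e : ℝ} (hz0 : 0 ≤ z) (hz : z ≤ 2 / 5)
    (he : 1 ≤ e) (heB : 10 * (e + 2) ≤ B) (hw : |B * (z * z) - w| ≤ 4 / 5 * e + 1.1) (n i y : ℕ)
    (hy : |B * z ^ (2 * i + 1) - y| ≤ e + 2) :
    |∑ k ∈ Finset.range n, B * z ^ (2 * (i + k) + 1) / (2 * (i + k) + 1 : ℝ)
      - artanhSum B w n i y| ≤ n * (e + 3) := by
  have hB' : (0 : ℝ) < B := by exact_mod_cast hB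
  induction n generalizing i y with
  | zero => simp [artanhSum]
  | succ n ih =>
    have hzp : z ^ (2 * i + 1) ≤ 2 / 5 := by
      calc z ^ (2 * i + 1) ≤ z ^ 1 := pow_le_pow_of_le_one hz0 (by linarith) (by omega)
        _ ≤ 2 / 5 := by simpa using hz
    have hyB : (y : ℝ) / B ≤ 1 / 2 := by
      rw [div_le_iff₀ hB']
      have := (abs_le.mp hy).1
      have := mul_le_mul_of_nonneg_left hzp hB'.le
      linarith
    have hstep : |B * z ^ (2 * (i + 1) + 1) - ((y * w / B : ℕ) : ℝ)| ≤ e + 2 := by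
      have h := abs_mul_sub_natDiv_le hB (mul_nonneg hz0 hz0) hy hw
      have h1 : z ^ (2 * (i + 1) + 1) = z ^ (2 * i + 1) * (z * z) := by ring
      rw [h1]
      refine h.trans ?_
      have h2 : z * z ≤ 4 / 25 := by nlinarith
      have h3 : z * z * (e + 2) ≤ 4 / 25 * (e + 2) := by gcongr
      have h4 : (y : ℝ) / B * (4 / 5 * e + 1.1) ≤ 1 / 2 * (4 / 5 * e + 1.1) := by gcongr
      linarith
    rw [Finset.sum_range_succ', artanhSum_succ]
    have ih' := ih (i + 1) _ hstep
    have h0 : |B * z ^ (2 * i + 1) / (2 * i + 1 : ℝ) - ((y / (2 * i + 1) : ℕ) : ℝ)| ≤ e + 3 := by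
      refine (abs_sub_natDiv_le _ _ _).trans ?_
      have h1 : B * z ^ (2 * i + 1) / (2 * i + 1 : ℝ) - (y : ℝ) / ((2 * i + 1 : ℕ) : ℝ)
          = (B * z ^ (2 * i + 1) - y) / (2 * i + 1) := by push_cast; ring
      rw [h1, abs_div, abs_of_pos (by positivity : (0 : ℝ) < 2 * i + 1)]
      have h2 : |B * z ^ (2 * i + 1) - (y : ℝ)| / (2 * i + 1) ≤ |B * z ^ (2 * i + 1) - (y : ℝ)| :=
        div_le_self (abs_nonneg _) (by linarith [(Nat.cast_nonneg i : (0 : ℝ) ≤ i)])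
      linarith
    have hs : ∑ k ∈ Finset.range n, B * z ^ (2 * (i + (k + 1)) + 1) / (2 * (i + (k + 1 : ℕ)) + 1 : ℝ)
        = ∑ k ∈ Finset.range n, B * z ^ (2 * (i + 1 + k) + 1) / (2 * ((i + 1 : ℕ) + k) + 1 : ℝ) := by
      refine Finset.sum_congr rfl fun k _ => ?_
      push_cast
      ring_nf
    rw [hs]
    push_cast
    push_cast at ih'
    simp only [add_zero]
    have := abs_add_le (∑ k ∈ Finset.range n, B * z ^ (2 * (i + 1 + k) + 1) /
        (2 * ((i + 1 : ℝ) + k) + 1 : ℝ) - artanhSum B w n (i + 1) (y * w / B))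
      (B * z ^ (2 * i + 1) / (2 * i + 1 : ℝ) - ((y / (2 * i + 1) : ℕ) : ℝ))
    calc _ = _ := by congr 1; ring
      _ ≤ _ := this.trans (add_le_add ih' h0)
      _ = _ := by ring

theorem abs_log_sub_logRatioApprox_le {B N Z : ℕ} (hB : 0 < B) {z e : ℝ} (hz0 : 0 ≤ z)
    (hz : z ≤ 2 / 5) (he : 1 ≤ e) (heB : 10 * (e * e + 2) ≤ B) (hZ : |B * z - Z| ≤ e)
    (hN : B ≤ 2 ^ (2 * N)) :
    |B * (Real.log (1 + z) - Real.log (1 - z)) - logRatioApprox B N Z| ≤ 2 * (N * (e + 3) + 1) := by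
  have hB' : (0 : ℝ) < B := by exact_mod_cast hB
  have hee : e ≤ e * e := by nlinarith
  have hzZB : (Z : ℝ) / B ≤ 2 / 5 + e / B := by
    rw [div_le_iff₀ hB', add_mul, div_mul_cancel₀ _ hB'.ne']
    have := (abs_le.mp hZ).1
    nlinarith
  have hw : |B * (z * z) - ((Z * Z / B : ℕ) : ℝ)| ≤ 4 / 5 * e + 1.1 := by
    refine (abs_mul_sub_natDiv_le hB hz0 hZ hZ).trans ?_
    have h1 : z * e ≤ 2 / 5 * e := by gcongr
    have h2 : (Z : ℝ) / B * e ≤ (2 / 5 + e / B) * e := by gcongr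
    have h3 : e / B * e ≤ 1 / 10 := by
      rw [div_mul_eq_mul_div, div_le_iff₀ hB']
      linarith
    linarith
  have h1 := abs_sum_sub_artanhSum_le hB hz0 hz he (by linarith) hw N 0 Z
    (by simpa using hZ.trans (by linarith : e ≤ e + 2))
  have hsum := Real.hasSum_log_sub_log_of_abs_lt_one (x := z) (by rw [abs_of_nonneg hz0]; linarith)
  have hzz : z ^ 2 ≤ 1 / 4 := by nlinarith
  have hgeo := (hasSum_geometric_of_lt_one (sq_nonneg z) (by linarith)).mul_left (2 * z ^ (2 * N + 1))
  have htail := (hasSum_nat_add_iff' N).mpr hsum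
  have hle := hasSum_le (fun k => ?_) htail hgeo
  swap
  · have h2 : (1 : ℝ) / (2 * ((k + N : ℕ) : ℝ) + 1) ≤ 1 := by
      rw [div_le_one (by positivity)]
      have : (0 : ℝ) ≤ ((k + N : ℕ) : ℝ) := by positivity
      linarith
    calc 2 * (1 / (2 * ((k + N : ℕ) : ℝ) + 1)) * z ^ (2 * (k + N) + 1)
        ≤ 2 * 1 * z ^ (2 * (k + N) + 1) := by gcongr
      _ = 2 * z ^ (2 * N + 1) * (z ^ 2) ^ k := by ring
  have hnn := htail.nonneg (fun k => by positivity)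
  have hinv : (1 - z ^ 2)⁻¹ ≤ 4 / 3 := by
    rw [inv_le_comm₀ (by linarith) (by norm_num)]
    linarith
  have hinv0 : 0 ≤ (1 - z ^ 2)⁻¹ := inv_nonneg.mpr (by linarith)
  have hBz : B * z ^ (2 * N) ≤ 1 := by
    have hBN : (B : ℝ) ≤ 4 ^ N := by
      have : (4 : ℝ) ^ N = 2 ^ (2 * N) := by rw [pow_mul]; norm_num
      rw [this]
      exact_mod_cast hN
    calc B * z ^ (2 * N) ≤ 4 ^ N * (1 / 4) ^ N := by
          rw [pow_mul]
          gcongr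
      _ = 1 := by rw [← mul_pow]; norm_num
  have hBtail : B * (2 * z ^ (2 * N + 1) * (1 - z ^ 2)⁻¹) ≤ 2 := by
    calc B * (2 * z ^ (2 * N + 1) * (1 - z ^ 2)⁻¹)
        = 2 * (B * z ^ (2 * N)) * (z * (1 - z ^ 2)⁻¹) := by ring
      _ ≤ 2 * 1 * (2 / 5 * (4 / 3)) := by
          have := mul_le_mul hz hinv hinv0 (by norm_num : (0 : ℝ) ≤ 2 / 5)
          have h0 := mul_nonneg hz0 hinv0
          gcongr
      _ ≤ 2 := by norm_num
  have hBle := (mul_le_mul_of_nonneg_left hle hB'.le).trans hBtail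
  have hBnn := mul_nonneg hB'.le hnn
  rw [mul_sub, Finset.mul_sum] at hBle hBnn
  have hs : ∑ k ∈ Finset.range N, (B : ℝ) * (2 * (1 / (2 * (k : ℝ) + 1)) * z ^ (2 * k + 1))
      = 2 * ∑ k ∈ Finset.range N, B * z ^ (2 * (0 + k) + 1) / (2 * ((0 : ℕ) + k) + 1 : ℝ) := by
    rw [Finset.mul_sum]
    refine Finset.sum_congr rfl fun k _ => ?_
    simp only [Nat.cast_zero, zero_add]
    ring
  rw [hs] at hBle hBnn
  rw [logRatioApprox]
  push_cast at h1 ⊢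
  rw [abs_le] at h1 ⊢
  constructor <;> linarith [h1.1, h1.2]

/-- Fixed-point evaluation (scale `B`) of the powers of the number encoded by `Φ`. -/
def fixedPow (B Φ : ℕ) : ℕ → ℕ
  | 0 => B
  | k + 1 => fixedPow B Φ k * Φ / B

theorem inv_goldenRatio_sq : Real.goldenRatio⁻¹ ^ 2 = 1 - Real.goldenRatio⁻¹ := by
  rw [Real.inv_goldenRatio, neg_sq, Real.goldenConj_sq]
  ring

theorem inv_goldenRatio_pos : 0 < Real.goldenRatio⁻¹ := inv_pos.mpr Real.goldenRatio_pos

theorem inv_goldenRatio_le : Real.goldenRatio⁻¹ ≤ 0.6181 := by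
  have h := inv_goldenRatio_sq
  have := inv_goldenRatio_pos
  nlinarith

theorem abs_mul_inv_goldenRatio_sub_le {B Φ : ℕ} (h₁ : Φ * (Φ + B) ≤ B * B)
    (h₂ : B * B ≤ (Φ + 1) * (Φ + 1 + B)) : |B * Real.goldenRatio⁻¹ - Φ| ≤ 1 := by
  have h₁' : (Φ : ℝ) * (Φ + B) ≤ B * B := by exact_mod_cast h₁
  have h₂' : (B : ℝ) * B ≤ (Φ + 1) * (Φ + 1 + B) := by exact_mod_cast h₂
  have hg := inv_goldenRatio_sq
  have hg0 := inv_goldenRatio_pos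
  have hB : (0 : ℝ) ≤ B := B.cast_nonneg
  have hΦ : (0 : ℝ) ≤ Φ := Φ.cast_nonneg
  have hx : (B * Real.goldenRatio⁻¹) * (B * Real.goldenRatio⁻¹ + B) = (B : ℝ) * B := by
    linear_combination (B : ℝ) * B * hg
  have hx0 : 0 ≤ B * Real.goldenRatio⁻¹ := by positivity
  generalize B * Real.goldenRatio⁻¹ = x at *
  rw [abs_le]
  constructor <;> by_contra! hlt <;> nlinarith

theorem fixedPow_le {B Φ : ℕ} (hΦ : Φ ≤ B) (k : ℕ) : fixedPow B Φ k ≤ B := by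
  induction k with
  | zero => exact le_rfl
  | succ k ih =>
    rw [fixedPow]
    exact Nat.div_le_of_le_mul (Nat.mul_le_mul ih hΦ)

theorem abs_sub_fixedPow_le {B Φ : ℕ} (hB : 0 < B) (h₁ : Φ * (Φ + B) ≤ B * B)
    (h₂ : B * B ≤ (Φ + 1) * (Φ + 1 + B)) (k : ℕ) :
    |B * Real.goldenRatio⁻¹ ^ k - fixedPow B Φ k| ≤ 6 := by
  have hB' : (0 : ℝ) < B := by exact_mod_cast hB
  have hΦB : Φ ≤ B := by nlinarith
  induction k with
  | zero => simp [fixedPow]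
  | succ k ih =>
    rw [fixedPow, pow_succ]
    refine (abs_mul_sub_natDiv_le hB inv_goldenRatio_pos.le ih
      (abs_mul_inv_goldenRatio_sub_le h₁ h₂)).trans ?_
    have h3 : (fixedPow B Φ k : ℝ) / B ≤ 1 := by
      rw [div_le_one hB']
      exact_mod_cast fixedPow_le hΦB k
    linarith [inv_goldenRatio_le]

/-- The hypotheses making `Φ` a fixed-point approximation of `φ⁻¹` with scale `B`, and `N` terms of
the series for the logarithm sufficient at that scale. -/
structure IsFixedPointSetup (B Φ N : ℕ) : Prop where
  le_scale : 380 ≤ B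
  scale_le : B ≤ 2 ^ (2 * N)
  mul_le : Φ * (Φ + B) ≤ B * B
  le_mul : B * B ≤ (Φ + 1) * (Φ + 1 + B)

namespace IsFixedPointSetup

variable {B Φ N : ℕ}

theorem scale_pos (h : IsFixedPointSetup B Φ N) : 0 < B := by have := h.le_scale; omega

theorem abs_log_sub_le (h : IsFixedPointSetup B Φ N) {z : ℝ} {Z : ℕ} (hz0 : 0 ≤ z) (hz : z ≤ 2 / 5)
    (hZ : |B * z - Z| ≤ 6) :
    |B * (Real.log (1 + z) - Real.log (1 - z)) - logRatioApprox B N Z| ≤ ((18 * N + 2 : ℕ) : ℝ) := by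
  have hB : (380 : ℝ) ≤ B := by exact_mod_cast h.le_scale
  refine (abs_log_sub_logRatioApprox_le h.scale_pos hz0 hz (e := 6) (by norm_num)
    (by linarith) hZ h.scale_le).trans_eq ?_
  push_cast
  ring

theorem abs_log_two_sub_le (h : IsFixedPointSetup B Φ N) :
    |B * Real.log 2 - logRatioApprox B N (B / 3)| ≤ ((18 * N + 2 : ℕ) : ℝ) := by
  have h1 := h.abs_log_sub_le (z := 1 / 3) (Z := B / 3) (by norm_num) (by norm_num)
    ((abs_sub_natDiv_le _ _ _).trans (by
      have : (B : ℝ) * (1 / 3) - B / ((3 : ℕ) : ℝ) = 0 := by push_cast; ring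
      rw [this]; norm_num))
  rw [← Real.log_div (by norm_num) (by norm_num)] at h1
  norm_num at h1 ⊢
  exact h1

theorem abs_log_goldenRatio_sub_le (h : IsFixedPointSetup B Φ N) :
    |B * Real.log Real.goldenRatio - logRatioApprox B N (fixedPow B Φ 3)|
      ≤ ((18 * N + 2 : ℕ) : ℝ) := by
  have hg := inv_goldenRatio_sq
  have hg0 := inv_goldenRatio_pos
  have hg1 := inv_goldenRatio_le
  have hg3 : Real.goldenRatio⁻¹ ^ 3 = 2 * Real.goldenRatio⁻¹ - 1 := by
    linear_combination (Real.goldenRatio⁻¹ - 1) * hg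
  have h1 := h.abs_log_sub_le (z := Real.goldenRatio⁻¹ ^ 3) (by positivity) (by rw [hg3]; linarith)
    (abs_sub_fixedPow_le h.scale_pos h.mul_le h.le_mul 3)
  rw [← Real.log_div (by positivity) (by rw [hg3]; linarith)] at h1
  have h2 : (1 + Real.goldenRatio⁻¹ ^ 3) / (1 - Real.goldenRatio⁻¹ ^ 3) = Real.goldenRatio := by
    rw [div_eq_iff (by rw [hg3]; linarith)]
    have h3 : Real.goldenRatio = 1 + Real.goldenRatio⁻¹ := by
      rw [Real.inv_goldenRatio, ← Real.goldenRatio_add_goldenConj]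
      ring
    rw [hg3]
    generalize Real.goldenRatio⁻¹ = g at *
    rw [h3]
    linear_combination 2 * hg
  rwa [h2] at h1

theorem abs_half_log_five_sub_le (h : IsFixedPointSetup B Φ N) :
    |B * (Real.log 5 / 2) - logRatioApprox B N (fixedPow B Φ 2)| ≤ ((18 * N + 2 : ℕ) : ℝ) := by
  have hg := inv_goldenRatio_sq
  have hg0 := inv_goldenRatio_pos
  have hg1 := inv_goldenRatio_le
  have hlow : 0.6 ≤ Real.goldenRatio⁻¹ := by nlinarith
  have h1 := h.abs_log_sub_le (z := Real.goldenRatio⁻¹ ^ 2) (by positivity) (by rw [hg]; linarith)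
    (abs_sub_fixedPow_le h.scale_pos h.mul_le h.le_mul 2)
  rw [← Real.log_div (by positivity) (by rw [hg]; linarith)] at h1
  have h2 : (1 + Real.goldenRatio⁻¹ ^ 2) / (1 - Real.goldenRatio⁻¹ ^ 2) = √5 := by
    rw [div_eq_iff (by rw [hg]; linarith)]
    have h5 : √5 = 2 * Real.goldenRatio⁻¹ + 1 := by
      rw [Real.inv_goldenRatio, Real.goldenConj]
      ring
    rw [h5]
    generalize Real.goldenRatio⁻¹ = g at *
    linear_combination 2 * g * hg
  rwa [h2, Real.log_sqrt (by norm_num)] at h1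

theorem abs_log_inv_pow_add_one_sub_le (h : IsFixedPointSetup B Φ N) {k : ℕ} (hk : 0 < k) :
    |B * Real.log (1 + Real.goldenRatio⁻¹ ^ k)
      - logRatioApprox B N (fixedPow B Φ k * B / (2 * B + fixedPow B Φ k))|
      ≤ ((18 * N + 2 : ℕ) : ℝ) := by
  have hB' : (0 : ℝ) < B := by exact_mod_cast h.scale_pos
  have hy0 : 0 < Real.goldenRatio⁻¹ ^ k := pow_pos inv_goldenRatio_pos k
  have hy1 : Real.goldenRatio⁻¹ ^ k ≤ 0.6181 :=
    (pow_le_pow_of_le_one inv_goldenRatio_pos.le (inv_goldenRatio_le.trans (by norm_num))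
      hk).trans (by simpa using inv_goldenRatio_le)
  have hx := abs_sub_fixedPow_le h.scale_pos h.mul_le h.le_mul k
  generalize Real.goldenRatio⁻¹ ^ k = y at *
  generalize fixedPow B Φ k = x at *
  have hz0 : 0 ≤ y / (2 + y) := by positivity
  have hz : y / (2 + y) ≤ 2 / 5 := by
    rw [div_le_div_iff₀ (by positivity) (by norm_num)]
    linarith
  have hx0 : (0 : ℝ) ≤ x := x.cast_nonneg
  have h1 := h.abs_log_sub_le (z := y / (2 + y)) (Z := x * B / (2 * B + x)) hz0 hz
    ((abs_sub_natDiv_le _ _ _).trans (by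
      have h2 : (B : ℝ) * (y / (2 + y)) - ((x * B : ℕ) : ℝ) / ((2 * B + x : ℕ) : ℝ)
          = (2 * B / ((2 + y) * (2 * B + x))) * (B * y - x) := by
        push_cast
        field_simp
        ring
      rw [h2, abs_mul, abs_of_nonneg (by positivity)]
      have h3 : 2 * B / ((2 + y) * (2 * B + x)) ≤ 1 / 2 := by
        rw [div_le_div_iff₀ (by positivity) (by norm_num)]
        nlinarith [mul_nonneg hy0.le hx0, mul_pos hy0 hB']
      have := mul_le_mul h3 hx (abs_nonneg _) (by norm_num)
      linarith))
  have hne : 1 - y / (2 + y) = 2 / (2 + y) := by field_simp; ring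
  rw [← Real.log_div (by positivity) (by rw [hne]; positivity)] at h1
  have h2 : (1 + y / (2 + y)) / (1 - y / (2 + y)) = 1 + y := by
    rw [hne]
    field_simp
    ring
  rwa [h2] at h1

end IsFixedPointSetup

theorem le_mul_abs_int_mul_sub {B E q δ ℓ t : ℕ} {τ h : ℝ} (hτ : 0 ≤ τ) (hℓ : |B * τ - ℓ| ≤ E)
    (ht : |B * h - t| ≤ 2 * E) (htℓ : t ≤ 2 * ℓ) (h₁ : δ + (4 * q + 1) * E ≤ q * t % ℓ)
    (h₂ : q * t % ℓ + (δ + (4 * q + 1) * E) ≤ ℓ) (M : ℤ) : δ ≤ B * |M * τ - q * h| := by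
  have hQ : q * t / ℓ ≤ 2 * q :=
    Nat.div_le_of_le_mul (by nlinarith [Nat.mul_le_mul_left q htℓ])
  have hdiv : ((q * t : ℕ) : ℝ) = ((ℓ * (q * t / ℓ) + q * t % ℓ : ℕ) : ℝ) := by
    rw [Nat.div_add_mod]
  generalize q * t / ℓ = Q at *
  generalize q * t % ℓ = r at *
  push_cast at hdiv
  have hQ' : (Q : ℝ) ≤ 2 * q := by exact_mod_cast hQ
  have h₁' : (δ : ℝ) + (4 * q + 1) * E ≤ r := by exact_mod_cast h₁
  have h₂' : (r : ℝ) + (δ + (4 * q + 1) * E) ≤ ℓ := by exact_mod_cast h₂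
  have hB : (0 : ℝ) ≤ B := B.cast_nonneg
  have hE : (0 : ℝ) ≤ E := E.cast_nonneg
  have hq : (0 : ℝ) ≤ q := q.cast_nonneg
  obtain ⟨hℓ1, hℓ2⟩ := abs_le.mp hℓ
  obtain ⟨ht1, ht2⟩ := abs_le.mp ht
  have hid : B * (M * τ - q * h) = (M - Q) * (B * τ) + Q * (B * τ - ℓ) - r - q * (B * h - t) := by
    linear_combination (-1) * hdiv
  have e1 : Q * (B * τ - ℓ) ≤ 2 * q * E :=
    (mul_le_mul_of_nonneg_left hℓ2 Q.cast_nonneg).trans (mul_le_mul_of_nonneg_right hQ' hE)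
  have e2 : -(2 * q * E) ≤ Q * (B * τ - ℓ) := by
    have := mul_le_mul_of_nonneg_left hℓ1 (Q.cast_nonneg (α := ℝ))
    have := mul_le_mul_of_nonneg_right hQ' hE
    linarith
  have e3 := mul_le_mul_of_nonneg_left ht1 hq
  have e4 := mul_le_mul_of_nonneg_left ht2 hq
  have habs : B * |M * τ - q * h| = |B * (M * τ - q * h)| := by rw [abs_mul, Nat.abs_cast]
  rw [habs, hid]
  rcases le_or_gt M Q with hM | hM
  · have hM' : (M : ℝ) - Q ≤ 0 := by
      have : (M : ℝ) ≤ ((Q : ℤ) : ℝ) := by exact_mod_cast hM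
      simpa using this
    have := mul_nonpos_of_nonpos_of_nonneg hM' (mul_nonneg hB hτ)
    refine le_trans ?_ (neg_le_abs _)
    linarith
  · have hM' : 1 ≤ (M : ℝ) - Q := by
      have : ((Q : ℤ) : ℝ) + 1 ≤ M := by exact_mod_cast hM
      push_cast at this
      linarith
    have := mul_le_mul_of_nonneg_right hM' (mul_nonneg hB hτ)
    refine le_trans ?_ (le_abs_self _)
    linarith

/-- Checks that the residue `r` modulo `ℓ` has distance at least `δ` from `0`. -/
def gapCheck (δ ℓ : ℕ) : ℕ → Bool
  | 0 => false
  | r + 1 => Nat.ble δ (r + 1) && Nat.ble (r + 1 + δ) ℓ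

theorem gapCheck_spec {δ ℓ r : ℕ} (h : gapCheck δ ℓ r = true) : 0 < r ∧ δ ≤ r ∧ r + δ ≤ ℓ := by
  cases r with
  | zero => simp [gapCheck] at h
  | succ r =>
    rw [gapCheck, Bool.and_eq_true, Nat.ble_eq, Nat.ble_eq] at h
    exact ⟨r.succ_pos, h⟩

/-- The approximation of `log (1 + φ⁻ᵏ)` computed from an approximation `x` of `φ⁻ᵏ`. -/
def logOneAddApprox (B N x : ℕ) : ℕ := logRatioApprox B N (x * B / (2 * B + x))

/-- Checks the gap condition of the Baker–Davenport reduction for `n` consecutive values of `k`,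
the exceptional values `2` and `6` excluded. -/
def reductionCheck (B Φ N q ℓ₂ ℓ₅ δ : ℕ) : ℕ → ℕ → ℕ → Bool
  | 0, _, _ => true
  | _ + 1, 0, _ => false
  | _ + 1, _ + 1, 0 => false
  | n + 1, k + 1, x + 1 =>
    (Nat.beq (k + 1) 2 || Nat.beq (k + 1) 6 ||
      gapCheck δ ℓ₂ (q * (ℓ₅ - logOneAddApprox B N (x + 1)) % ℓ₂)) &&
    reductionCheck B Φ N q ℓ₂ ℓ₅ δ n (k + 2) ((x + 1) * Φ / B)

theorem reductionCheck_spec {B Φ N q ℓ₂ ℓ₅ δ n k : ℕ}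
    (h : reductionCheck B Φ N q ℓ₂ ℓ₅ δ n k (fixedPow B Φ k) = true) {i : ℕ} (hk : k ≤ i)
    (hi : i < k + n) (h2 : i ≠ 2) (h6 : i ≠ 6) :
    gapCheck δ ℓ₂ (q * (ℓ₅ - logOneAddApprox B N (fixedPow B Φ i)) % ℓ₂) = true := by
  induction n generalizing k with
  | zero => omega
  | succ n ih =>
    cases k with
    | zero => simp [reductionCheck] at h
    | succ k =>
      have hstep : fixedPow B Φ (k + 2) = fixedPow B Φ (k + 1) * Φ / B := rfl
      cases hx : fixedPow B Φ (k + 1) with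
      | zero => simp [hx, reductionCheck] at h
      | succ x =>
        rw [hx] at h hstep
        rw [reductionCheck, Bool.and_eq_true, ← hstep] at h
        rcases hk.eq_or_lt with rfl | hlt
        · have h1 := h.1
          rw [Bool.or_eq_true, Bool.or_eq_true, Nat.beq_eq, Nat.beq_eq] at h1
          rw [hx]
          tauto
        · exact ih h.2 hlt (by omega)

theorem log_two_le_of_coprime {q p n : ℕ} (hqp : q.Coprime p) (hn : 0 < n) (hnq : n < q) (a : ℤ)
    (x : ℝ) :
    Real.log 2 ≤ q * |n * x - a * Real.log 2| + n * |q * x - p * Real.log 2| := by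
  have hne : (n : ℤ) * p - a * q ≠ 0 := by
    intro h
    have h1 : (q : ℤ) ∣ n * p := ⟨a, by linarith⟩
    have h2 : q ∣ n * p := by exact_mod_cast h1
    exact absurd (Nat.le_of_dvd hn (hqp.dvd_of_dvd_mul_right h2)) (by omega)
  have h1 : (1 : ℝ) ≤ |(((n : ℤ) * p - a * q : ℤ) : ℝ)| := by
    rw [← Int.cast_abs]
    exact_mod_cast Int.one_le_abs hne
  have hl := Real.log_pos (one_lt_two : (1 : ℝ) < 2)
  calc Real.log 2 ≤ |(((n : ℤ) * p - a * q : ℤ) : ℝ)| * Real.log 2 := by nlinarith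
    _ = |q * (n * x - a * Real.log 2) - n * (q * x - p * Real.log 2)| := by
      rw [← abs_of_pos hl, ← abs_mul, abs_of_pos hl]
      congr 1
      push_cast
      ring
    _ ≤ _ := by
      refine (abs_sub _ _).trans_eq ?_
      rw [abs_mul, abs_mul, Nat.abs_cast, Nat.abs_cast]

theorem log_goldenRatio_pow_add_one (k : ℕ) : Real.log (Real.goldenRatio ^ k + 1)
    = k * Real.log Real.goldenRatio + Real.log (1 + Real.goldenRatio⁻¹ ^ k) := by
  have h0 := Real.goldenRatio_pos
  rw [← Real.log_pow, ← Real.log_mul (by positivity) (by positivity), mul_add, ← mul_pow,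
    mul_inv_cancel₀ h0.ne', one_pow, mul_one]

theorem sqrt_five_eq : √5 = 2 * Real.goldenRatio - 1 := by
  rw [Real.goldenRatio]
  ring

theorem log_goldenRatio_sq_add_one :
    Real.log (Real.goldenRatio ^ 2 + 1) = Real.log 5 / 2 + Real.log Real.goldenRatio := by
  have h0 := Real.goldenRatio_pos
  rw [← Real.log_sqrt (by norm_num), ← Real.log_mul (by positivity) h0.ne', sqrt_five_eq]
  congr 1
  have := Real.goldenRatio_sq
  generalize Real.goldenRatio = x at *
  linear_combination (-1) * this

theorem log_goldenRatio_pow_six_add_one : Real.log (Real.goldenRatio ^ 6 + 1)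
    = Real.log 5 / 2 + 3 * Real.log Real.goldenRatio + Real.log 2 := by
  have h0 := Real.goldenRatio_pos
  have h3 : 3 * Real.log Real.goldenRatio = Real.log (Real.goldenRatio ^ 3) := by
    rw [Real.log_pow]
    norm_num
  rw [h3, ← Real.log_sqrt (by norm_num), ← Real.log_mul (by positivity) (by positivity),
    ← Real.log_mul (by positivity) (by positivity), sqrt_five_eq]
  congr 1
  have := Real.goldenRatio_sq
  generalize Real.goldenRatio = x at *
  linear_combination (x ^ 4 + x ^ 3 - 2 * x ^ 2 + x - 1) * this

/-- The numerical input of the Baker–Davenport reduction. -/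
structure IsReductionSetup (B Φ N q p ℓ₂ ℓ₅ δ K : ℕ) : Prop extends IsFixedPointSetup B Φ N where
  log_two : logRatioApprox B N (B / 3) = ℓ₂
  half_log_five : logRatioApprox B N (fixedPow B Φ 2) = ℓ₅
  le_two_mul : ℓ₅ ≤ 2 * ℓ₂
  le_log_two : δ + (4 * q + 1) * (18 * N + 2) ≤ ℓ₂
  coprime : q.Coprime p
  gap : gapCheck (δ + (4 * q + 1) * (18 * N + 2)) ℓ₂ (q * ℓ₅ % ℓ₂) = true
  check : reductionCheck B Φ N q ℓ₂ ℓ₅ (δ + (4 * q + 1) * (18 * N + 2)) K 1 (fixedPow B Φ 1) = true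

namespace IsReductionSetup

variable {B Φ N q p ℓ₂ ℓ₅ δ K : ℕ}

theorem abs_log_two_sub (h : IsReductionSetup B Φ N q p ℓ₂ ℓ₅ δ K) :
    |B * Real.log 2 - ℓ₂| ≤ ((18 * N + 2 : ℕ) : ℝ) :=
  h.log_two ▸ h.toIsFixedPointSetup.abs_log_two_sub_le

theorem abs_half_log_five_sub (h : IsReductionSetup B Φ N q p ℓ₂ ℓ₅ δ K) :
    |B * (Real.log 5 / 2) - ℓ₅| ≤ ((18 * N + 2 : ℕ) : ℝ) :=
  h.half_log_five ▸ h.toIsFixedPointSetup.abs_half_log_five_sub_le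

theorem le_of_log_two_le (h : IsReductionSetup B Φ N q p ℓ₂ ℓ₅ δ K) {x : ℝ}
    (hx : Real.log 2 ≤ x) : δ ≤ B * x := by
  have h1 := (abs_le.mp h.abs_log_two_sub).1
  have h2 : (δ : ℝ) + ((4 * q + 1 : ℕ) : ℝ) * ((18 * N + 2 : ℕ) : ℝ) ≤ ℓ₂ := by
    exact_mod_cast h.le_log_two
  have h3 : (1 : ℝ) * ((18 * N + 2 : ℕ) : ℝ) ≤ ((4 * q + 1 : ℕ) : ℝ) * ((18 * N + 2 : ℕ) : ℝ) := by
    gcongr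
    push_cast
    linarith [(q.cast_nonneg : (0 : ℝ) ≤ q)]
  have h4 := mul_le_mul_of_nonneg_left hx (B.cast_nonneg : (0 : ℝ) ≤ B)
  linarith

theorem le_of_gapCheck (h : IsReductionSetup B Φ N q p ℓ₂ ℓ₅ δ K) {t : ℕ} {y : ℝ} (htℓ : t ≤ ℓ₅)
    (ht : |B * y - t| ≤ 2 * ((18 * N + 2 : ℕ) : ℝ))
    (hgap : gapCheck (δ + (4 * q + 1) * (18 * N + 2)) ℓ₂ (q * t % ℓ₂) = true) (n : ℕ) (a : ℤ) :
    δ ≤ B * (q * |n * Real.log Real.goldenRatio - y - a * Real.log 2|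
      + n * |q * Real.log Real.goldenRatio - p * Real.log 2|) := by
  obtain ⟨-, h1, h2⟩ := gapCheck_spec hgap
  refine (le_mul_abs_int_mul_sub (Real.log_nonneg one_le_two) h.abs_log_two_sub ht
    (htℓ.trans h.le_two_mul) h1 h2 (n * p - a * q)).trans
      (mul_le_mul_of_nonneg_left ?_ B.cast_nonneg)
  have h3 : (((n : ℤ) * p - a * q : ℤ) : ℝ) * Real.log 2 - q * y
      = q * (n * Real.log Real.goldenRatio - y - a * Real.log 2)
        - n * (q * Real.log Real.goldenRatio - p * Real.log 2) := by
    push_cast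
    ring
  rw [h3]
  refine (abs_sub _ _).trans_eq ?_
  rw [abs_mul, abs_mul, Nat.abs_cast, Nat.abs_cast]

theorem le_logForm_one (h : IsReductionSetup B Φ N q p ℓ₂ ℓ₅ δ K) (n a : ℕ) :
    δ ≤ B * (q * |logForm n a 1|
      + n * |q * Real.log Real.goldenRatio - p * Real.log 2|) := by
  have h1 := h.le_of_gapCheck le_rfl (h.abs_half_log_five_sub.trans
    (by linarith [((18 * N + 2).cast_nonneg : (0 : ℝ) ≤ ((18 * N + 2 : ℕ) : ℝ))])) h.gap n a
  rw [logForm, Real.log_one, add_zero]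
  exact_mod_cast h1

theorem le_logForm (h : IsReductionSetup B Φ N q p ℓ₂ ℓ₅ δ K) {n m k a : ℕ} (hn : n = m + k)
    (hnq : n < q) (hm : 0 < m) (hk : 0 < k) (hkK : k ≤ K) :
    δ ≤ B * (q * |logForm m a (Real.goldenRatio ^ k + 1)|
      + n * |q * Real.log Real.goldenRatio - p * Real.log 2|) := by
  have hω := abs_nonneg (q * Real.log Real.goldenRatio - p * Real.log 2)
  rcases eq_or_ne k 2 with rfl | h2
  · refine h.le_of_log_two_le ((log_two_le_of_coprime h.coprime (n := m + 1) (by omega) (by omega)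
      a (Real.log Real.goldenRatio)).trans ?_)
    have heq : logForm m a (Real.goldenRatio ^ 2 + 1)
        = ((m + 1 : ℕ) : ℝ) * Real.log Real.goldenRatio - ((a : ℤ) : ℝ) * Real.log 2 := by
      rw [logForm, log_goldenRatio_sq_add_one]
      push_cast
      ring
    rw [heq]
    gcongr
    omega
  rcases eq_or_ne k 6 with rfl | h6
  · refine h.le_of_log_two_le ((log_two_le_of_coprime h.coprime (n := m + 3) (by omega) (by omega)
      (a - 1) (Real.log Real.goldenRatio)).trans ?_)
    have heq : logForm m a (Real.goldenRatio ^ 6 + 1)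
        = ((m + 3 : ℕ) : ℝ) * Real.log Real.goldenRatio - (((a : ℤ) - 1 : ℤ) : ℝ) * Real.log 2 := by
      rw [logForm, log_goldenRatio_pow_six_add_one]
      push_cast
      ring
    rw [heq]
    gcongr
    omega
  have hgap := reductionCheck_spec h.check (i := k) hk (by omega) h2 h6
  have hL := h.toIsFixedPointSetup.abs_log_inv_pow_add_one_sub_le hk
  rw [← logOneAddApprox] at hL
  have h5 := h.abs_half_log_five_sub
  have hlt : logOneAddApprox B N (fixedPow B Φ k) ≤ ℓ₅ := by
    by_contra! hlt
    have := (gapCheck_spec hgap).1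
    simp [Nat.sub_eq_zero_of_le hlt.le] at this
  have h1 := h.le_of_gapCheck (Nat.sub_le _ _)
    (y := Real.log 5 / 2 - Real.log (1 + Real.goldenRatio⁻¹ ^ k)) (by
      rw [Nat.cast_sub hlt]
      rw [abs_le] at hL h5 ⊢
      constructor <;> linarith) hgap n a
  have h3 : logForm m a (Real.goldenRatio ^ k + 1) = n * Real.log Real.goldenRatio
      - (Real.log 5 / 2 - Real.log (1 + Real.goldenRatio⁻¹ ^ k)) - a * Real.log 2 := by
    rw [logForm, log_goldenRatio_pow_add_one, hn]
    push_cast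
    ring
  rw [h3]
  exact_mod_cast h1

end IsReductionSetup

/-- The scale of the fixed-point computations. -/
def fixedScale : ℕ := 2 ^ 1120

/-- Fixed-point approximation of `φ⁻¹`. -/
def fixedInvGolden : ℕ :=
  8802529787998443716085297483248103862149812387793426367108433868410920936816094132839310956310027588330920264761490124033480103515218381293715621222878258602505306432017882338320652810743917792829056663020208079786220836064015576825717355647060384620552095948019130860257508274231273339170505066632371521802868766497226670351360256263411

/-- Fixed-point approximation of `log 2`. -/
def fixedLogTwo : ℕ :=
  9872351384245924237546941767156526710145840668712397746712573058841711422024024448403233508825728025699277113092048226357119323104347665152892780142225445309170058899373611188736419158961552726655930668505700666368546756755154167054976927784192658442311902102904713276736760153240753657128500769061368509732617065011511876728730579447700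

/-- Fixed-point approximation of `log φ`. -/
def fixedLogGolden : ℕ :=
  6853800117032764096878031056746445326806140656053532396508497099154257929806933621458383694773773548884733263804890549344041292379001587046043232468943699019448788025822180938517284266288422142185322703418696854205777162156965711808961309619435757313533524287834291782852181715097225422844107035178471736085647874064248501846830090820800

/-- Fixed-point approximation of `log 5 / 2`. -/
def fixedHalfLogFive : ℕ :=
  11461445020840376697740517557006144895530002284508786528393195792567911951702010630786561759983696931510779488790222251527606116061129652977045365953836209121415718725294442096743444395146976831079106387432889514762986234370237068040148152136562610051225237130878787797519637501784316856028139768126349570313974445078183803697278885350992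

/-- Denominator of a convergent of `log φ / log 2`. -/
def convergentDen : ℕ :=
  3492954691388279508660745833925230201234457751214393983093958169735105217811233031544096958108061603927789989170297951117410575152884133120848060526819675692364269

/-- Numerator of a convergent of `log φ / log 2`. -/
def convergentNum : ℕ :=
  2424955549174441454450461951251725105249296262810496965332273520848686565431115948188258338527107678914813528656058928401312017151550992538037122069975187322400377

theorem isReductionSetup : IsReductionSetup fixedScale fixedInvGolden 560 convergentDen
    convergentNum fixedLogTwo fixedHalfLogFive (2 ^ 1109) 836 where
  le_scale := by decide +kernel
  scale_le := by decide +kernel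
  mul_le := by decide +kernel
  le_mul := by decide +kernel
  log_two := by decide +kernel
  half_log_five := by decide +kernel
  le_two_mul := by decide +kernel
  le_log_two := by decide +kernel
  coprime := by decide +kernel
  gap := by decide +kernel
  check := by decide +kernel

theorem abs_log_goldenRatio_sub_fixed :
    |fixedScale * Real.log Real.goldenRatio - fixedLogGolden| ≤ ((18 * 560 + 2 : ℕ) : ℝ) := by
  have h := isReductionSetup.toIsFixedPointSetup.abs_log_goldenRatio_sub_le
  have h1 : logRatioApprox fixedScale 560 (fixedPow fixedScale fixedInvGolden 3)
      = fixedLogGolden := by decide +kernel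
  rwa [h1] at h

theorem abs_mul_sub_mul_le {B ℓ ℓ' E q p x y : ℕ} {u v : ℝ} (hB : 0 < B) (hy : 0 < y)
    (hu : |B * u - ℓ| ≤ E) (hv : |B * v - ℓ'| ≤ E)
    (h₁ : (q * ℓ + (q + p) * E) * y ≤ p * ℓ' * y + x * B)
    (h₂ : (p * ℓ' + (q + p) * E) * y ≤ q * ℓ * y + x * B) : |q * u - p * v| ≤ (x : ℝ) / y := by
  have hB' : (0 : ℝ) < B := by exact_mod_cast hB
  have hy' : (0 : ℝ) < y := by exact_mod_cast hy
  have h₁' : ((q : ℝ) * ℓ + (q + p) * E) * y ≤ p * ℓ' * y + x * B := by exact_mod_cast h₁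
  have h₂' : ((p : ℝ) * ℓ' + (q + p) * E) * y ≤ q * ℓ * y + x * B := by exact_mod_cast h₂
  rw [le_div_iff₀ hy', ← mul_le_mul_iff_right₀ hB']
  have hq : (0 : ℝ) ≤ q * y := by positivity
  have hp : (0 : ℝ) ≤ p * y := by positivity
  have e1 := mul_le_mul_of_nonneg_left (abs_le.mp hu).1 hq
  have e2 := mul_le_mul_of_nonneg_left (abs_le.mp hu).2 hq
  have e3 := mul_le_mul_of_nonneg_left (abs_le.mp hv).1 hp
  have e4 := mul_le_mul_of_nonneg_left (abs_le.mp hv).2 hp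
  have habs : B * (|q * u - p * v| * y) = |q * y * (B * u) - p * y * (B * v)| := by
    have h : q * y * (B * u) - p * y * (B * v) = B * ((q * u - p * v) * y) := by ring
    rw [h, abs_mul, abs_mul, Nat.abs_cast, Nat.abs_cast]
  rw [habs, abs_le]
  constructor <;> linarith

theorem abs_mul_log_sub_mul_log_le {q p x y : ℕ} (hy : 0 < y)
    (h₁ : (q * fixedLogGolden + (q + p) * (18 * 560 + 2)) * y
      ≤ p * fixedLogTwo * y + x * fixedScale)
    (h₂ : (p * fixedLogTwo + (q + p) * (18 * 560 + 2)) * y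
      ≤ q * fixedLogGolden * y + x * fixedScale) :
    |q * Real.log Real.goldenRatio - p * Real.log 2| ≤ (x : ℝ) / y :=
  abs_mul_sub_mul_le isReductionSetup.toIsFixedPointSetup.scale_pos hy
    abs_log_goldenRatio_sub_fixed isReductionSetup.abs_log_two_sub h₁ h₂

theorem mul_mul_mul_div_le {A C D S X n : ℕ} (h : A * (X * S) ≤ C * D) :
    A * (X * (S * (n / D))) ≤ C * n :=
  calc A * (X * (S * (n / D))) = A * (X * S) * (n / D) := by ring
    _ ≤ C * D * (n / D) := Nat.mul_le_mul_right _ h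
    _ = C * (D * (n / D)) := by ring
    _ ≤ C * n := Nat.mul_le_mul_left _ (Nat.mul_div_le _ _)

theorem exists_le_logForm_one {n a : ℕ} (hn : 10 ^ 158 ≤ n) :
    ∃ u : ℕ, 2 ^ 143 * u ≤ n ∧ 1 / 2 ^ u ≤ |logForm n a 1| := by
  have hω := abs_mul_log_sub_mul_log_le
    (q := 26895719650901875452861714456128906108719290127809139)
    (p := 18672135878914716344257156781724082363705564787435768) (x := 5) (y := 10 ^ 54)
    (by norm_num) (by decide +kernel) (by decide +kernel)
  refine ⟨_, ?_, logForm_lower_bound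
    (q := 26895719650901875452861714456128906108719290127809139)
    (p := 18672135878914716344257156781724082363705564787435768)
    (b := 166) (e := 9) (L := 400) (j := 99) (X := 891) (π := 223) (H₁ := 81) (H₂ := 28)
    (S := 74504127358830078055110037924113869382094302954311607625)
    (c := 31178701596392595588345276431280704419326560916821)
    (D := 838573617215702007901848193902111320797799294868096907326702098546580584350576821273824729829559199702)
    (G := 32274863581082250543434057347354687330463148153370970000) (n := n) (n' := n) (ν := 0)
    (by norm_num) (by norm_num) (by norm_num) (by norm_num) (by norm_num) (by norm_num)
    (by norm_num) (by norm_num) (by norm_num) hω (by norm_num) (by norm_num) (by norm_num)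
    (by norm_num) (by norm_num) (by norm_num) (by norm_num) (by norm_num) le_rfl (by omega)
    (le_trans (by norm_num) hn) (by simp) IsConjPair.one le_rfl (by norm_num) (by norm_num)⟩
  refine (mul_mul_mul_div_le (C := 1) ?_).trans_eq (one_mul n)
  norm_num

theorem exists_le_logForm_of_le {n n' a ν : ℕ} {B B' : ℝ} (hn : 10 ^ 68 ≤ n) (hnn : n' ≤ n)
    (hnn' : n ≤ 2 * n') (hν : ν * 2 ^ 144 ≤ 3 * n + 2 ^ 147) (hB : IsConjPair B B') (hB1 : 1 ≤ B)
    (hB2 : B ≤ 2 ^ ν) (hB3 : |B'| ≤ 3) :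
    ∃ u : ℕ, 3 * u * 2 ^ 45 ≤ 2 * n ∧ 1 / 2 ^ u ≤ |logForm n' a B| := by
  have hω := abs_mul_log_sub_mul_log_le (q := 60185518238575617799402)
    (p := 41783309354799156411575) (x := 3) (y := 10 ^ 25)
    (by norm_num) (by decide +kernel) (by decide +kernel)
  have hdiv' := Nat.lt_div_mul_add (a := n) (b := 740151234593721939332260399519962770024614)
    (by norm_num)
  refine ⟨_, ?_, logForm_lower_bound (q := 60185518238575617799402) (p := 41783309354799156411575)
    (b := 65) (e := 14) (L := 144) (j := 28) (X := 392) (π := 79) (H₁ := 50) (H₂ := 50)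
    (S := 35003315592357058416956936) (c := 12297829382473034410)
    (D := 740151234593721939332260399519962770024614) (G := 26000143879064666889342816)
    (n := n) (n' := n') (ν := ν)
    (by norm_num) (by norm_num) (by norm_num) (by norm_num) (by norm_num) (by norm_num)
    (by norm_num) (by norm_num) (by norm_num) hω (by norm_num) (by norm_num) (by norm_num)
    (by norm_num) (by norm_num) (by norm_num) (by norm_num) (by norm_num) hnn hnn'
    (le_trans (by norm_num) hn) ?_ hB hB1 hB2 hB3⟩
  · rw [mul_right_comm]
    exact mul_mul_mul_div_le (by norm_num)
  · omega

theorem exists_le_logForm {n n' a ν : ℕ} {B B' : ℝ} (hn : 10 ^ 29 ≤ n) (hnn : n' ≤ n)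
    (hnn' : n ≤ 2 * n') (hν : ν * 2 ^ 45 ≤ n + 9 * 2 ^ 45) (hB : IsConjPair B B') (hB1 : 1 ≤ B)
    (hB2 : B ≤ 2 ^ ν) (hB3 : |B'| ≤ 3) :
    ∃ u : ℕ, 100 * u ≤ 31 * n ∧ 1 / 2 ^ u ≤ |logForm n' a B| := by
  have hω := abs_mul_log_sub_mul_log_le (q := 9148265) (p := 6351109) (x := 6) (y := 10 ^ 10)
    (by norm_num) (by decide +kernel) (by decide +kernel)
  have hdiv' := Nat.lt_div_mul_add (a := n) (b := 1598741643135) (by norm_num)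
  refine ⟨_, ?_, logForm_lower_bound (q := 9148265) (p := 6351109)
    (b := 19) (e := 9) (L := 96) (j := 19) (X := 171) (π := 36) (H₁ := 42) (H₂ := 15)
    (S := 2815101846) (c := 174762) (D := 1598741643135) (G := 2634701088)
    (n := n) (n' := n') (ν := ν)
    (by norm_num) (by norm_num) (by norm_num) (by norm_num) (by norm_num) (by norm_num)
    (by norm_num) (by norm_num) (by norm_num) hω (by norm_num) (by norm_num) (by norm_num)
    (by norm_num) (by norm_num) (by norm_num) (by norm_num) (by norm_num) hnn hnn'
    (le_trans (by norm_num) hn) ?_ hB hB1 hB2 hB3⟩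
  · exact mul_mul_mul_div_le (by norm_num)
  · omega

theorem logForm_eq_log (k a : ℕ) {C : ℝ} (hC : 0 < C) :
    logForm k a C = Real.log (Real.goldenRatio ^ k * C / √5 / 2 ^ a) := by
  have h0 := Real.goldenRatio_pos
  rw [Real.log_div (by positivity) (by positivity), Real.log_div (by positivity) (by positivity),
    Real.log_mul (by positivity) hC.ne', Real.log_pow, Real.log_pow, Real.log_sqrt (by norm_num),
    logForm]

theorem abs_log_div_le {T A V : ℝ} (hA : 0 < A) (hV : 16 ≤ V) (h : |T - A| ≤ 8 * A / V) :
    |Real.log (T / A)| ≤ 16 / V := by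
  have hV0 : 0 < V := by linarith
  have hx : |T / A - 1| ≤ 8 / V := by
    have : T / A - 1 = (T - A) / A := by field_simp
    rw [this, abs_div, abs_of_pos hA, div_le_iff₀ hA]
    exact h.trans_eq (by ring)
  have hV2 : 8 / V ≤ 1 / 2 := by
    rw [div_le_div_iff₀ hV0 two_pos]
    linarith
  have h16 : 16 / V = 2 * (8 / V) := by ring
  rw [h16]
  generalize 8 / V = w at *
  obtain ⟨h1, h2⟩ := abs_le.mp hx
  have hT : 0 < T / A := by linarith
  have h3 := Real.log_le_sub_one_of_pos hT
  have h4 := Real.one_sub_inv_le_log_of_pos hT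
  have h5 : -(2 * w) ≤ 1 - (T / A)⁻¹ := by
    have : (T / A)⁻¹ ≤ 1 + 2 * w := by
      rw [inv_le_comm₀ hT (by linarith)]
      refine le_trans ?_ (by linarith : 1 - w ≤ T / A)
      rw [inv_le_iff_one_le_mul₀ (by linarith)]
      nlinarith
    linarith
  rw [abs_le]
  constructor <;> linarith

theorem four_pow_le_goldenRatio_pow (u : ℕ) : (4 : ℝ) ^ u ≤ Real.goldenRatio ^ (3 * u) := by
  rw [pow_mul]
  refine pow_le_pow_left₀ (by norm_num) ?_ u
  have h := Real.goldenRatio_sq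
  have h1 := Real.one_lt_goldenRatio
  nlinarith [Real.goldenRatio_pos]

theorem two_pow_le_goldenRatio_pow {u k : ℕ} (h : 3 * u ≤ 2 * k) :
    (2 : ℝ) ^ u ≤ Real.goldenRatio ^ k := by
  have h1 : ((2 : ℝ) ^ u) ^ 2 ≤ (Real.goldenRatio ^ k) ^ 2 := by
    rw [← pow_mul, ← pow_mul, mul_comm u, pow_mul]
    norm_num
    refine (four_pow_le_goldenRatio_pow u).trans ?_
    exact pow_le_pow_right₀ Real.one_lt_goldenRatio.le (by omega)
  exact le_of_sq_le_sq h1 (pow_nonneg Real.goldenRatio_pos.le _)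

theorem sqrt_five_gt : 2.23 < √5 := Real.lt_sqrt_of_sq_lt (by norm_num)

theorem sqrt_five_lt : √5 < 2.24 := by
  rw [Real.sqrt_lt' (by norm_num)]
  norm_num

theorem abs_goldenConj_pow_le (k : ℕ) : |Real.goldenConj ^ k| ≤ 1 := by
  rw [abs_pow]
  refine pow_le_one₀ (abs_nonneg _) ?_
  rw [abs_le]
  exact ⟨Real.neg_one_lt_goldenConj.le, Real.goldenConj_neg.le.trans zero_le_one⟩

theorem abs_goldenRatio_pow_div_sub_fib_le (k : ℕ) :
    |Real.goldenRatio ^ k / √5 - Nat.fib k| ≤ 1 / 2 := by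
  have h5 := sqrt_five_gt
  have h : Real.goldenRatio ^ k / √5 - Nat.fib k = Real.goldenConj ^ k / √5 := by
    rw [Real.coe_fib_eq]
    ring
  rw [h, abs_div, abs_of_nonneg (Real.sqrt_nonneg 5), div_le_iff₀ (by linarith)]
  linarith [abs_goldenConj_pow_le k]

theorem rpow_half_sq (a : ℕ) : (2 : ℝ) ^ ((a : ℝ) / 2) * (2 : ℝ) ^ ((a : ℝ) / 2) = 2 ^ a := by
  rw [← Real.rpow_add two_pos, add_halves, Real.rpow_natCast]

section

variable {n m l a : ℕ}

theorem goldenRatio_pow_le_of_abs_sub_lt (ha : 0 < a)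
    (h : |(Nat.fib n : ℝ) + Nat.fib m + Nat.fib l - 2 ^ a| < (2 : ℝ) ^ ((a : ℝ) / 2)) :
    Real.goldenRatio ^ n ≤ 5.25 * 2 ^ a := by
  have hR := rpow_half_sq a
  have hR1 : 1 ≤ (2 : ℝ) ^ ((a : ℝ) / 2) := Real.one_le_rpow one_le_two (by positivity)
  have hA : (2 : ℝ) ≤ 2 ^ a := le_self_pow₀ one_le_two ha.ne'
  have h1 := (abs_lt.mp h).2
  have h2 := (abs_le.mp (abs_goldenRatio_pow_div_sub_fib_le n)).2
  have hm : (0 : ℝ) ≤ Nat.fib m := Nat.cast_nonneg _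
  have hl : (0 : ℝ) ≤ Nat.fib l := Nat.cast_nonneg _
  have h3 : (2 : ℝ) ^ ((a : ℝ) / 2) ≤ 2 ^ a := by nlinarith
  have h5 := sqrt_five_gt
  have h4 : Real.goldenRatio ^ n / √5 ≤ 2 * 2 ^ a + 1 / 2 := by linarith
  rw [div_le_iff₀ (by linarith)] at h4
  nlinarith [sqrt_five_lt]

theorem abs_sum_div_sub_le {u : ℕ} (ha : 0 < a) (hu : 3 * u + 4 ≤ n)
    (h : |(Nat.fib n : ℝ) + Nat.fib m + Nat.fib l - 2 ^ a| < (2 : ℝ) ^ ((a : ℝ) / 2)) :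
    |(Real.goldenRatio ^ n + Real.goldenRatio ^ m + Real.goldenRatio ^ l) / √5 - 2 ^ a|
      ≤ 3 * 2 ^ a / 2 ^ u := by
  have hR := rpow_half_sq a
  have hR1 : 1 ≤ (2 : ℝ) ^ ((a : ℝ) / 2) := Real.one_le_rpow one_le_two (by positivity)
  have hn := goldenRatio_pow_le_of_abs_sub_lt ha h
  have hV : (2 : ℝ) ^ u * 2 ^ u ≤ 2 ^ a := by
    have h1 : (2 : ℝ) ^ u * 2 ^ u = 4 ^ u := by rw [← mul_pow]; norm_num
    have h2 : Real.goldenRatio ^ (3 * u) * Real.goldenRatio ^ 4 ≤ Real.goldenRatio ^ n := by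
      rw [← pow_add]
      exact pow_le_pow_right₀ Real.one_lt_goldenRatio.le hu
    have h3 := four_pow_le_goldenRatio_pow u
    have h4 : 5.25 ≤ Real.goldenRatio ^ 4 := by
      have h := Real.goldenRatio_sq
      have : Real.goldenRatio ^ 4 = 3 * Real.goldenRatio + 2 := by
        linear_combination (Real.goldenRatio ^ 2 + Real.goldenRatio + 2) * h
      nlinarith [Real.one_lt_goldenRatio]
    have h5 := mul_le_mul h3 h4 (by norm_num) (by positivity)
    rw [h1]
    linarith
  have hVR : (2 : ℝ) ^ u ≤ (2 : ℝ) ^ ((a : ℝ) / 2) := by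
    by_contra! hlt
    nlinarith
  have hn' := abs_goldenRatio_pow_div_sub_fib_le n
  have hm' := abs_goldenRatio_pow_div_sub_fib_le m
  have hl' := abs_goldenRatio_pow_div_sub_fib_le l
  rw [abs_lt] at h
  rw [abs_le] at hn' hm' hl'
  have hfin : 3 * (2 : ℝ) ^ ((a : ℝ) / 2) ≤ 3 * 2 ^ a / 2 ^ u := by
    rw [le_div_iff₀ (by positivity), ← hR]
    nlinarith
  refine le_trans ?_ hfin
  rw [add_div, add_div, abs_le]
  constructor <;> linarith

theorem goldenRatio_pow_div_le {u k : ℕ} (ha : 0 < a)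
    (h : |(Nat.fib n : ℝ) + Nat.fib m + Nat.fib l - 2 ^ a| < (2 : ℝ) ^ ((a : ℝ) / 2))
    (hk : k ≤ n) (hu : 3 * u ≤ 2 * (n - k)) :
    Real.goldenRatio ^ k / √5 ≤ 2.4 * 2 ^ a / 2 ^ u := by
  have h1 := two_pow_le_goldenRatio_pow hu
  have h2 := goldenRatio_pow_le_of_abs_sub_lt ha h
  have h3 : Real.goldenRatio ^ k * Real.goldenRatio ^ (n - k) = Real.goldenRatio ^ n := by
    rw [← pow_add, Nat.add_sub_cancel' hk]
  have h5 := sqrt_five_gt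
  have h4 := mul_le_mul_of_nonneg_left h1 (pow_nonneg Real.goldenRatio_pos.le k)
  rw [div_le_div_iff₀ (by linarith) (by positivity)]
  have hA : (0 : ℝ) < 2 ^ a := by positivity
  nlinarith

theorem abs_logForm_le_of_abs_sub_lt {u : ℕ} (ha : 0 < a) (hml : l ≤ m) (hnm : m ≤ n)
    (hu : 3 * u + 4 ≤ n) (hu4 : 4 ≤ u)
    (h : |(Nat.fib n : ℝ) + Nat.fib m + Nat.fib l - 2 ^ a| < (2 : ℝ) ^ ((a : ℝ) / 2)) :
    |logForm l a (Real.goldenRatio ^ (n - l) + Real.goldenRatio ^ (m - l) + 1)| ≤ 16 / 2 ^ u := by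
  have h0 := Real.goldenRatio_pos
  have hV : (16 : ℝ) ≤ 2 ^ u := by
    calc (16 : ℝ) = 2 ^ 4 := by norm_num
      _ ≤ 2 ^ u := pow_le_pow_right₀ one_le_two hu4
  rw [logForm_eq_log _ _ (by positivity)]
  refine abs_log_div_le (by positivity) hV ?_
  have h1 : Real.goldenRatio ^ l * (Real.goldenRatio ^ (n - l) + Real.goldenRatio ^ (m - l) + 1)
      = Real.goldenRatio ^ n + Real.goldenRatio ^ m + Real.goldenRatio ^ l := by
    rw [mul_add, mul_add, ← pow_add, ← pow_add, Nat.add_sub_cancel' hml,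
      Nat.add_sub_cancel' (hml.trans hnm), mul_one]
  rw [h1]
  refine (abs_sum_div_sub_le ha hu h).trans ?_
  gcongr
  norm_num

theorem abs_logForm_two_terms_le_of_abs_sub_lt {u : ℕ} (ha : 0 < a) (hml : l ≤ m) (hnm : m ≤ n)
    (hu : 3 * u + 4 ≤ n) (hu4 : 4 ≤ u) (hul : 3 * u ≤ 2 * (n - l))
    (h : |(Nat.fib n : ℝ) + Nat.fib m + Nat.fib l - 2 ^ a| < (2 : ℝ) ^ ((a : ℝ) / 2)) :
    |logForm m a (Real.goldenRatio ^ (n - m) + 1)| ≤ 16 / 2 ^ u := by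
  have h0 := Real.goldenRatio_pos
  have hV : (16 : ℝ) ≤ 2 ^ u := by
    calc (16 : ℝ) = 2 ^ 4 := by norm_num
      _ ≤ 2 ^ u := pow_le_pow_right₀ one_le_two hu4
  rw [logForm_eq_log _ _ (by positivity)]
  refine abs_log_div_le (by positivity) hV ?_
  have h1 : Real.goldenRatio ^ m * (Real.goldenRatio ^ (n - m) + 1)
      = Real.goldenRatio ^ n + Real.goldenRatio ^ m := by
    rw [mul_add, ← pow_add, Nat.add_sub_cancel' hnm, mul_one]
  rw [h1]
  have h2 := abs_sum_div_sub_le ha hu h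
  have h3 := goldenRatio_pow_div_le ha h (hml.trans hnm) hul
  have h4 : 0 ≤ Real.goldenRatio ^ l / √5 := by positivity
  have hpos : 0 ≤ (2 : ℝ) ^ a / 2 ^ u := by positivity
  rw [mul_div_assoc] at h2 h3 ⊢
  rw [abs_le, add_div, add_div] at h2
  rw [abs_le, add_div]
  constructor <;> linarith

theorem abs_logForm_one_le_of_abs_sub_lt {u : ℕ} (ha : 0 < a) (hml : l ≤ m) (hnm : m ≤ n)
    (hu : 3 * u + 4 ≤ n) (hu4 : 4 ≤ u) (hum : 3 * u ≤ 2 * (n - m))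
    (h : |(Nat.fib n : ℝ) + Nat.fib m + Nat.fib l - 2 ^ a| < (2 : ℝ) ^ ((a : ℝ) / 2)) :
    |logForm n a 1| ≤ 16 / 2 ^ u := by
  have h0 := Real.goldenRatio_pos
  have hV : (16 : ℝ) ≤ 2 ^ u := by
    calc (16 : ℝ) = 2 ^ 4 := by norm_num
      _ ≤ 2 ^ u := pow_le_pow_right₀ one_le_two hu4
  rw [logForm_eq_log _ _ one_pos, mul_one]
  refine abs_log_div_le (by positivity) hV ?_
  have h2 := abs_sum_div_sub_le ha hu h
  have h3 := goldenRatio_pow_div_le ha h (hml.trans hnm) (hum.trans (by omega))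
  have h3' := goldenRatio_pow_div_le ha h hnm hum
  have h4 : 0 ≤ Real.goldenRatio ^ l / √5 := by positivity
  have h4' : 0 ≤ Real.goldenRatio ^ m / √5 := by positivity
  have hpos : 0 ≤ (2 : ℝ) ^ a / 2 ^ u := by positivity
  rw [mul_div_assoc] at h2 h3 h3' ⊢
  rw [abs_le, add_div, add_div] at h2
  rw [abs_le]
  constructor <;> linarith

theorem not_le_of_le_logForm {u₀ : ℕ} {x : ℝ} (h : 1 / 2 ^ u₀ ≤ |x|) :
    ¬ |x| ≤ 16 / 2 ^ (u₀ + 5) := by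
  intro h'
  have h1 : (16 : ℝ) / 2 ^ (u₀ + 5) = 1 / 2 ^ u₀ / 2 := by
    rw [pow_add]
    field_simp
    norm_num
  have h2 : (0 : ℝ) < 1 / 2 ^ u₀ := by positivity
  linarith

end

theorem goldenRatio_pow_le_two_pow (k : ℕ) : Real.goldenRatio ^ k ≤ 2 ^ k :=
  pow_le_pow_left₀ Real.goldenRatio_pos.le Real.goldenRatio_lt_two.le k

set_option exponentiation.threshold 2000 in
theorem one_div_two_pow_le_of_gap {n : ℕ} {x : ℝ} (hn : n < 10 ^ 158)
    (h : ((2 ^ 1109 : ℕ) : ℝ) ≤ fixedScale * (convergentDen * |x|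
      + n * |convergentDen * Real.log Real.goldenRatio - convergentNum * Real.log 2|)) :
    1 / 2 ^ 552 ≤ |x| := by
  have hω := abs_mul_log_sub_mul_log_le (q := convergentDen) (p := convergentNum) (x := 1)
    (y := 2 ^ 540) (by norm_num) (by decide +kernel) (by decide +kernel)
  have hB : fixedScale = 2 ^ 1109 * 2 ^ 11 := by decide +kernel
  have hq : convergentDen ≤ 2 ^ 540 := by decide +kernel
  have hS : 0 < 2 ^ 1109 := by positivity
  rw [hB] at h
  generalize 2 ^ 1109 = S at *
  have hS' : (0 : ℝ) < S := by exact_mod_cast hS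
  have hn' : (n : ℝ) ≤ 10 ^ 158 := by exact_mod_cast hn.le
  have hq' : (convergentDen : ℝ) ≤ 2 ^ 540 := by
    calc (convergentDen : ℝ) ≤ ((2 ^ 540 : ℕ) : ℝ) := Nat.cast_le.mpr hq
      _ = 2 ^ 540 := Nat.cast_pow 2 540
  have h1 := mul_le_mul hn' hω (abs_nonneg _) (by positivity)
  have h2 := mul_le_mul_of_nonneg_right hq' (abs_nonneg x)
  have h3 : (S : ℝ) * 1 ≤ S * (2048 * (convergentDen * |x|
      + n * |convergentDen * Real.log Real.goldenRatio - convergentNum * Real.log 2|)) := by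
    push_cast at h
    linarith
  have h4 := le_of_mul_le_mul_left h3 hS'
  have h5 : (10 : ℝ) ^ 158 * (((1 : ℕ) : ℝ) / ((2 ^ 540 : ℕ) : ℝ)) ≤ 1 / 4096 := by norm_num
  have h6 : 1 / 4096 ≤ (2 : ℝ) ^ 540 * |x| := by linarith
  have h7 : (1 : ℝ) / 2 ^ 552 = 1 / 4096 / 2 ^ 540 := by norm_num
  rw [h7, div_le_iff₀ (by positivity)]
  linarith

section

variable {n m l a : ℕ}

theorem sub_le_of_lt_of_abs_sub_lt (ha : 0 < a) (hml : l ≤ m) (hnm : m < n) (hn : 10 ^ 29 ≤ n)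
    (hn' : n < 10 ^ 158)
    (h : |(Nat.fib n : ℝ) + Nat.fib m + Nat.fib l - 2 ^ a| < (2 : ℝ) ^ ((a : ℝ) / 2)) :
    n - l ≤ 836 := by
  have hq : 10 ^ 158 ≤ convergentDen := by decide +kernel
  have h1 : n - m ≤ 836 := by
    by_contra! hlt
    exact not_le_of_le_logForm
      (one_div_two_pow_le_of_gap hn' (isReductionSetup.le_logForm_one n a))
      (abs_logForm_one_le_of_abs_sub_lt ha hml hnm.le (by omega) (by omega) (by omega) h)
  by_contra! hlt
  exact not_le_of_le_logForm
    (one_div_two_pow_le_of_gap hn' (isReductionSetup.le_logForm (n := n) (m := m) (k := n - m)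
      (a := a) (by omega) (hn'.trans_le hq) (by omega) (by omega) h1))
    (abs_logForm_two_terms_le_of_abs_sub_lt ha hml hnm.le (by omega) (by omega) (by omega) h)

theorem sub_mul_le_of_le_of_abs_sub_lt (ha : 0 < a) (hml : l ≤ m) (hnm : m ≤ n)
    (hn : 10 ^ 158 ≤ n)
    (h : |(Nat.fib n : ℝ) + Nat.fib m + Nat.fib l - 2 ^ a| < (2 : ℝ) ^ ((a : ℝ) / 2)) :
    (n - l + 2) * 2 ^ 45 ≤ n + 9 * 2 ^ 45 := by
  obtain ⟨u₁, hu₁, hlow₁⟩ := exists_le_logForm_one (a := a) hn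
  have hn68 : 10 ^ 68 ≤ n := le_trans (by norm_num) hn
  clear hn
  have h1 : 2 * (n - m) < 3 * (u₁ + 5) := by
    by_contra! hle
    exact not_le_of_le_logForm hlow₁
      (abs_logForm_one_le_of_abs_sub_lt ha hml hnm (by omega) (by omega) hle h)
  obtain ⟨u₂, hu₂, hlow₂⟩ := exists_le_logForm_of_le (n' := m) (a := a) (ν := n - m + 1) hn68 hnm
    (by omega) (by omega) ((IsConjPair.goldenRatio.pow (n - m)).add .one)
    (by have : 0 ≤ Real.goldenRatio ^ (n - m) := by positivity
        linarith)
    (by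
      have e1 := goldenRatio_pow_le_two_pow (n - m)
      have e2 : (1 : ℝ) ≤ 2 ^ (n - m) := one_le_pow₀ one_le_two
      rw [pow_succ]
      linarith)
    (by
      have e1 := abs_goldenConj_pow_le (n - m)
      rw [abs_le] at e1 ⊢
      constructor <;> linarith)
  have h2 : 2 * (n - l) < 3 * (u₂ + 5) := by
    by_contra! hle
    exact not_le_of_le_logForm hlow₂
      (abs_logForm_two_terms_le_of_abs_sub_lt ha hml hnm (by omega) (by omega) hle h)
  have h3 : 2 * (n - l + 2) ≤ 3 * u₂ + 18 := by
    clear hu₁ hu₂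
    omega
  have h4 := Nat.mul_le_mul_right (2 ^ 45) h3
  linarith

theorem false_of_le_of_abs_sub_lt (ha : 0 < a) (hml : l ≤ m) (hnm : m ≤ n) (hn : 10 ^ 29 ≤ n)
    (hnl : (n - l + 2) * 2 ^ 45 ≤ n + 9 * 2 ^ 45)
    (h : |(Nat.fib n : ℝ) + Nat.fib m + Nat.fib l - 2 ^ a| < (2 : ℝ) ^ ((a : ℝ) / 2)) : False := by
  have h1 := Real.one_lt_goldenRatio
  obtain ⟨u, hu, hlow⟩ := exists_le_logForm (n' := l) (a := a) hn (hml.trans hnm) (by omega) hnl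
    (((IsConjPair.goldenRatio.pow (n - l)).add (IsConjPair.goldenRatio.pow (m - l))).add .one)
    (by have : 0 ≤ Real.goldenRatio ^ (n - l) + Real.goldenRatio ^ (m - l) := by positivity
        linarith)
    (by
      have e1 := goldenRatio_pow_le_two_pow (n - l)
      have e2 := goldenRatio_pow_le_two_pow (m - l)
      have e3 : (2 : ℝ) ^ (m - l) ≤ 2 ^ (n - l) := pow_le_pow_right₀ one_le_two (by omega)
      have e4 : (1 : ℝ) ≤ 2 ^ (n - l) := one_le_pow₀ one_le_two
      rw [pow_add]
      linarith)
    (by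
      have e1 := abs_goldenConj_pow_le (n - l)
      have e2 := abs_goldenConj_pow_le (m - l)
      rw [abs_le] at e1 e2 ⊢
      constructor <;> linarith)
  exact not_le_of_le_logForm hlow
    (abs_logForm_le_of_abs_sub_lt ha hml hnm (by omega) (by omega) h)

theorem lt_of_abs_sub_lt (ha : 0 < a) (hml : l ≤ m) (hnm : m < n)
    (h : |(Nat.fib n : ℝ) + Nat.fib m + Nat.fib l - 2 ^ a| < (2 : ℝ) ^ ((a : ℝ) / 2)) :
    n < 10 ^ 29 := by
  by_contra! hn
  refine false_of_le_of_abs_sub_lt ha hml hnm.le hn ?_ h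
  rcases lt_or_ge n (10 ^ 158) with hn' | hn'
  · have := sub_le_of_lt_of_abs_sub_lt ha hml hnm hn hn' h
    clear hn' h
    omega
  · exact sub_mul_le_of_le_of_abs_sub_lt ha hml hnm.le hn' h

theorem goldenRatio_pow_ten_le : Real.goldenRatio ^ 10 ≤ 2 ^ 7 := by
  have h1 : Real.goldenRatio ^ 10 = 55 * Real.goldenRatio + 34 := by
    have h2 := Real.goldenRatio_sq
    have h4 : Real.goldenRatio ^ 4 = 3 * Real.goldenRatio + 2 := by
      calc Real.goldenRatio ^ 4 = (Real.goldenRatio ^ 2) ^ 2 := by ring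
        _ = 3 * Real.goldenRatio + 2 := by rw [h2]; linear_combination h2
    calc Real.goldenRatio ^ 10 = (Real.goldenRatio ^ 4) ^ 2 * Real.goldenRatio ^ 2 := by ring
      _ = 55 * Real.goldenRatio + 34 := by
        rw [h4, h2]
        linear_combination (9 * Real.goldenRatio + 30) * h2
  rw [h1, Real.goldenRatio]
  linarith [sqrt_five_lt]

theorem ten_mul_le_of_abs_sub_lt (ha : 2 ≤ a) (hml : l ≤ m) (hnm : m ≤ n)
    (h : |(Nat.fib n : ℝ) + Nat.fib m + Nat.fib l - 2 ^ a| < (2 : ℝ) ^ ((a : ℝ) / 2)) :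
    10 * a ≤ 7 * n + 30 := by
  have h0 := Real.goldenRatio_pos
  have hR := rpow_half_sq a
  have hA : (2 : ℝ) ^ 2 ≤ 2 ^ a := pow_le_pow_right₀ one_le_two ha
  have hR0 : 0 < (2 : ℝ) ^ ((a : ℝ) / 2) := by positivity
  have hR2 : 2 ≤ (2 : ℝ) ^ ((a : ℝ) / 2) := by nlinarith
  have h1 := (abs_lt.mp h).1
  have hm : (Nat.fib m : ℝ) ≤ Nat.fib n := by exact_mod_cast Nat.fib_mono hnm
  have hl : (Nat.fib l : ℝ) ≤ Nat.fib n := by exact_mod_cast Nat.fib_mono (hml.trans hnm)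
  have h5 := sqrt_five_gt
  have h2 := (abs_le.mp (abs_goldenRatio_pow_div_sub_fib_le n)).1
  have hφ : 1 ≤ Real.goldenRatio ^ n := one_le_pow₀ Real.one_lt_goldenRatio.le
  have h3 : Real.goldenRatio ^ n / √5 ≤ Real.goldenRatio ^ n / 2 :=
    div_le_div_of_nonneg_left (by positivity) two_pos (by linarith)
  have h4 : (2 : ℝ) ^ a ≤ 2 ^ 3 * Real.goldenRatio ^ n := by nlinarith
  have h6 : (2 : ℝ) ^ (10 * a) ≤ 2 ^ (7 * n + 30) :=
    calc (2 : ℝ) ^ (10 * a) = (2 ^ a) ^ 10 := by rw [mul_comm, pow_mul]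
      _ ≤ (2 ^ 3 * Real.goldenRatio ^ n) ^ 10 := pow_le_pow_left₀ (by positivity) h4 10
      _ = 2 ^ 30 * (Real.goldenRatio ^ 10) ^ n := by
        rw [mul_pow, ← pow_mul, ← pow_mul, ← pow_mul, mul_comm n 10]
      _ ≤ 2 ^ 30 * (2 ^ 7) ^ n := by
        gcongr
        exact goldenRatio_pow_ten_le
      _ = 2 ^ (7 * n + 30) := by rw [pow_add, pow_mul]; ring
  exact (pow_le_pow_iff_right₀ one_lt_two).mp h6

end

theorem large_solution_upper_bounds
    (n m l a : ℕ) (hnm : m < n) (hml : l < m) (hl : 1 < l) (ha : 0 < a) (hn : 550 < n)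
    (h : |(Nat.fib n : ℝ) + Nat.fib m + Nat.fib l - 2 ^ a| < (2 : ℝ) ^ ((a : ℝ) / 2)) :
    (n : ℝ) < 1.87 * 10 ^ 29 ∧ (a : ℝ) < 9 * 10 ^ 28 := by
  have h1 := lt_of_abs_sub_lt ha hml.le hnm h
  have h1' : (n : ℝ) < 10 ^ 29 := by exact_mod_cast h1
  refine ⟨by linarith, ?_⟩
  rcases lt_or_ge a 2 with ha2 | ha2
  · have : (a : ℝ) < 2 := by exact_mod_cast ha2
    linarith
  · have h2 : (10 * a : ℝ) ≤ 7 * n + 30 := by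
      exact_mod_cast ten_mul_le_of_abs_sub_lt ha2 hml.le hnm.le h
    linarith
end

section
/- Let n, m, l, a be positive integers with n > m > l > 1 and a ≥ 2 satisfying |F_n + F_m + F_l - 2^a| < 2^(a/2), and suppose further that n - a > n·(1 - log α / log 2) - 1 and (n - a)·log α < 2.4 × 10^12 · log n, where α = (1+√5)/2. Then a < 3.84 × 10^14 and n < 5.53 × 10^14. -/
/-- Equal to `f n`; the kernel evaluates `n` to a numeral before it unfolds `f`. -/
noncomputable def evalThen {β : Type} (n : ℕ) (f : ℕ → β) : β :=
  Nat.rec (f 0) (fun k _ => f (Nat.succ k)) n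

/-- The integer part of `logb 2 n` for `0 < n < 2 ^ 2 ^ k`, found by bisection. -/
noncomputable def floorLog (k : ℕ) : ℕ → ℕ :=
  Nat.rec (fun _ => 0) (fun k ih n => evalThen n fun n =>
    Bool.rec (ih n) (Nat.add (Nat.pow 2 k) (ih (Nat.shiftRight n (Nat.pow 2 k))))
      (Nat.ble (Nat.pow 2 (Nat.pow 2 k)) n)) k

/-- The integer part of `logb 2 n`, with `h` as a first guess. -/
noncomputable def floorLogFrom (h n : ℕ) : ℕ :=
  Bool.rec (floorLog 14 n) (Nat.add h (floorLog 9 (Nat.shiftRight n h))) (Nat.ble (Nat.pow 2 h) n)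

/-- A lower bound for `256 ^ i * logb 2 y`, found by raising the leading `w` bits of `y` to the
power `256` repeatedly. The truncations are odd because powers of even numbers would share their
low bits and make the kernel's hash tables degenerate. -/
noncomputable def logbLower (w i : ℕ) : ℕ → ℕ :=
  Nat.rec (fun y => floorLogFrom (Nat.mul 256 w) y)
    (fun i ih y => evalThen y fun y =>
      evalThen (Nat.sub (floorLogFrom (Nat.mul 256 w) y) w) fun s =>
      Nat.add (Nat.mul (Nat.pow 256 (Nat.succ i)) s)
        (ih (Nat.pow (Nat.pred (Nat.mul 2 (Nat.shiftRight y (Nat.succ s)))) 256))) i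

/-- An upper bound for `256 ^ i * logb 2 y`; compare `logbLower`. -/
noncomputable def logbUpper (w i : ℕ) : ℕ → ℕ :=
  Nat.rec (fun y => evalThen (floorLogFrom (Nat.mul 256 w) y) fun s =>
      Nat.add s (Nat.shiftRight y s))
    (fun i ih y => evalThen y fun y =>
      evalThen (Nat.sub (floorLogFrom (Nat.mul 256 w) y) w) fun s =>
      Nat.add (Nat.mul (Nat.pow 256 (Nat.succ i)) s)
        (ih (Nat.pow (Nat.add (Nat.mul 2 (Nat.shiftRight y (Nat.succ s))) 3) 256))) i

/-- The integer part of `2 ^ 160 * φ`. -/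
def phiFloor : ℕ := 2364759323815023072858958529125875303615727544171

/-- No multiple of `2 ^ 64` is within distance `E` of the interval `[q * lo, q * hi]`. -/
noncomputable def avoidsIntegers (q E lo hi : ℕ) : Bool :=
  Nat.ble (Nat.succ (Nat.add (Nat.mul q (Nat.sub hi lo)) (Nat.mul 2 E)))
    (Nat.mod (Nat.add (Nat.mul q hi) E) (Nat.pow 2 64))

/-- A certificate that `φ ^ (n - d) * Y` is not close to any `√5 * 2 ^ a` when
`ylo ≤ 2 ^ (160 * d) * Y ≤ yhi` and `n` is within `5 * 10 ^ 11` of `5535 * 10 ^ 11`. The factors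
`8724756314707` and `7731062364157` are denominators of convergents of `logb 2 φ`. -/
noncomputable def separated (d ylo yhi : ℕ) : Bool :=
  evalThen (Nat.add (Nat.add 7088399358461794091591047025391704
      (Nat.mul (Nat.sub 128 d) 12806502905986368093)) (logbLower 72 8 ylo)) fun lo =>
  evalThen (Nat.add (Nat.add 7088399358461794091591047025391705
      (Nat.mul (Nat.sub 128 d) 12806502905986368094)) (logbUpper 72 8 yhi)) fun hi =>
  or (avoidsIntegers 8724756314707 72185405510598372 lo hi)
    (avoidsIntegers 7731062364157 993201042616368956 lo hi)

/-- Whether `P k` holds for all `k < n`. -/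
noncomputable def allBelow (n : ℕ) (P : ℕ → Bool) : Bool :=
  Nat.rec true (fun k ih => Bool.rec false ih (P k)) n

/-- `2 ^ (160 * d) * ((c / 2 ^ 160) ^ d + (c / 2 ^ 160) ^ p)`. -/
noncomputable def scaledPowers (c d p : ℕ) : ℕ :=
  Nat.mul (Nat.pow c p) (Nat.add (Nat.pow c (Nat.sub d p)) (Nat.pow 2 (Nat.mul 160 (Nat.sub d p))))

/-- `separated` for `Y = φ ^ d + φ ^ p + 1`. -/
noncomputable def pairSeparated (d p : ℕ) : Bool :=
  evalThen d fun d => evalThen p fun p => separated d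
    (Nat.add (scaledPowers phiFloor d p) (Nat.pow 2 (Nat.mul 160 d)))
    (Nat.add (scaledPowers (Nat.add phiFloor 2) d p) (Nat.pow 2 (Nat.mul 160 d)))

theorem evalThen_eq {β : Type} (n : ℕ) (f : ℕ → β) : evalThen n f = f n := by
  cases n <;> rfl

theorem floorLog_zero (n : ℕ) : floorLog 0 n = 0 := rfl

theorem floorLog_succ (k n : ℕ) : floorLog (k + 1) n =
    if 2 ^ 2 ^ k ≤ n then 2 ^ k + floorLog k (n >>> 2 ^ k) else floorLog k n := by
  have : floorLog (k + 1) n = evalThen n fun n =>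
    Bool.rec (floorLog k n) (2 ^ k + floorLog k (n >>> 2 ^ k)) (Nat.ble (2 ^ 2 ^ k) n) := rfl
  rw [this, evalThen_eq]
  split_ifs with h
  · rw [Nat.ble_eq_true_of_le h]
  · have : Nat.ble (2 ^ 2 ^ k) n = false := by
      rw [Bool.eq_false_iff]; exact fun h' => h (Nat.le_of_ble_eq_true h')
    rw [this]

theorem floorLogFrom_eq (h n : ℕ) : floorLogFrom h n =
    if 2 ^ h ≤ n then h + floorLog 9 (n >>> h) else floorLog 14 n := by
  have : floorLogFrom h n =
    Bool.rec (floorLog 14 n) (h + floorLog 9 (n >>> h)) (Nat.ble (2 ^ h) n) := rfl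
  rw [this]
  split_ifs with h1
  · rw [Nat.ble_eq_true_of_le h1]
  · have : Nat.ble (2 ^ h) n = false := by
      rw [Bool.eq_false_iff]; exact fun h' => h1 (Nat.le_of_ble_eq_true h')
    rw [this]

theorem logbLower_zero (w y : ℕ) : logbLower w 0 y = floorLogFrom (256 * w) y := rfl

theorem logbLower_succ (w i y : ℕ) : logbLower w (i + 1) y =
    256 ^ (i + 1) * (floorLogFrom (256 * w) y - w) +
      logbLower w i ((2 * (y >>> (floorLogFrom (256 * w) y - w + 1)) - 1) ^ 256) := by
  have : logbLower w (i + 1) y = evalThen y fun y =>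
      evalThen (floorLogFrom (256 * w) y - w) fun s =>
      256 ^ (i + 1) * s + logbLower w i ((2 * (y >>> (s + 1)) - 1) ^ 256) := rfl
  rw [this, evalThen_eq, evalThen_eq]

theorem logbUpper_zero (w y : ℕ) : logbUpper w 0 y =
    floorLogFrom (256 * w) y + y >>> floorLogFrom (256 * w) y := by
  have : logbUpper w 0 y = evalThen (floorLogFrom (256 * w) y) fun s => s + y >>> s := rfl
  rw [this, evalThen_eq]

theorem logbUpper_succ (w i y : ℕ) : logbUpper w (i + 1) y =
    256 ^ (i + 1) * (floorLogFrom (256 * w) y - w) +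
      logbUpper w i ((2 * (y >>> (floorLogFrom (256 * w) y - w + 1)) + 3) ^ 256) := by
  have : logbUpper w (i + 1) y = evalThen y fun y =>
      evalThen (floorLogFrom (256 * w) y - w) fun s =>
      256 ^ (i + 1) * s + logbUpper w i ((2 * (y >>> (s + 1)) + 3) ^ 256) := rfl
  rw [this, evalThen_eq, evalThen_eq]

theorem add_logb_le_logb {s t y : ℕ} (ht : 0 < t) (h : t * 2 ^ s ≤ y) :
    (s : ℝ) + Real.logb 2 t ≤ Real.logb 2 y := by
  have ht' : (0 : ℝ) < t := by exact_mod_cast ht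
  have : Real.logb 2 (t * 2 ^ s : ℝ) ≤ Real.logb 2 y :=
    Real.logb_le_logb_of_le (by norm_num) (by positivity) (by exact_mod_cast h)
  rw [Real.logb_mul ht'.ne' (by positivity), Real.logb_pow, Real.logb_self_eq_one (by norm_num)]
    at this
  linarith

theorem logb_le_add_logb {s t y : ℕ} (ht : 0 < t) (h : y ≤ t * 2 ^ s) :
    Real.logb 2 y ≤ s + Real.logb 2 t := by
  have ht' : (1 : ℝ) ≤ t := by exact_mod_cast ht
  rcases Nat.eq_zero_or_pos y with rfl | hy
  · simpa using add_nonneg (Nat.cast_nonneg s) (Real.logb_nonneg (by norm_num : (1 : ℝ) < 2) ht')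
  have : Real.logb 2 y ≤ Real.logb 2 (t * 2 ^ s : ℝ) :=
    Real.logb_le_logb_of_le (by norm_num) (by exact_mod_cast hy) (by exact_mod_cast h)
  rw [Real.logb_mul (by positivity) (by positivity), Real.logb_pow,
    Real.logb_self_eq_one (by norm_num)] at this
  linarith

theorem add_logb_shiftRight_le {s n : ℕ} (h : 2 ^ s ≤ n) :
    (s : ℝ) + Real.logb 2 (n >>> s : ℕ) ≤ Real.logb 2 n := by
  apply add_logb_le_logb
  · rw [Nat.shiftRight_eq_div_pow]; exact Nat.div_pos h (by positivity)
  · rw [Nat.shiftRight_eq_div_pow]; exact Nat.div_mul_le_self _ _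

theorem floorLog_le_logb (k n : ℕ) : (floorLog k n : ℝ) ≤ Real.logb 2 n := by
  induction k generalizing n with
  | zero =>
    rw [floorLog_zero]
    rcases Nat.eq_zero_or_pos n with rfl | hn
    · simp
    · exact_mod_cast Real.logb_nonneg (by norm_num : (1 : ℝ) < 2) (by exact_mod_cast hn)
  | succ k ih =>
    rw [floorLog_succ]
    split_ifs with h
    · have h1 := add_logb_shiftRight_le h
      have h2 := ih (n >>> 2 ^ k)
      push_cast at h1 ⊢
      linarith
    · exact ih n

theorem floorLogFrom_le_logb (h n : ℕ) : (floorLogFrom h n : ℝ) ≤ Real.logb 2 n := by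
  rw [floorLogFrom_eq]
  split_ifs with h1
  · have h2 := add_logb_shiftRight_le h1
    have h3 := floorLog_le_logb 9 (n >>> h)
    push_cast at h2 ⊢
    linarith
  · exact floorLog_le_logb 14 n

theorem logbLower_le (w i y : ℕ) : (logbLower w i y : ℝ) ≤ 256 ^ i * Real.logb 2 y := by
  induction i generalizing y with
  | zero => simpa [logbLower_zero] using floorLogFrom_le_logb (256 * w) y
  | succ i ih =>
    rw [logbLower_succ]
    set s := floorLogFrom (256 * w) y - w with hs
    set t := 2 * (y >>> (s + 1)) - 1 with ht
    have key : (s : ℝ) + Real.logb 2 t ≤ Real.logb 2 y := by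
      rcases Nat.eq_zero_or_pos t with h0 | h0
      · have h1 : (s : ℝ) ≤ floorLogFrom (256 * w) y := by exact_mod_cast Nat.sub_le _ _
        have h2 := floorLogFrom_le_logb (256 * w) y
        rw [h0]
        simp only [Nat.cast_zero, Real.logb_zero]
        linarith
      · apply add_logb_le_logb h0
        have h1 := Nat.div_mul_le_self y (2 ^ (s + 1))
        rw [← Nat.shiftRight_eq_div_pow] at h1
        calc t * 2 ^ s ≤ (2 * (y >>> (s + 1))) * 2 ^ s := by gcongr; omega
          _ = y >>> (s + 1) * 2 ^ (s + 1) := by ring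
          _ ≤ y := h1
    have h := ih (t ^ 256)
    push_cast [Real.logb_pow] at h ⊢
    have := mul_le_mul_of_nonneg_left key (by positivity : (0 : ℝ) ≤ 256 ^ (i + 1))
    rw [pow_succ] at this ⊢
    linarith

theorem le_logbUpper (w i y : ℕ) : 256 ^ i * Real.logb 2 y ≤ (logbUpper w i y : ℝ) := by
  induction i generalizing y with
  | zero =>
    rw [logbUpper_zero]
    set s := floorLogFrom (256 * w) y
    have h1 : y ≤ (y >>> s + 1) * 2 ^ s := by
      rw [Nat.shiftRight_eq_div_pow]
      have h : y < y / 2 ^ s * 2 ^ s + 2 ^ s := Nat.lt_div_mul_add (by positivity)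
      exact h.le.trans_eq (by ring)
    have h2 := logb_le_add_logb (Nat.succ_pos _) h1
    have h3 : Real.logb 2 (y >>> s + 1 : ℕ) ≤ (y >>> s : ℕ) := by
      rw [Real.logb_le_iff_le_rpow (by norm_num) (by positivity), Real.rpow_natCast]
      exact_mod_cast Nat.lt_two_pow_self
    push_cast at h2 h3 ⊢
    linarith
  | succ i ih =>
    rw [logbUpper_succ]
    set s := floorLogFrom (256 * w) y - w with hs
    set t := 2 * (y >>> (s + 1)) + 3 with ht
    have key : Real.logb 2 y ≤ s + Real.logb 2 t := by
      apply logb_le_add_logb (by omega)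
      have h1 : y < y / 2 ^ (s + 1) * 2 ^ (s + 1) + 2 ^ (s + 1) :=
        Nat.lt_div_mul_add (by positivity)
      rw [← Nat.shiftRight_eq_div_pow] at h1
      calc y ≤ (2 * (y >>> (s + 1)) + 2) * 2 ^ s := h1.le.trans_eq (by ring)
        _ ≤ t * 2 ^ s := by gcongr; omega
    have h := ih (t ^ 256)
    push_cast [Real.logb_pow] at h ⊢
    have := mul_le_mul_of_nonneg_left key (by positivity : (0 : ℝ) ≤ 256 ^ (i + 1))
    rw [pow_succ] at this ⊢
    linarith

theorem allBelow_spec {n : ℕ} {P : ℕ → Bool} (h : allBelow n P = true) {k : ℕ} (hk : k < n) :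
    P k = true := by
  induction n with
  | zero => omega
  | succ n ih =>
    change (Bool.rec false (allBelow n P) (P n) : Bool) = true at h
    rcases hP : P n with _ | _
    · rw [hP] at h; exact absurd h (by simp)
    · rw [hP] at h
      rcases Nat.lt_succ_iff_lt_or_eq.mp hk with h1 | rfl
      · exact ih h h1
      · exact hP

theorem avoidsIntegers_spec {q E lo hi : ℕ} (h : avoidsIntegers q E lo hi = true) {x : ℝ}
    (hlo : lo ≤ x) (hhi : x ≤ hi) (N : ℤ) : (E : ℝ) < |q * x - N * 2 ^ 64| := by
  have h' : q * (hi - lo) + 2 * E < (q * hi + E) % 2 ^ 64 := Nat.le_of_ble_eq_true h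
  by_contra! hc
  rw [abs_le] at hc
  have hq : (0 : ℝ) ≤ q := Nat.cast_nonneg q
  have h1 := mul_le_mul_of_nonneg_left hlo hq
  have h2 := mul_le_mul_of_nonneg_left hhi hq
  have hle : lo ≤ hi := by exact_mod_cast hlo.trans hhi
  have h3 : N * 2 ^ 64 ≤ ((q * hi + E : ℕ) : ℤ) := by
    have : (N : ℝ) * 2 ^ 64 ≤ q * hi + E := by linarith
    exact_mod_cast this
  have h4 : ((q * lo : ℕ) : ℤ) ≤ N * 2 ^ 64 + E := by
    have : (q : ℝ) * lo ≤ N * 2 ^ 64 + E := by linarith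
    exact_mod_cast this
  have h5 : q * hi = q * lo + q * (hi - lo) := by rw [← mul_add]; congr 1; omega
  omega

theorem phiFloor_le : (phiFloor : ℝ) ≤ Real.goldenRatio * 2 ^ 160 := by
  have : (2 * phiFloor - 2 ^ 160 : ℝ) / 2 ^ 160 ≤ √5 := by
    apply Real.le_sqrt_of_sq_le
    norm_num [phiFloor]
  rw [Real.goldenRatio]
  rw [div_le_iff₀ (by positivity)] at this
  linarith

theorem goldenRatio_mul_le : Real.goldenRatio * 2 ^ 160 ≤ phiFloor + 2 := by
  have : √5 ≤ (2 * phiFloor + 4 - 2 ^ 160 : ℝ) / 2 ^ 160 := by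
    rw [Real.sqrt_le_left (by norm_num [phiFloor])]
    norm_num [phiFloor]
  rw [Real.goldenRatio]
  rw [le_div_iff₀ (by positivity)] at this
  linarith

theorem le_logbLower_phiFloor : 15482112022016700362723491040055854715379922 + 160 * 2 ^ 144 ≤
    logbLower 150 18 phiFloor := by decide +kernel

theorem logbUpper_phiFloor_le : logbUpper 150 18 (phiFloor + 2) ≤
    15482112022016700362723491040055854715379930 + 160 * 2 ^ 144 := by decide +kernel

theorem le_logbLower_five : 51780726813392703010284209102350459700733357 + 160 * 2 ^ 144 ≤
    logbLower 150 18 (5 * 2 ^ 160) := by decide +kernel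

theorem logbUpper_five_le : logbUpper 150 18 (5 * 2 ^ 160) ≤
    51780726813392703010284209102350459700733365 + 160 * 2 ^ 144 := by decide +kernel

attribute [irreducible] logbLower logbUpper

theorem logb_goldenRatio_bounds :
    (15482112022016700362723491040055854715379922 : ℝ) ≤ 2 ^ 144 * Real.logb 2 Real.goldenRatio ∧
    2 ^ 144 * Real.logb 2 Real.goldenRatio ≤
      (15482112022016700362723491040055854715379930 : ℝ) := by
  have hl' : ((15482112022016700362723491040055854715379922 + 160 * 2 ^ 144 : ℕ) : ℝ) ≤
    logbLower 150 18 phiFloor := by exact_mod_cast le_logbLower_phiFloor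
  have hu' : (logbUpper 150 18 (phiFloor + 2) : ℝ) ≤
    (15482112022016700362723491040055854715379930 + 160 * 2 ^ 144 : ℕ) := by
    exact_mod_cast logbUpper_phiFloor_le
  have h1 := logbLower_le 150 18 phiFloor
  have h2 := le_logbUpper 150 18 (phiFloor + 2)
  have hs : Real.logb 2 (Real.goldenRatio * 2 ^ 160) = Real.logb 2 Real.goldenRatio + 160 := by
    rw [Real.logb_mul Real.goldenRatio_ne_zero (by positivity), Real.logb_pow,
      Real.logb_self_eq_one (by norm_num)]
    norm_num
  have h3 : Real.logb 2 phiFloor ≤ Real.logb 2 (Real.goldenRatio * 2 ^ 160) :=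
    Real.logb_le_logb_of_le (by norm_num) (by norm_num [phiFloor]) phiFloor_le
  have h4 : Real.logb 2 (Real.goldenRatio * 2 ^ 160) ≤ Real.logb 2 (phiFloor + 2 : ℕ) :=
    Real.logb_le_logb_of_le (by norm_num) (mul_pos Real.goldenRatio_pos (by positivity))
      (by exact_mod_cast goldenRatio_mul_le)
  rw [hs] at h3 h4
  push_cast at hl' hu' h1 h2 h4
  constructor <;> linarith

theorem logb_five_bounds :
    (51780726813392703010284209102350459700733357 : ℝ) ≤ 2 ^ 144 * Real.logb 2 5 ∧
    2 ^ 144 * Real.logb 2 5 ≤ (51780726813392703010284209102350459700733365 : ℝ) := by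
  have hl' : ((51780726813392703010284209102350459700733357 + 160 * 2 ^ 144 : ℕ) : ℝ) ≤
    logbLower 150 18 (5 * 2 ^ 160) := by exact_mod_cast le_logbLower_five
  have hu' : (logbUpper 150 18 (5 * 2 ^ 160) : ℝ) ≤
    (51780726813392703010284209102350459700733365 + 160 * 2 ^ 144 : ℕ) := by
    exact_mod_cast logbUpper_five_le
  have h1 := logbLower_le 150 18 (5 * 2 ^ 160)
  have h2 := le_logbUpper 150 18 (5 * 2 ^ 160)
  have hs : Real.logb 2 ((5 * 2 ^ 160 : ℕ) : ℝ) = Real.logb 2 5 + 160 := by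
    rw [Nat.cast_mul, Nat.cast_pow, Nat.cast_ofNat, Nat.cast_ofNat,
      Real.logb_mul (by norm_num) (by positivity), Real.logb_pow,
      Real.logb_self_eq_one (by norm_num)]
    norm_num
  rw [hs] at h1 h2
  generalize logbLower 150 18 (5 * 2 ^ 160) = l at hl' h1
  generalize logbUpper 150 18 (5 * 2 ^ 160) = u at hu' h2
  push_cast at hl' hu'
  constructor <;> linarith

theorem separated_eq (d ylo yhi : ℕ) : separated d ylo yhi =
    (avoidsIntegers 8724756314707 72185405510598372
        (7088399358461794091591047025391704 + (128 - d) * 12806502905986368093 + logbLower 72 8 ylo)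
        (7088399358461794091591047025391705 + (128 - d) * 12806502905986368094 +
          logbUpper 72 8 yhi) ||
      avoidsIntegers 7731062364157 993201042616368956
        (7088399358461794091591047025391704 + (128 - d) * 12806502905986368093 + logbLower 72 8 ylo)
        (7088399358461794091591047025391705 + (128 - d) * 12806502905986368094 +
          logbUpper 72 8 yhi)) := by
  rw [separated, evalThen_eq, evalThen_eq]
  rfl

/-- If `q * θ` is close to the integer `r`, then `n * θ + c` can only be very close to an integer,
for `n` near `n₀`, if `q * (n₀ * θ + c)` is close to one. -/
theorem not_near_integer {q E lo hi : ℕ} (h : avoidsIntegers q E lo hi = true) {r θ c : ℝ}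
    {n₀ n a R K : ℤ} (hr : r = R) (hn : |(n : ℝ) - n₀| ≤ 5 * 10 ^ 11)
    (hE : 5 * 10 ^ 11 * |q * θ - r| * 2 ^ 64 + q ≤ E)
    (hlo : lo ≤ 2 ^ 64 * (n₀ * θ + c + K)) (hhi : 2 ^ 64 * (n₀ * θ + c + K) ≤ hi) :
    1 / 2 ^ 64 < |n * θ + c - a| := by
  have h1 := avoidsIntegers_spec h hlo hhi (q * K + q * a - R * (n - n₀))
  by_contra! hc
  have hq : (0 : ℝ) ≤ q := Nat.cast_nonneg q
  have h2 : (q : ℝ) * (2 ^ 64 * (n₀ * θ + c + K)) -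
      ((q * K + q * a - R * (n - n₀) : ℤ) : ℝ) * 2 ^ 64
      = 2 ^ 64 * (q * (n * θ + c - a)) - 2 ^ 64 * ((n - n₀) * (q * θ - r)) := by
    push_cast [hr]; ring
  rw [h2, ← mul_sub, abs_mul, abs_of_nonneg (by positivity : (0 : ℝ) ≤ 2 ^ 64)] at h1
  have h3 : |q * (n * θ + c - a)| ≤ q * (1 / 2 ^ 64) := by
    rw [abs_mul, abs_of_nonneg hq]; gcongr
  have h4 : |((n : ℝ) - n₀) * (q * θ - r)| ≤ 5 * 10 ^ 11 * |q * θ - r| := by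
    rw [abs_mul]; gcongr
  have h5 := abs_sub (q * (n * θ + c - a)) (((n : ℝ) - n₀) * (q * θ - r))
  linarith

theorem separated_spec {d ylo yhi : ℕ} (h : separated d ylo yhi = true) (hd : d ≤ 128)
    (hylo : 0 < ylo) {Y : ℝ} (hlo : ylo ≤ Y * 2 ^ (160 * d)) (hhi : Y * 2 ^ (160 * d) ≤ yhi)
    {n a : ℕ} (hn : |(n : ℝ) - 553500000000000| ≤ 5 * 10 ^ 11) :
    1 / 2 ^ 64 < |((n : ℝ) - d) * Real.logb 2 Real.goldenRatio + Real.logb 2 Y -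
      Real.logb 2 5 / 2 - a| := by
  have hY : 0 < Y * 2 ^ (160 * d) := lt_of_lt_of_le (by exact_mod_cast hylo) hlo
  have hY0 : 0 < Y := pos_of_mul_pos_left hY (by positivity)
  have hs : Real.logb 2 (Y * 2 ^ (160 * d)) = Real.logb 2 Y + 160 * d := by
    rw [Real.logb_mul hY0.ne' (by positivity), Real.logb_pow, Real.logb_self_eq_one (by norm_num)]
    push_cast; ring
  have h1 := (logbLower_le 72 8 ylo).trans (mul_le_mul_of_nonneg_left
    (Real.logb_le_logb_of_le (by norm_num : (1 : ℝ) < 2) (by exact_mod_cast hylo) hlo)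
    (by positivity))
  have h2 := (mul_le_mul_of_nonneg_left (Real.logb_le_logb_of_le (by norm_num : (1 : ℝ) < 2) hY hhi)
    (by positivity)).trans (le_logbUpper 72 8 yhi)
  rw [hs] at h1 h2
  obtain ⟨hθ1, hθ2⟩ := logb_goldenRatio_bounds
  obtain ⟨hf1, hf2⟩ := logb_five_bounds
  have hD : (0 : ℝ) ≤ 128 - d := by
    have : (d : ℝ) ≤ 128 := by exact_mod_cast hd
    linarith
  set θ := Real.logb 2 Real.goldenRatio
  set f := Real.logb 2 5
  have hdlo := mul_le_mul_of_nonneg_left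
    (by linarith : (12806502905986368093 : ℝ) ≤ 2 ^ 64 * θ) hD
  have hdhi := mul_le_mul_of_nonneg_left
    (by linarith : 2 ^ 64 * θ ≤ (12806502905986368094 : ℝ)) hD
  have hlo' : ((7088399358461794091591047025391704 + (128 - d) * 12806502905986368093 +
      logbLower 72 8 ylo : ℕ) : ℝ) ≤ 2 ^ 64 * (((553500000000000 : ℤ) : ℝ) * θ +
        (Real.logb 2 Y - d * θ - f / 2) + ((160 * d : ℤ) : ℝ)) := by
    push_cast [Nat.cast_sub hd]
    linarith
  have hhi' : 2 ^ 64 * (((553500000000000 : ℤ) : ℝ) * θ +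
        (Real.logb 2 Y - d * θ - f / 2) + ((160 * d : ℤ) : ℝ)) ≤
      ((7088399358461794091591047025391705 + (128 - d) * 12806502905986368094 +
      logbUpper 72 8 yhi : ℕ) : ℝ) := by
    push_cast [Nat.cast_sub hd]
    linarith
  have hn' : |((n : ℤ) : ℝ) - ((553500000000000 : ℤ) : ℝ)| ≤ 5 * 10 ^ 11 := by
    push_cast; exact hn
  have hgoal : ((n : ℝ) - d) * θ + Real.logb 2 Y - f / 2 - a =
      ((n : ℤ) : ℝ) * θ + (Real.logb 2 Y - d * θ - f / 2) - ((a : ℤ) : ℝ) := by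
    push_cast; ring
  rw [hgoal]
  rw [separated_eq, Bool.or_eq_true] at h
  rcases h with h | h
  · refine not_near_integer h (r := 6057091519883) (R := 6057091519883) (by norm_num) hn' ?_
      hlo' hhi'
    have : |(8724756314707 : ℕ) * θ - 6057091519883| ≤
        72176680754283665 / (2 ^ 64 * (5 * 10 ^ 11)) := by
      rw [abs_le]; push_cast; constructor <;> linarith
    push_cast at this ⊢
    rw [le_div_iff₀ (by positivity)] at this
    linarith
  · refine not_near_integer h (r := 5367227530090) (R := 5367227530090) (by norm_num) hn' ?_
      hlo' hhi'
    have : |(7731062364157 : ℕ) * θ - 5367227530090| ≤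
        993193311554004799 / (2 ^ 64 * (5 * 10 ^ 11)) := by
      rw [abs_le]; push_cast; constructor <;> linarith
    push_cast at this ⊢
    rw [le_div_iff₀ (by positivity)] at this
    linarith

theorem separated_one_term :
    separated 65 (Nat.pow phiFloor 65)
      (Nat.add (Nat.pow (Nat.add phiFloor 2) 65) (Nat.pow 2 (Nat.mul 160 65))) = true := by
  decide +kernel

theorem separated_two_terms : allBelow 65 (fun p => evalThen (Nat.succ p) fun p =>
    separated 66 (scaledPowers phiFloor 66 p)
      (Nat.add (scaledPowers (Nat.add phiFloor 2) 66 p) (Nat.pow 2 (Nat.mul 160 66)))) = true := by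
  decide +kernel

theorem separated_three_terms :
    allBelow 65 (fun d => allBelow d fun p => pairSeparated (Nat.succ d) (Nat.succ p)) = true := by
  decide +kernel

theorem scaledPowers_eq (c : ℕ) {d p : ℕ} (h : p ≤ d) :
    scaledPowers c d p = c ^ d + c ^ p * 2 ^ (160 * (d - p)) := by
  have : scaledPowers c d p = c ^ p * (c ^ (d - p) + 2 ^ (160 * (d - p))) := rfl
  rw [this, mul_add, ← pow_add, Nat.add_sub_cancel' h]

theorem pairSeparated_eq (d p : ℕ) : pairSeparated d p = separated d
    (scaledPowers phiFloor d p + 2 ^ (160 * d))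
    (scaledPowers (phiFloor + 2) d p + 2 ^ (160 * d)) := by
  rw [pairSeparated, evalThen_eq, evalThen_eq]
  rfl

theorem phiFloor_pow_le (d : ℕ) : (phiFloor : ℝ) ^ d ≤ Real.goldenRatio ^ d * 2 ^ (160 * d) := by
  rw [pow_mul, ← mul_pow]
  exact pow_le_pow_left₀ (Nat.cast_nonneg _) phiFloor_le d

theorem goldenRatio_pow_mul_le (d : ℕ) :
    Real.goldenRatio ^ d * 2 ^ (160 * d) ≤ ((phiFloor + 2 : ℕ) : ℝ) ^ d := by
  rw [pow_mul, ← mul_pow]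
  push_cast
  exact pow_le_pow_left₀ (mul_nonneg Real.goldenRatio_pos.le (by positivity)) goldenRatio_mul_le d

theorem scaledPowers_le {d p : ℕ} (h : p ≤ d) : (scaledPowers phiFloor d p : ℝ) ≤
    (Real.goldenRatio ^ d + Real.goldenRatio ^ p) * 2 ^ (160 * d) := by
  have h1 := mul_le_mul_of_nonneg_right (phiFloor_pow_le p)
    (by positivity : (0 : ℝ) ≤ 2 ^ (160 * (d - p)))
  rw [mul_assoc, ← pow_add, ← mul_add, Nat.add_sub_cancel' h] at h1
  rw [scaledPowers_eq _ h, add_mul]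
  push_cast
  exact add_le_add (phiFloor_pow_le d) h1

theorem le_scaledPowers {d p : ℕ} (h : p ≤ d) :
    (Real.goldenRatio ^ d + Real.goldenRatio ^ p) * 2 ^ (160 * d) ≤
      (scaledPowers (phiFloor + 2) d p : ℝ) := by
  have h1 := mul_le_mul_of_nonneg_right (goldenRatio_pow_mul_le p)
    (by positivity : (0 : ℝ) ≤ 2 ^ (160 * (d - p)))
  rw [mul_assoc, ← pow_add, ← mul_add, Nat.add_sub_cancel' h] at h1
  rw [scaledPowers_eq _ h, add_mul]
  push_cast at h1 ⊢
  have h2 := goldenRatio_pow_mul_le d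
  push_cast at h2
  exact add_le_add h2 h1

attribute [irreducible] separated

theorem separated_spec_mul {d ylo yhi : ℕ} (h : separated d ylo yhi = true) (hd : d ≤ 128)
    (hylo : 0 < ylo) {Y Z : ℝ} (hlo : ylo ≤ Y * 2 ^ (160 * d)) (hhi : Y * 2 ^ (160 * d) ≤ yhi)
    {n : ℕ} (hn : |(n : ℝ) - 553500000000000| ≤ 5 * 10 ^ 11) (hdn : d ≤ n)
    (hZ : Z = Real.goldenRatio ^ (n - d) * Y) (a : ℕ) :
    1 / 2 ^ 64 < |Real.logb 2 Z - Real.logb 2 5 / 2 - a| := by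
  have hY : 0 < Y := pos_of_mul_pos_left (lt_of_lt_of_le (by exact_mod_cast hylo) hlo)
    (by positivity)
  rw [hZ, Real.logb_mul (pow_ne_zero _ Real.goldenRatio_ne_zero) hY.ne', Real.logb_pow,
    Nat.cast_sub hdn]
  exact separated_spec h hd hylo hlo hhi hn

theorem goldenRatio_pow_add_pow_le {m l k : ℕ} (h1 : l < m) (h2 : m < k) :
    Real.goldenRatio ^ m + Real.goldenRatio ^ l ≤ Real.goldenRatio ^ k := by
  obtain ⟨j, rfl⟩ : ∃ j, m = j + 1 := ⟨m - 1, by omega⟩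
  calc Real.goldenRatio ^ (j + 1) + Real.goldenRatio ^ l
      ≤ Real.goldenRatio ^ (j + 1) + Real.goldenRatio ^ j := by
        gcongr
        · exact Real.one_lt_goldenRatio.le
        · omega
    _ = Real.goldenRatio ^ (j + 2) := by
        rw [pow_add _ j 2, Real.goldenRatio_sq]; ring
    _ ≤ Real.goldenRatio ^ k := pow_le_pow_right₀ Real.one_lt_goldenRatio.le (by omega)

/-- For `n` in a short window, sums of three powers of `φ` are not close to any `√5 * 2 ^ a`. -/
theorem logb_sum_pow_not_near {n m l : ℕ} (hnm : m < n) (hml : l < m)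
    (hn : |(n : ℝ) - 553500000000000| ≤ 5 * 10 ^ 11) (a : ℕ) :
    1 / 2 ^ 64 < |Real.logb 2 (Real.goldenRatio ^ n + Real.goldenRatio ^ m + Real.goldenRatio ^ l) -
      Real.logb 2 5 / 2 - a| := by
  have hn66 : 66 ≤ n := by
    have := (abs_le.mp hn).1
    have : (66 : ℝ) ≤ n := by linarith
    exact_mod_cast this
  have hφ : ∀ k : ℕ, 0 < Real.goldenRatio ^ k := fun k => pow_pos Real.goldenRatio_pos k
  have hc : 0 < phiFloor := by norm_num [phiFloor]
  by_cases hl : n - l ≤ 65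
  · obtain ⟨d, hd⟩ : ∃ d, n = l + (d + 1) := ⟨n - l - 1, by omega⟩
    obtain ⟨p, hp⟩ : ∃ p, m = l + (p + 1) := ⟨m - l - 1, by omega⟩
    have h := allBelow_spec (allBelow_spec separated_three_terms (by omega : d < 65))
      (by omega : p < d)
    rw [pairSeparated_eq] at h
    have h1 := scaledPowers_le (by omega : p.succ ≤ d.succ)
    have h2 := le_scaledPowers (by omega : p.succ ≤ d.succ)
    refine separated_spec_mul h (by omega) (by positivity)
      (Y := Real.goldenRatio ^ (d + 1) + Real.goldenRatio ^ (p + 1) + 1) ?_ ?_ hn (by omega) ?_ a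
    · push_cast
      rw [add_mul _ (1 : ℝ), one_mul]
      exact add_le_add_left h1 _
    · push_cast
      rw [add_mul _ (1 : ℝ), one_mul]
      exact add_le_add_left h2 _
    · rw [show n - d.succ = l by omega, hd, hp]
      ring
  by_cases hm : n - m ≤ 65
  · obtain ⟨p, hp⟩ : ∃ p, m = n - 66 + (p + 1) := ⟨m - (n - 66) - 1, by omega⟩
    have h := allBelow_spec separated_two_terms (by omega : p < 65)
    rw [evalThen_eq] at h
    have h1 := scaledPowers_le (by omega : p.succ ≤ 66)
    have h2 := le_scaledPowers (by omega : p.succ ≤ 66)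
    have hu : Real.goldenRatio ^ l ≤ Real.goldenRatio ^ (n - 66) :=
      pow_le_pow_right₀ Real.one_lt_goldenRatio.le (by omega)
    have hu1 := (div_le_one (hφ (n - 66))).mpr hu
    have hu0 := div_pos (hφ l) (hφ (n - 66))
    refine separated_spec_mul h (by omega) (by rw [scaledPowers_eq _ (by omega)]; positivity)
      (Y := Real.goldenRatio ^ 66 + Real.goldenRatio ^ (p + 1) +
        Real.goldenRatio ^ l / Real.goldenRatio ^ (n - 66)) ?_ ?_ hn hn66 ?_ a
    · exact h1.trans (mul_le_mul_of_nonneg_right (le_add_of_nonneg_right hu0.le) (by positivity))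
    · rw [add_mul _ (_ / _), Nat.add_eq, Nat.add_eq, Nat.pow_eq, Nat.mul_eq, Nat.cast_add,
        Nat.cast_pow, Nat.cast_ofNat]
      exact add_le_add h2 (mul_le_of_le_one_left (pow_pos two_pos _).le hu1)
    · rw [mul_add, mul_div_cancel₀ _ (hφ _).ne', mul_add, ← pow_add, ← pow_add, ← hp,
        Nat.sub_add_cancel hn66]
  · have hu := goldenRatio_pow_add_pow_le hml (by omega : m < n - 65)
    have hu1 := (div_le_one (hφ (n - 65))).mpr hu
    have hu0 := div_pos (add_pos (hφ m) (hφ l)) (hφ (n - 65))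
    refine separated_spec_mul separated_one_term (by omega) (pow_pos hc 65)
      (Y := Real.goldenRatio ^ 65 + (Real.goldenRatio ^ m + Real.goldenRatio ^ l) /
        Real.goldenRatio ^ (n - 65)) ?_ ?_ hn (by omega) ?_ a
    · rw [Nat.pow_eq, Nat.cast_pow]
      exact (phiFloor_pow_le 65).trans
        (mul_le_mul_of_nonneg_right (le_add_of_nonneg_right hu0.le) (by positivity))
    · rw [add_mul, Nat.add_eq, Nat.add_eq, Nat.pow_eq, Nat.pow_eq, Nat.mul_eq, Nat.cast_add,
        Nat.cast_pow, Nat.cast_pow, Nat.cast_ofNat]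
      exact add_le_add (goldenRatio_pow_mul_le 65)
        (mul_le_of_le_one_left (pow_pos two_pos _).le hu1)
    · rw [mul_add, mul_div_cancel₀ _ (hφ _).ne', ← pow_add,
        Nat.sub_add_cancel (by omega : 65 ≤ n), add_assoc]

theorem abs_goldenRatio_pow_sub_le (n : ℕ) : |Real.goldenRatio ^ n - √5 * Nat.fib n| ≤ 1 := by
  have h5 : √5 ≠ 0 := by positivity
  have h : Real.goldenRatio ^ n - √5 * Nat.fib n = Real.goldenConj ^ n := by
    rw [Real.coe_fib_eq]
    field_simp
    ring
  rw [h, abs_pow]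
  apply pow_le_one₀ (abs_nonneg _)
  rw [abs_le]
  exact ⟨Real.neg_one_lt_goldenConj.le, Real.goldenConj_neg.le.trans zero_le_one⟩

theorem abs_logb_le {R : ℝ} (h : |R - 1| ≤ 1 / 2) : |Real.logb 2 R| ≤ 4 * |R - 1| := by
  have hR : 1 / 2 ≤ R := by linarith [(abs_le.mp h).1]
  have hR0 : 0 < R := by linarith
  have h2 := Real.log_two_gt_d9
  have key : |Real.log R| ≤ 2 * |R - 1| := by
    rw [abs_le]
    constructor
    · have h1 := Real.one_sub_inv_le_log_of_pos hR0
      have h3 : -(2 * |R - 1|) ≤ 1 - R⁻¹ := by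
        have : 1 - R⁻¹ = (R - 1) * R⁻¹ := by field_simp
        have hi : R⁻¹ ≤ 2 := by
          rw [inv_le_comm₀ hR0 (by norm_num)]; linarith
        have h4 : |(R - 1) * R⁻¹| ≤ |R - 1| * 2 := by
          rw [abs_mul, abs_of_pos (inv_pos.mpr hR0)]; gcongr
        rw [this]
        linarith [neg_abs_le ((R - 1) * R⁻¹)]
      linarith
    · have h1 := Real.log_le_sub_one_of_pos hR0
      linarith [le_abs_self (R - 1), abs_nonneg (R - 1)]
  rw [Real.logb, abs_div, abs_of_pos (by linarith : (0 : ℝ) < Real.log 2),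
    div_le_iff₀ (by linarith)]
  nlinarith [abs_nonneg (R - 1)]

theorem logb_sum_pow_near {n m l a : ℕ} (ha : 200 ≤ a)
    (h : |(Nat.fib n : ℝ) + Nat.fib m + Nat.fib l - 2 ^ a| < (2 : ℝ) ^ ((a : ℝ) / 2)) :
    |Real.logb 2 (Real.goldenRatio ^ n + Real.goldenRatio ^ m + Real.goldenRatio ^ l) -
      Real.logb 2 5 / 2 - a| ≤ 1 / 2 ^ 64 := by
  set Z := Real.goldenRatio ^ n + Real.goldenRatio ^ m + Real.goldenRatio ^ l with hZ
  set x : ℝ := (2 : ℝ) ^ ((a : ℝ) / 2) with hx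
  have hZ0 : 0 < Z := by
    have := Real.goldenRatio_pos
    positivity
  have hxx : x ^ 2 = 2 ^ a := by
    rw [hx, ← Real.rpow_natCast, ← Real.rpow_mul (by norm_num), ← Real.rpow_natCast]
    congr 1
    push_cast
    ring
  have hx100 : 2 ^ 100 ≤ x := by
    rw [hx, ← Real.rpow_natCast]
    apply Real.rpow_le_rpow_of_exponent_le (by norm_num)
    have : (200 : ℝ) ≤ a := by exact_mod_cast ha
    push_cast
    linarith
  have hs : (2 : ℝ) ≤ √5 := Real.le_sqrt_of_sq_le (by norm_num)
  have hx0 : 0 < x := lt_of_lt_of_le (by positivity) hx100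
  have hZx : |Z - √5 * x ^ 2| ≤ √5 * x + 3 := by
    have e : Z - √5 * x ^ 2 = (Real.goldenRatio ^ n - √5 * Nat.fib n) +
        (Real.goldenRatio ^ m - √5 * Nat.fib m) + (Real.goldenRatio ^ l - √5 * Nat.fib l) +
        √5 * ((Nat.fib n : ℝ) + Nat.fib m + Nat.fib l - 2 ^ a) := by
      rw [hxx, hZ]; ring
    have h4 : |√5 * ((Nat.fib n : ℝ) + Nat.fib m + Nat.fib l - 2 ^ a)| ≤ √5 * x := by
      rw [abs_mul, abs_of_nonneg (Real.sqrt_nonneg 5)]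
      gcongr
    rw [e]
    refine (abs_add_le _ _).trans ?_
    have h5 := abs_add_three (Real.goldenRatio ^ n - √5 * Nat.fib n)
      (Real.goldenRatio ^ m - √5 * Nat.fib m) (Real.goldenRatio ^ l - √5 * Nat.fib l)
    linarith [abs_goldenRatio_pow_sub_le n, abs_goldenRatio_pow_sub_le m,
      abs_goldenRatio_pow_sub_le l]
  have hR : |Z / (√5 * 2 ^ a) - 1| ≤ 1 / 2 ^ 98 := by
    rw [← hxx, div_sub_one (by positivity), abs_div, abs_of_pos (by positivity : 0 < √5 * x ^ 2),
      div_le_iff₀ (by positivity)]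
    have : √5 * x * 2 ^ 100 ≤ √5 * x * x := by gcongr
    nlinarith
  have hlog : Real.logb 2 (Z / (√5 * 2 ^ a)) = Real.logb 2 Z - Real.logb 2 5 / 2 - a := by
    rw [Real.logb_div hZ0.ne' (by positivity), Real.logb_mul (by positivity) (by positivity),
      Real.logb_pow, Real.logb_self_eq_one (by norm_num), Real.logb, Real.logb, Real.logb,
      Real.log_sqrt (by norm_num)]
    ring
  rw [← hlog]
  refine (abs_logb_le (hR.trans (by norm_num))).trans ?_
  linarith

theorem case_three_bounds
    (n m l a : ℕ) (hnm : m < n) (hml : l < m) (hl : 1 < l) (ha : 2 ≤ a)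
    (h : |(Nat.fib n : ℝ) + Nat.fib m + Nat.fib l - 2 ^ a| < (2 : ℝ) ^ ((a : ℝ) / 2))
    (h1 : (n : ℝ) * (1 - Real.log ((1 + Real.sqrt 5) / 2) / Real.log 2) - 1 <
      (n : ℝ) - a)
    (h2 : ((n : ℝ) - a) * Real.log ((1 + Real.sqrt 5) / 2) <
      2.4 * 10 ^ 12 * Real.log n) :
    (a : ℝ) < 3.84 * 10 ^ 14 ∧ (n : ℝ) < 5.53 * 10 ^ 14 := by
  have hlogn : Real.log n ≤ 33.95 + (n / (5.54 * 10 ^ 14) - 1) := by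
    have hn0 : (0 : ℝ) < n := by exact_mod_cast (by omega : 0 < n)
    have e : Real.log n = Real.log (5.54 * 10 ^ 14) + Real.log (n / (5.54 * 10 ^ 14)) := by
      rw [← Real.log_mul (by norm_num) (by positivity), mul_div_cancel₀ _ (by norm_num)]
    have e2 : Real.log (5.54 * 10 ^ 14) = 49 * Real.log 2 + Real.log (5.54 * 10 ^ 14 / 2 ^ 49) := by
      rw [Real.log_div (by norm_num) (by norm_num), Real.log_pow]
      push_cast; ring
    have e3 := Real.log_le_sub_one_of_pos (by norm_num : (0 : ℝ) < 5.54 * 10 ^ 14 / 2 ^ 49)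
    have e4 := Real.log_le_sub_one_of_pos (by positivity : (0 : ℝ) < n / (5.54 * 10 ^ 14))
    have := Real.log_two_lt_d9
    rw [e, e2]
    norm_num at e3 ⊢
    linarith
  have hθ : Real.log ((1 + √5) / 2) = Real.logb 2 Real.goldenRatio * Real.log 2 := by
    rw [Real.logb, div_mul_cancel₀ _ (Real.log_pos (by norm_num)).ne', Real.goldenRatio]
  rw [hθ, mul_div_cancel_right₀ _ (Real.log_pos (by norm_num)).ne'] at h1
  rw [hθ] at h2
  obtain ⟨hθ1, hθ2⟩ := logb_goldenRatio_bounds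
  set θ := Real.logb 2 Real.goldenRatio
  have hlog2 := Real.log_two_gt_d9
  have hθ3 : 0.69424191 ≤ θ := by linarith
  have hθ4 : θ ≤ 0.69424192 := by linarith
  have hc : 0.481211822 ≤ θ * Real.log 2 := by nlinarith
  have hn54 : (n : ℝ) < 5.54 * 10 ^ 14 := by
    by_contra! hge
    have : 0.30575808 * (n : ℝ) - 1 ≤ n - a := by nlinarith
    have : (0.30575808 * (n : ℝ) - 1) * 0.481211822 ≤ (n - a) * (θ * Real.log 2) := by
      apply mul_le_mul this hc <;> linarith
    linarith
  have ha0 : 200 ≤ (a : ℝ) ∨ (n : ℝ) < 5.53 * 10 ^ 14 := by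
    by_contra! hc'
    have : ((n : ℝ) - a) * 0.481211822 ≤ (n - a) * (θ * Real.log 2) := by
      apply mul_le_mul_of_nonneg_left hc; linarith
    linarith
  have hn53 : (n : ℝ) < 5.53 * 10 ^ 14 := by
    by_contra! hge
    refine (logb_sum_pow_near (by exact_mod_cast ha0.resolve_right hge.not_gt) h).not_gt
      (logb_sum_pow_not_near hnm hml ?_ a)
    rw [abs_le]
    constructor <;> linarith
  refine ⟨?_, hn53⟩
  nlinarith
end
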